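/- arXiv:1802.02723 — 3 statements merged into one kernel-verified Lean document; each statement's English description precedes it below -/
import Mathlib

section
/- For every integer n ≥ 1 and every λ ∈ ℂ, set L := sup_{z∈ℂ} (f_λ^{n−1})^#(z) and ε := (4L)^{−1/(d−1)}. If |F_n(λ)| < (√2 − 1)·(2^{d+1}·L)^{−1/(d−1)}, then f_λ^n maps the closed chordal disc {z ∈ ℂ : [z,0] ≤ [ε,0]} into the open chordal disc {z ∈ ℂ : [z,0] < [ε,0]}; in particular f_λ^n has a fixed point z₀ with [z₀,0] < [ε,0]. Consequently, if 0 is not contained in the immediate basin of a (super)attracting cycle of f_λ in ℂ, then |F_n(λ)| ≥ (√2 − 1)·(2^{d+1}·L)^{−1/(d−1)}. -/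
/- STATEMENT 4:
For every n ≥ 1 and λ ∈ ℂ, set L := sup_{z∈ℂ} (f_λ^{n−1})^#(z) and ε := (4L)^{−1/(d−1)}.
If |F_n(λ)| < (√2 − 1)·(2^{d+1}·L)^{−1/(d−1)}, then f_λ^n maps the closed chordal disc
{z ∈ ℂ : [z,0] ≤ [ε,0]} into the open chordal disc {z ∈ ℂ : [z,0] < [ε,0]}; in particular
f_λ^n has a fixed point z₀ with [z₀,0] < [ε,0]. Consequently, if 0 is not contained in the
immediate basin of a (super)attracting cycle of f_λ in ℂ, then
|F_n(λ)| ≥ (√2 − 1)·(2^{d+1}·L)^{−1/(d−1)}. -/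

noncomputable def fc (d : ℕ) (lam z : ℂ) : ℂ := z ^ d + lam

noncomputable def chord (z w : ℂ) : ℝ :=
  ‖z - w‖ / (Real.sqrt (1 + ‖z‖ ^ 2) * Real.sqrt (1 + ‖w‖ ^ 2))

noncomputable def csharp (h : ℂ → ℂ) (z : ℂ) : ℝ :=
  ‖deriv h z‖ * (1 + ‖z‖ ^ 2) / (1 + ‖h z‖ ^ 2)

/-- `0` lies in the immediate basin of a (super)attracting cycle of `f_λ` in `ℂ`:
there are a cycle point `p` of some exact-or-not period `k ≥ 1` with multiplier of
modulus `< 1`, and a connected open set containing both `0` and `p` all of whose points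
converge to `p` under iteration of `f_λ^k`. -/
def zeroInImmediateBasin (d : ℕ) (lam : ℂ) : Prop :=
  ∃ k : ℕ, 1 ≤ k ∧ ∃ p : ℂ, (fc d lam)^[k] p = p ∧ ‖deriv ((fc d lam)^[k]) p‖ < 1 ∧
    ∃ U : Set ℂ, IsOpen U ∧ IsConnected U ∧ (0 : ℂ) ∈ U ∧ p ∈ U ∧
      ∀ z ∈ U, Filter.Tendsto (fun m : ℕ => (fc d lam)^[m * k] z) Filter.atTop (nhds p)

lemma fc_differentiable (d : ℕ) (lam : ℂ) : Differentiable ℂ (fc d lam) := by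
  unfold fc; fun_prop

lemma fc_hasDerivAt (d : ℕ) (lam z : ℂ) : HasDerivAt (fc d lam) (d * z ^ (d - 1)) z := by
  unfold fc
  exact (hasDerivAt_pow d z).add_const lam

lemma iter_differentiable (d k : ℕ) (lam : ℂ) : Differentiable ℂ ((fc d lam)^[k]) :=
  (fc_differentiable d lam).iterate k

lemma csharp_nonneg (h : ℂ → ℂ) (z : ℂ) : 0 ≤ csharp h z := by
  unfold csharp; positivity

lemma csharp_fc_le (d : ℕ) (hd : 1 < d) (lam z : ℂ) :
    csharp (fc d lam) z ≤ 4 * d * (1 + ‖lam‖ ^ 2) := by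
  unfold csharp
  rw [(fc_hasDerivAt d lam z).deriv, div_le_iff₀ (by positivity), norm_mul, norm_pow,
    Complex.norm_natCast]
  set r := ‖z‖ with hr
  have hr0 : 0 ≤ r := norm_nonneg z
  have h1 : ∀ m : ℕ, m ≤ 2 * d → r ^ m ≤ 1 + r ^ (2 * d) := by
    intro m hm
    rcases le_total r 1 with h | h
    · have := pow_le_one₀ (n := m) hr0 h
      have : 0 ≤ r ^ (2 * d) := by positivity
      linarith
    · have := pow_le_pow_right₀ h hm
      linarith
  have h2 : r ^ (d - 1) * (1 + r ^ 2) ≤ 2 * (1 + r ^ (2 * d)) := by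
    have a := h1 (d - 1) (by omega)
    have b := h1 (d - 1 + 2) (by omega)
    rw [pow_add] at b
    linarith
  have h3 : r ^ d ≤ ‖fc d lam z‖ + ‖lam‖ := by
    have : z ^ d = fc d lam z - lam := by simp [fc]
    rw [hr, ← norm_pow, this]
    exact norm_sub_le _ _
  have h4 : 1 + r ^ (2 * d) ≤ 2 * (1 + ‖lam‖ ^ 2) * (1 + ‖fc d lam z‖ ^ 2) := by
    have e : r ^ (2 * d) = (r ^ d) ^ 2 := by rw [← pow_mul, mul_comm]
    rw [e]
    have h5 : (r ^ d) ^ 2 ≤ (‖fc d lam z‖ + ‖lam‖) ^ 2 := by gcongr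
    nlinarith [sq_nonneg (‖fc d lam z‖ - ‖lam‖), sq_nonneg (‖fc d lam z‖ * ‖lam‖)]
  have hd0 : (0 : ℝ) ≤ d := by positivity
  calc (d : ℝ) * r ^ (d - 1) * (1 + r ^ 2) = d * (r ^ (d - 1) * (1 + r ^ 2)) := by ring
    _ ≤ d * (2 * (2 * (1 + ‖lam‖ ^ 2) * (1 + ‖fc d lam z‖ ^ 2))) := by
        exact mul_le_mul_of_nonneg_left (by linarith) hd0
    _ = _ := by ring

lemma csharp_comp (g f : ℂ → ℂ) (hg : Differentiable ℂ g) (hf : Differentiable ℂ f) (z : ℂ) :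
    csharp (g ∘ f) z = csharp g (f z) * csharp f z := by
  unfold csharp
  rw [deriv_comp z (hg _) (hf _), norm_mul, Function.comp]
  have h1 : 1 + ‖f z‖ ^ 2 ≠ 0 := by positivity
  have h2 : 1 + ‖g (f z)‖ ^ 2 ≠ 0 := by positivity
  field_simp

lemma csharp_iter_le (d : ℕ) (hd : 1 < d) (lam : ℂ) (k : ℕ) :
    ∀ z, csharp ((fc d lam)^[k]) z ≤ (4 * d * (1 + ‖lam‖ ^ 2)) ^ k := by
  induction k with
  | zero =>
    intro z
    have h1 : 1 + ‖z‖ ^ 2 ≠ 0 := by positivity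
    simp [csharp, h1]
  | succ k ih =>
    intro z
    rw [Function.iterate_succ, csharp_comp _ _ (iter_differentiable d k lam)
      (fc_differentiable d lam), pow_succ]
    exact mul_le_mul (ih _) (csharp_fc_le d hd lam z) (csharp_nonneg _ _) (by positivity)

lemma csharp_le_sup (d : ℕ) (hd : 1 < d) (lam : ℂ) (k : ℕ) (z : ℂ) :
    csharp ((fc d lam)^[k]) z ≤ ⨆ z : ℂ, csharp ((fc d lam)^[k]) z := by
  refine le_ciSup (f := fun z => csharp ((fc d lam)^[k]) z) ⟨(4 * d * (1 + ‖lam‖ ^ 2)) ^ k, ?_⟩ z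
  rintro _ ⟨w, rfl⟩
  exact csharp_iter_le d hd lam k w

lemma fc_surj (d : ℕ) (hd : 1 < d) (lam : ℂ) : Function.Surjective (fc d lam) := by
  intro w
  obtain ⟨z, hz⟩ := IsAlgClosed.exists_pow_nat_eq (w - lam) (show 0 < d by omega)
  exact ⟨z, by simp [fc, hz]⟩

lemma fc_growth (d : ℕ) (hd : 1 < d) (lam z : ℂ) (hz : 2 + ‖lam‖ ≤ ‖z‖) :
    ‖z‖ ≤ ‖fc d lam z‖ := by
  have h0 := norm_nonneg lam
  have h1 : ‖z‖ ^ 2 ≤ ‖z‖ ^ d := pow_le_pow_right₀ (by linarith) (by omega)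
  have h2 : ‖z ^ d‖ - ‖lam‖ ≤ ‖fc d lam z‖ := by
    unfold fc
    have := norm_sub_le (z ^ d + lam) lam
    rw [add_sub_cancel_right] at this
    linarith
  rw [norm_pow] at h2
  nlinarith

lemma iter_growth (d : ℕ) (hd : 1 < d) (lam : ℂ) (k : ℕ) :
    ∀ z, 2 + ‖lam‖ ≤ ‖z‖ → ‖z‖ ≤ ‖(fc d lam)^[k] z‖ := by
  induction k with
  | zero => intro z _; simp
  | succ k ih =>
    intro z hz
    have := fc_growth d hd lam z hz
    rw [Function.iterate_succ_apply]
    exact this.trans (ih _ (hz.trans this))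

lemma norm_deriv_le (g : ℂ → ℂ) (L : ℝ) (hL : ∀ z, csharp g z ≤ L) (z : ℂ) :
    ‖deriv g z‖ ≤ L * (1 + ‖g z‖ ^ 2) / (1 + ‖z‖ ^ 2) := by
  have := hL z
  unfold csharp at this
  rw [div_le_iff₀ (by positivity)] at this
  rw [le_div_iff₀ (by positivity)]
  exact this

lemma L_ge_one (g : ℂ → ℂ) (hg : Differentiable ℂ g) (z₀ : ℂ) (hz₀ : g z₀ = 0)
    (R₀ : ℝ) (hgr : ∀ z, R₀ ≤ ‖z‖ → ‖z‖ ≤ ‖g z‖) (L : ℝ) (hL : ∀ z, csharp g z ≤ L) : 1 ≤ L := by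
  by_contra hlt
  push Not at hlt
  have hL0 : 0 ≤ L := (csharp_nonneg g 0).trans (hL 0)
  obtain ⟨c, hc1, hc2⟩ := exists_between hlt
  have hc0 : 0 < c := by linarith
  set u : ℂ := Complex.exp (z₀.arg * Complex.I) with hu
  have hun : ‖u‖ = 1 := Complex.norm_exp_ofReal_mul_I _
  have hz₀u : (‖z₀‖ : ℂ) * u = z₀ := Complex.norm_mul_exp_arg_mul_I z₀
  have harg : ∀ t : ℝ, 0 ≤ t → 0 ≤ c * Real.arctan t ∧ c * Real.arctan t < c * (Real.pi / 2) := by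
    intro t ht
    have h1 := Real.arctan_lt_pi_div_two t
    have h2 : 0 ≤ Real.arctan t := by simpa using Real.arctan_mono ht
    exact ⟨by positivity, by nlinarith⟩
  have hpi := Real.pi_pos
  have hcpi : c * (Real.pi / 2) < Real.pi / 2 := by nlinarith
  have key : ∀ R : ℝ, ‖z₀‖ ≤ R → ‖g (R * u)‖ ≤ Real.tan (c * (Real.pi / 2)) := by
    intro R hR
    have hder : ∀ t : ℝ, HasDerivAt (fun t : ℝ => g (t * u)) (deriv g (t * u) * u) t := by
      intro t
      have h1 : HasDerivAt (fun t : ℝ => (t : ℂ) * u) u t := by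
        simpa using (Complex.ofRealCLM.hasDerivAt (x := t)).mul_const u
      have := (hg (t * u)).hasDerivAt.comp_of_eq t h1 rfl
      exact this
    have hB : ∀ t : ℝ, 0 ≤ t → HasDerivAt (fun t : ℝ => Real.tan (c * Real.arctan t))
        (1 / Real.cos (c * Real.arctan t) ^ 2 * (c * (1 / (1 + t ^ 2)))) t := by
      intro t ht
      have hcos : Real.cos (c * Real.arctan t) ≠ 0 := by
        refine (Real.cos_pos_of_mem_Ioo ⟨?_, ?_⟩).ne'
        · linarith [(harg t ht).1]
        · linarith [(harg t ht).2]
      have h1 := (Real.hasDerivAt_arctan t).const_mul c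
      exact (Real.hasDerivAt_tan hcos).comp t h1
    have main := image_norm_le_of_norm_deriv_right_lt_deriv_boundary' (a := ‖z₀‖) (b := R)
      (f := fun t : ℝ => g (t * u)) (f' := fun t : ℝ => deriv g (t * u) * u)
      (B := fun t : ℝ => Real.tan (c * Real.arctan t))
      (B' := fun t => 1 / Real.cos (c * Real.arctan t) ^ 2 * (c * (1 / (1 + t ^ 2))))
      (fun t _ => (hder t).continuousAt.continuousWithinAt)
      (fun t _ => (hder t).hasDerivWithinAt)
      (by
        simp only [hz₀u, hz₀, norm_zero]
        have := harg ‖z₀‖ (norm_nonneg _)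
        exact Real.tan_nonneg_of_nonneg_of_le_pi_div_two this.1 (by linarith [this.2]))
      (fun t ht => (hB t ((norm_nonneg _).trans ht.1)).continuousAt.continuousWithinAt)
      (fun t ht => (hB t ((norm_nonneg _).trans ht.1)).hasDerivWithinAt)
      (by
        intro t ht heq
        have ht0 : 0 ≤ t := (norm_nonneg _).trans ht.1
        have hcos : Real.cos (c * Real.arctan t) ≠ 0 := by
          refine (Real.cos_pos_of_mem_Ioo ⟨?_, ?_⟩).ne'
          · linarith [(harg t ht0).1]
          · linarith [(harg t ht0).2]
        have h1 := norm_deriv_le g L hL (t * u)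
        rw [heq] at h1
        have h2 : ‖(t : ℂ) * u‖ = t := by
          rw [norm_mul, hun, mul_one, Complex.norm_real, Real.norm_of_nonneg ht0]
        rw [h2] at h1
        rw [norm_mul, hun, mul_one]
        refine h1.trans_lt ?_
        have h3 : 1 / Real.cos (c * Real.arctan t) ^ 2 = 1 + Real.tan (c * Real.arctan t) ^ 2 := by
          rw [← Real.inv_one_add_tan_sq hcos]; simp
        rw [h3, mul_one_div, ← mul_div_assoc, mul_comm L]
        gcongr)
    have := main (x := R) ⟨hR, le_rfl⟩
    refine this.trans ?_
    have hR0 : 0 ≤ R := (norm_nonneg _).trans hR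
    have h := harg R hR0
    exact (Real.tan_lt_tan_of_nonneg_of_lt_pi_div_two h.1 hcpi h.2).le
  set T := Real.tan (c * (Real.pi / 2))
  set R := max (max ‖z₀‖ R₀) (T + 1) with hR
  have hR1 : ‖z₀‖ ≤ R := (le_max_left _ _).trans (le_max_left _ _)
  have hR2 : R₀ ≤ R := (le_max_right _ _).trans (le_max_left _ _)
  have hR3 : T + 1 ≤ R := le_max_right _ _
  have hn : ‖(R : ℂ) * u‖ = R := by
    rw [norm_mul, hun, mul_one, Complex.norm_real,
      Real.norm_of_nonneg ((norm_nonneg _).trans hR1)]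
  have := hgr (R * u) (by rw [hn]; exact hR2)
  rw [hn] at this
  linarith [key R hR1]

lemma chord_zero_lt_iff (z w : ℂ) : chord z 0 < chord w 0 ↔ ‖z‖ < ‖w‖ := by
  unfold chord
  simp only [sub_zero, norm_zero, ne_eq, OfNat.ofNat_ne_zero, not_false_eq_true, zero_pow,
    add_zero, Real.sqrt_one, mul_one]
  have ha := norm_nonneg z
  have hb := norm_nonneg w
  rw [← abs_of_nonneg (show 0 ≤ ‖z‖ / √(1 + ‖z‖ ^ 2) by positivity),
    ← abs_of_nonneg (show 0 ≤ ‖w‖ / √(1 + ‖w‖ ^ 2) by positivity), ← sq_lt_sq, div_pow, div_pow,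
    Real.sq_sqrt (by positivity), Real.sq_sqrt (by positivity),
    div_lt_div_iff₀ (by positivity) (by positivity), ← abs_of_nonneg ha, ← abs_of_nonneg hb,
    ← sq_lt_sq]
  simp only [abs_norm]
  constructor <;> intro h <;> nlinarith

lemma chord_zero_le_iff (z w : ℂ) : chord z 0 ≤ chord w 0 ↔ ‖z‖ ≤ ‖w‖ := by
  rw [← not_lt, chord_zero_lt_iff, not_lt]

lemma d_bound (m : ℕ) : ((m + 2 : ℕ) : ℝ) * (3 / 5 : ℝ) ^ (m + 1) ≤ 6 / 5 := by
  induction m with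
  | zero => norm_num
  | succ m ih =>
    rw [pow_succ]
    push_cast at *
    have : (0 : ℝ) < (3 / 5 : ℝ) ^ (m + 1) := by positivity
    have hm : (0 : ℝ) ≤ m := by positivity
    nlinarith

/-- The disc of radius `ε` is mapped into the disc of radius `3ε/5`. -/
lemma maps_disc (d : ℕ) (hd : 1 < d) (g : ℂ → ℂ) (hg : Differentiable ℂ g) (lam : ℂ) (L ε : ℝ)
    (hL1 : 1 ≤ L) (hL : ∀ z, csharp g z ≤ L) (hε0 : 0 < ε) (hε1 : ε ≤ 1)
    (hε : L * ε ^ (d - 1) = 1 / 4) (hF : ‖g lam‖ < (Real.sqrt 2 - 1) * (ε / 2))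
    (z : ℂ) (hz : ‖z‖ ≤ ε) : ‖g (fc d lam z)‖ ≤ 3 / 5 * ε := by
  have hs : Real.sqrt 2 < 1.42 := by
    rw [Real.sqrt_lt' (by norm_num)]; norm_num
  have hF' : ‖g lam‖ ≤ 0.21 * ε := by nlinarith
  have hzd : L * ‖z‖ ^ d ≤ ε / 4 := by
    have : ε ^ d = ε ^ (d - 1) * ε := by rw [← pow_succ]; congr 1; omega
    calc L * ‖z‖ ^ d ≤ L * ε ^ d := by gcongr
      _ = (L * ε ^ (d - 1)) * ε := by rw [this]; ring
      _ = ε / 4 := by rw [hε]; ring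
  have hder : ∀ t : ℝ, HasDerivAt (fun t : ℝ => g (t * z ^ d + lam))
      (deriv g (t * z ^ d + lam) * z ^ d) t := by
    intro t
    have h1 : HasDerivAt (fun t : ℝ => (t : ℂ) * z ^ d + lam) (z ^ d) t := by
      simpa using ((Complex.ofRealCLM.hasDerivAt (x := t)).mul_const (z ^ d)).add_const lam
    exact (hg (t * z ^ d + lam)).hasDerivAt.comp_of_eq t h1 rfl
  have hB : ∀ t : ℝ, HasDerivAt (fun t : ℝ => 0.21 * ε + 0.35 * ε * t) (0.35 * ε) t := by
    intro t
    simpa using ((hasDerivAt_id t).const_mul (0.35 * ε)).const_add (0.21 * ε)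
  have main := image_norm_le_of_norm_deriv_right_lt_deriv_boundary' (a := 0) (b := 1)
      (f := fun t : ℝ => g (t * z ^ d + lam)) (f' := fun t : ℝ => deriv g (t * z ^ d + lam) * z ^ d)
      (B := fun t : ℝ => 0.21 * ε + 0.35 * ε * t)
      (B' := fun t => 0.35 * ε)
      (fun t _ => (hder t).continuousAt.continuousWithinAt)
      (fun t _ => (hder t).hasDerivWithinAt)
      (by simpa using hF')
      (fun t ht => (hB t).continuousAt.continuousWithinAt)
      (fun t ht => (hB t).hasDerivWithinAt)
      (by
        intro t ht heq
        have h1 := norm_deriv_le g L hL (t * z ^ d + lam)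
        rw [heq] at h1
        have hb0 : 0 ≤ 0.21 * ε + 0.35 * ε * t := by
          have := ht.1
          positivity
        have hb : 0.21 * ε + 0.35 * ε * t ≤ 0.6 := by nlinarith [ht.1, ht.2]
        have h2 : ‖deriv g (t * z ^ d + lam)‖ ≤ L * 1.36 := by
          refine h1.trans ((div_le_self (by positivity) ?_).trans ?_)
          · nlinarith [sq_nonneg ‖(t : ℂ) * z ^ d + lam‖]
          · gcongr; nlinarith
        rw [norm_mul, norm_pow]
        calc _ ≤ L * 1.36 * ‖z‖ ^ d := by gcongr
          _ = 1.36 * (L * ‖z‖ ^ d) := by ring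
          _ ≤ 1.36 * (ε / 4) := by gcongr
          _ < _ := by linarith)
  have := main (x := 1) ⟨zero_le_one, le_rfl⟩
  simp only [Complex.ofReal_one, one_mul] at this
  unfold fc
  linarith

lemma deriv_disc (d : ℕ) (hd : 1 < d) (g : ℂ → ℂ) (hg : Differentiable ℂ g) (lam : ℂ) (L ε : ℝ)
    (hL1 : 1 ≤ L) (hL : ∀ z, csharp g z ≤ L) (hε0 : 0 < ε) (hε1 : ε ≤ 1)
    (hε : L * ε ^ (d - 1) = 1 / 4)
    (z : ℂ) (hz : ‖z‖ ≤ 3 / 5 * ε) (hgz : ‖g (fc d lam z)‖ ≤ 3 / 5 * ε) :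
    ‖deriv (g ∘ fc d lam) z‖ ≤ 1 / 2 := by
  rw [deriv_comp z (hg _) (fc_differentiable d lam _), (fc_hasDerivAt d lam z).deriv, norm_mul,
    norm_mul, norm_pow, Complex.norm_natCast]
  have h1 := norm_deriv_le g L hL (fc d lam z)
  have h2 : ‖deriv g (fc d lam z)‖ ≤ L * 1.36 := by
    refine h1.trans ((div_le_self (by positivity) ?_).trans ?_)
    · nlinarith [sq_nonneg ‖fc d lam z‖]
    · have := norm_nonneg (g (fc d lam z))
      gcongr; nlinarith
  have h3 : (d : ℝ) * (3 / 5 : ℝ) ^ (d - 1) ≤ 6 / 5 := by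
    obtain ⟨m, rfl⟩ := Nat.exists_eq_add_of_le' (show 2 ≤ d by omega)
    exact d_bound m
  calc _ ≤ L * 1.36 * (d * (3 / 5 * ε) ^ (d - 1)) := by gcongr
    _ = 1.36 * (L * ε ^ (d - 1)) * (d * (3 / 5) ^ (d - 1)) := by rw [mul_pow]; ring
    _ ≤ 1.36 * (1 / 4) * (6 / 5) := by rw [hε]; gcongr
    _ ≤ 1 / 2 := by norm_num

lemma disc_conv (G : ℂ → ℂ) (hG : Differentiable ℂ G) (r : ℝ) (hr : 0 ≤ r)
    (hmap : ∀ z, ‖z‖ ≤ r → ‖G z‖ ≤ r) (hder : ∀ z, ‖z‖ ≤ r → ‖deriv G z‖ ≤ 1 / 2) :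
    ∃ p, ‖p‖ ≤ r ∧ G p = p ∧ ∀ z, ‖z‖ ≤ r →
      Filter.Tendsto (fun m : ℕ => G^[m] z) Filter.atTop (nhds p) := by
  have hms : Set.MapsTo G (Metric.closedBall 0 r) (Metric.closedBall 0 r) := by
    intro z hz
    rw [mem_closedBall_zero_iff] at *
    exact hmap z hz
  have hlip : LipschitzOnWith (1 / 2) G (Metric.closedBall 0 r) := by
    refine (convex_closedBall 0 r).lipschitzOnWith_of_nnnorm_deriv_le (𝕜 := ℂ)
      (fun z _ => hG z) ?_
    intro z hz
    rw [mem_closedBall_zero_iff] at hz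
    have := hder z hz
    rw [← NNReal.coe_le_coe]
    simpa using this
  have hc : ContractingWith (1 / 2) (hms.restrict G _ _) := by
    refine ⟨?_, hlip.mapsToRestrict hms⟩
    rw [← NNReal.coe_lt_coe]; norm_num
  have hcomp : IsComplete (Metric.closedBall (0 : ℂ) r) := Metric.isClosed_closedBall.isComplete
  have ex : ∀ z, ‖z‖ ≤ r → ∃ p, ‖p‖ ≤ r ∧ G p = p ∧
      Filter.Tendsto (fun m : ℕ => G^[m] z) Filter.atTop (nhds p) := by
    intro z hz
    obtain ⟨y, hy, hfy, ht, -⟩ := hc.exists_fixedPoint' hcomp hms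
      (x := z) (by rwa [mem_closedBall_zero_iff]) (edist_ne_top _ _)
    exact ⟨y, by rwa [mem_closedBall_zero_iff] at hy, hfy, ht⟩
  obtain ⟨p, hp, hGp, -⟩ := ex 0 (by simpa using hr)
  refine ⟨p, hp, hGp, fun z hz => ?_⟩
  obtain ⟨q, hq, hGq, ht⟩ := ex z hz
  have : q = p := by
    have h := hlip.dist_le_mul q (by rwa [mem_closedBall_zero_iff]) p
      (by rwa [mem_closedBall_zero_iff])
    rw [hGq, hGp] at h
    simp only [NNReal.coe_div, NNReal.coe_one, NNReal.coe_ofNat] at h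
    have := dist_nonneg (x := q) (y := p)
    exact dist_le_zero.1 (by linarith)
  rwa [this] at ht

theorem statement4 (d : ℕ) (hd : 1 < d) (n : ℕ) (hn : 1 ≤ n) (lam : ℂ) (L ε : ℝ)
    (hL : L = ⨆ z : ℂ, csharp ((fc d lam)^[n - 1]) z)
    (hε : ε = (4 * L) ^ (-(1 : ℝ) / ((d : ℝ) - 1))) :
    ((‖(fc d lam)^[n] 0‖ < (Real.sqrt 2 - 1) * (2 ^ (d + 1) * L) ^ (-(1 : ℝ) / ((d : ℝ) - 1))) →
      (∀ z : ℂ, chord z 0 ≤ chord (ε : ℂ) 0 → chord ((fc d lam)^[n] z) 0 < chord (ε : ℂ) 0) ∧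
      (∃ z₀ : ℂ, (fc d lam)^[n] z₀ = z₀ ∧ chord z₀ 0 < chord (ε : ℂ) 0)) ∧
    (¬ zeroInImmediateBasin d lam →
      (Real.sqrt 2 - 1) * (2 ^ (d + 1) * L) ^ (-(1 : ℝ) / ((d : ℝ) - 1)) ≤ ‖(fc d lam)^[n] 0‖) := by
  obtain ⟨k, rfl⟩ := Nat.exists_eq_add_of_le' hn
  simp only [Nat.add_sub_cancel] at hL
  set g := (fc d lam)^[k] with hgdef
  have hg : Differentiable ℂ g := iter_differentiable d k lam
  have hLs : ∀ z, csharp g z ≤ L := fun z => by rw [hL]; exact csharp_le_sup d hd lam k z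
  obtain ⟨z₀, hz₀⟩ := (fc_surj d hd lam).iterate k 0
  have hL1 : 1 ≤ L := L_ge_one g hg z₀ hz₀ (2 + ‖lam‖) (iter_growth d hd lam k) L hLs
  have hG : (fc d lam)^[k + 1] = g ∘ fc d lam := Function.iterate_succ _ _
  have hd1 : (0 : ℝ) < (d : ℝ) - 1 := by
    have : (1 : ℝ) < d := by exact_mod_cast hd
    linarith
  have hdc : ((d - 1 : ℕ) : ℝ) = (d : ℝ) - 1 := by
    rw [Nat.cast_sub hd.le]; simp
  have hε0 : 0 < ε := by rw [hε]; positivity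
  have hεp : ε ^ (d - 1) = (4 * L)⁻¹ := by
    rw [hε, ← Real.rpow_natCast, ← Real.rpow_mul (by positivity), hdc,
      div_mul_cancel₀ _ hd1.ne', Real.rpow_neg_one]
  have hε4 : L * ε ^ (d - 1) = 1 / 4 := by
    rw [hεp]; field_simp
  have hε1 : ε ≤ 1 := by
    rw [hε]
    refine Real.rpow_le_one_of_one_le_of_nonpos (by linarith) ?_
    exact div_nonpos_of_nonpos_of_nonneg (by norm_num) hd1.le
  have hhalf : ((2 : ℝ) ^ (d + 1) * L) ^ (-(1 : ℝ) / ((d : ℝ) - 1)) = ε / 2 := by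
    have e1 : (2 : ℝ) ^ (d + 1) * L = (2 : ℝ) ^ (d - 1) * (4 * L) := by
      have : d + 1 = (d - 1) + 2 := by omega
      rw [this, pow_add]; ring
    rw [e1, Real.mul_rpow (by positivity) (by positivity), ← hε, ← Real.rpow_natCast,
      ← Real.rpow_mul (by norm_num), hdc, mul_div_cancel₀ _ hd1.ne', Real.rpow_neg_one]
    ring
  rw [hhalf, hG]
  have h0 : (g ∘ fc d lam) 0 = g lam := by
    have : d ≠ 0 := by omega
    simp [fc, this]
  rw [h0]
  have hεn : ‖(ε : ℂ)‖ = ε := by rw [Complex.norm_real, Real.norm_of_nonneg hε0.le]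
  have core : ‖g lam‖ < (Real.sqrt 2 - 1) * (ε / 2) →
      (∀ z : ℂ, ‖z‖ ≤ ε → ‖g (fc d lam z)‖ ≤ 3 / 5 * ε) ∧
      ∃ p, ‖p‖ ≤ 3 / 5 * ε ∧ (g ∘ fc d lam) p = p ∧ ‖deriv (g ∘ fc d lam) p‖ ≤ 1 / 2 ∧
        ∀ z, ‖z‖ ≤ 3 / 5 * ε →
        Filter.Tendsto (fun m : ℕ => (g ∘ fc d lam)^[m] z) Filter.atTop (nhds p) := by
    intro hF
    have hm := maps_disc d hd g hg lam L ε hL1 hLs hε0 hε1 hε4 hF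
    have hm' : ∀ z : ℂ, ‖z‖ ≤ 3 / 5 * ε → ‖g (fc d lam z)‖ ≤ 3 / 5 * ε :=
      fun z hz => hm z (by linarith)
    have hdv : ∀ z : ℂ, ‖z‖ ≤ 3 / 5 * ε → ‖deriv (g ∘ fc d lam) z‖ ≤ 1 / 2 :=
      fun z hz => deriv_disc d hd g hg lam L ε hL1 hLs hε0 hε1 hε4 z hz (hm' z hz)
    obtain ⟨p, hp, hGp, ht⟩ := disc_conv (g ∘ fc d lam) (hg.comp (fc_differentiable d lam))
      (3 / 5 * ε) (by positivity) hm' hdv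
    exact ⟨hm, p, hp, hGp, hdv p hp, ht⟩
  constructor
  · intro hF
    obtain ⟨hm, p, hp, hGp, -, -⟩ := core hF
    refine ⟨fun z hz => ?_, p, hGp, ?_⟩
    · rw [chord_zero_le_iff, hεn] at hz
      rw [chord_zero_lt_iff, hεn]
      exact (hm z hz).trans_lt (by linarith)
    · rw [chord_zero_lt_iff, hεn]
      linarith
  · intro hnot
    by_contra hF
    push Not at hF
    obtain ⟨hm, p, hp, hGp, hdp, ht⟩ := core hF
    refine hnot ⟨k + 1, by omega, p, by rw [hG]; exact hGp, by rw [hG]; linarith,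
      Metric.ball 0 ε, Metric.isOpen_ball, ?_, by simpa using hε0, ?_, ?_⟩
    · exact ⟨⟨0, by simpa using hε0⟩, (convex_ball 0 ε).isPreconnected⟩
    · rw [mem_ball_zero_iff]; linarith
    · intro z hz
      rw [mem_ball_zero_iff] at hz
      have h1 := ht _ (hm z hz.le)
      have e : (fun m : ℕ => (fc d lam)^[m * (k + 1)] z) = fun m => (g ∘ fc d lam)^[m] z := by
        funext m
        rw [mul_comm, Function.iterate_mul, hG]
      rw [e, ← Filter.tendsto_add_atTop_iff_nat 1]
      simpa only [Function.iterate_succ_apply, Function.comp_apply] using h1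
end

section
/- For every integer n ≥ 1 and every λ ∈ ℂ with |F_n(λ)| ≥ e^{−t_n}, one has |log|F_n(λ)| − d^{n−1}·g_I(λ)| ≤ t_n. -/
noncomputable def chordInf (z : ℂ) : ℝ := 1 / Real.sqrt (1 + ‖z‖ ^ 2)

def Mloc (d : ℕ) : Set ℂ :=
  {lam : ℂ | BddAbove (Set.range fun k : ℕ => ‖(fc d lam)^[k] 0‖)}

noncomputable def tconst (d : ℕ) (CB : ℝ) (n : ℕ) : ℝ :=
  (1 / ((d : ℝ) - 1)) * (((d : ℝ) + 1) * Real.log 2 + (2 * Real.log d) * ((n : ℝ) - 1)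
    + 4 * CB / ((d : ℝ) - 1) + ((d : ℝ) - 1) * Real.log (Real.sqrt 2 + 1))

open Filter Topology in
theorem aux_bdd_zero (d : ℕ) (hd : 1 < d) (a : ℕ → ℝ) (g C : ℝ) (m : ℕ) (hm : 1 ≤ m)
    (hb : ∀ k, ‖a (m * k)‖ ≤ C)
    (h : Tendsto (fun k : ℕ => a k / (d : ℝ) ^ (k - 1)) atTop (𝓝 g)) : g = 0 := by
  have hmt : Tendsto (fun k : ℕ => m * k) atTop atTop :=
    tendsto_id.const_mul_atTop' (by omega)
  have h1 := h.comp hmt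
  have hd1 : (1 : ℝ) < d := by exact_mod_cast hd
  have h2 : Tendsto (fun k : ℕ => C * ((d : ℝ) ^ (m * k - 1))⁻¹) atTop (𝓝 (C * 0)) := by
    refine Tendsto.const_mul _ (tendsto_inv_atTop_zero.comp ?_)
    exact (tendsto_pow_atTop_atTop_of_one_lt hd1).comp ((tendsto_sub_atTop_nat 1).comp hmt)
  rw [mul_zero] at h2
  have h3 : Tendsto ((fun k : ℕ => a k / (d : ℝ) ^ (k - 1)) ∘ (fun k : ℕ => m * k)) atTop (𝓝 0) := by
    refine squeeze_zero_norm (fun k => ?_) h2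
    have hp : (0 : ℝ) < (d : ℝ) ^ (m * k - 1) := by positivity
    simp only [Function.comp, div_eq_mul_inv, norm_mul, norm_inv]
    rw [Real.norm_of_nonneg hp.le]
    exact mul_le_mul_of_nonneg_right (hb k) (by positivity)
  exact tendsto_nhds_unique h1 h3

open Filter Topology in
theorem aux_shift (d : ℕ) (hd : 1 < d) (a : ℕ → ℝ) (g : ℝ) (n : ℕ) (hn : 1 ≤ n)
    (h : Tendsto (fun k : ℕ => a k / (d : ℝ) ^ (k - 1)) atTop (𝓝 g)) :
    Tendsto (fun k : ℕ => a (k + n) / (d : ℝ) ^ k) atTop (𝓝 ((d : ℝ) ^ (n - 1) * g)) := by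
  have h1 := ((tendsto_add_atTop_iff_nat n).2 h).const_mul ((d : ℝ) ^ (n - 1))
  refine h1.congr (fun k => ?_)
  have : k + n - 1 = k + (n - 1) := by omega
  have hd0 : (0 : ℝ) < d := by positivity
  rw [this, pow_add]
  field_simp

theorem aux_R (d : ℕ) (hd : 1 < d) : ∃ R : ℝ, 1 ≤ R ∧ R ^ (d - 1) = 2 ∧
    Real.log R = Real.log 2 / ((d : ℝ) - 1) := by
  have hd1 : (1 : ℝ) < d := by exact_mod_cast hd
  have hD : (0 : ℝ) < (d : ℝ) - 1 := by linarith
  refine ⟨Real.exp (Real.log 2 / ((d : ℝ) - 1)), ?_, ?_, Real.log_exp _⟩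
  · rw [Real.one_le_exp_iff]
    have := Real.log_pos (one_lt_two)
    positivity
  · rw [← Real.exp_nat_mul]
    rw [Nat.cast_sub hd.le, Nat.cast_one, mul_div_cancel₀ _ hD.ne', Real.exp_log two_pos]

theorem aux_step (d : ℕ) (hd : 1 < d) (R : ℝ) (hR1 : 1 ≤ R) (hR : R ^ (d - 1) = 2)
    (lam z : ℂ) (h1 : ‖lam‖ ≤ ‖z‖) (h2 : R ≤ ‖z‖) :
    ‖z‖ ≤ ‖fc d lam z‖ ∧ ‖z‖ ^ d / 2 ≤ ‖fc d lam z‖ := by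
  have e : ‖z‖ ^ d = ‖z‖ ^ (d - 1) * ‖z‖ := by
    rw [← pow_succ]; congr 1; omega
  have h3 : 2 ≤ ‖z‖ ^ (d - 1) := by
    rw [← hR]; gcongr
  have h4 : ‖z‖ ^ d - ‖lam‖ ≤ ‖fc d lam z‖ := by
    have := norm_sub_norm_le (z ^ d) (-lam)
    simpa [fc, norm_pow] using this
  have h5 : 2 * ‖z‖ ≤ ‖z‖ ^ d := by rw [e]; gcongr
  constructor <;> linarith

theorem aux_lower (d : ℕ) (hd : 1 < d) (R : ℝ) (hR1 : 1 ≤ R) (hR : R ^ (d - 1) = 2)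
    (hl : Real.log R = Real.log 2 / ((d : ℝ) - 1))
    (lam z : ℂ) (h1 : ‖lam‖ ≤ ‖z‖) (h2 : R ≤ ‖z‖) (k : ℕ) :
    ‖z‖ ≤ ‖(fc d lam)^[k] z‖ ∧
      (d : ℝ) ^ k * (Real.log ‖z‖ - Real.log R) ≤ Real.log ‖(fc d lam)^[k] z‖ - Real.log R := by
  have hd1 : (1 : ℝ) < d := by exact_mod_cast hd
  have hD : (0 : ℝ) < (d : ℝ) - 1 := by linarith
  induction k with
  | zero => simp
  | succ k ih =>
    obtain ⟨i1, i2⟩ := ih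
    rw [Function.iterate_succ_apply']
    set w := (fc d lam)^[k] z
    obtain ⟨s1, s2⟩ := aux_step d hd R hR1 hR lam w (h1.trans i1) (h2.trans i1)
    have hw : 0 < ‖w‖ := by linarith
    refine ⟨i1.trans s1, ?_⟩
    have h3 : Real.log (‖w‖ ^ d / 2) ≤ Real.log ‖fc d lam w‖ :=
      Real.log_le_log (by positivity) s2
    rw [Real.log_div (by positivity) (by norm_num), Real.log_pow] at h3
    have h4 : Real.log 2 = (d - 1) * Real.log R := by rw [hl]; field_simp
    have h5 : (d : ℝ) * ((d : ℝ) ^ k * (Real.log ‖z‖ - Real.log R)) ≤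
      d * (Real.log ‖w‖ - Real.log R) := by gcongr
    rw [pow_succ]
    nlinarith

theorem aux_upper (d : ℕ) (hd : 1 < d) (R : ℝ)
    (hl : Real.log R = Real.log 2 / ((d : ℝ) - 1))
    (lam z : ℂ) (v : ℝ) (h0 : 1 ≤ v) (h1 : ‖lam‖ ≤ v) (h2 : ‖z‖ ≤ v) (k : ℕ) :
    ∃ V : ℝ, 1 ≤ V ∧ ‖lam‖ ≤ V ∧ ‖(fc d lam)^[k] z‖ ≤ V ∧
      Real.log V + Real.log R ≤ (d : ℝ) ^ k * (Real.log v + Real.log R) := by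
  have hd1 : (1 : ℝ) < d := by exact_mod_cast hd
  have hD : (0 : ℝ) < (d : ℝ) - 1 := by linarith
  induction k with
  | zero => exact ⟨v, h0, h1, by simpa using h2, by simp⟩
  | succ k ih =>
    obtain ⟨V, i0, i1, i2, i3⟩ := ih
    rw [Function.iterate_succ_apply']
    set w := (fc d lam)^[k] z
    have hV : V ≤ V ^ d := le_self_pow₀ i0 (by omega)
    refine ⟨2 * V ^ d, by linarith, by linarith, ?_, ?_⟩
    · calc ‖fc d lam w‖ ≤ ‖w ^ d‖ + ‖lam‖ := norm_add_le _ _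
        _ ≤ V ^ d + V ^ d := by
          rw [norm_pow]
          have : ‖w‖ ^ d ≤ V ^ d := by gcongr
          linarith
        _ = _ := by ring
    · rw [Real.log_mul (by norm_num) (by positivity), Real.log_pow]
      have h4 : Real.log 2 = (d - 1) * Real.log R := by rw [hl]; field_simp
      have h5 : (d : ℝ) * (Real.log V + Real.log R) ≤
        d * ((d : ℝ) ^ k * (Real.log v + Real.log R)) := by gcongr
      rw [pow_succ]
      nlinarith

theorem aux_pow_sub (d : ℕ) (X Y : ℂ) (M : ℝ) (hX : ‖X‖ ≤ M) (hY : ‖Y‖ ≤ M) :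
    ‖Y ^ (d + 1) - X ^ (d + 1)‖ ≤ (d + 1) * M ^ d * ‖Y - X‖ := by
  have hM : 0 ≤ M := (norm_nonneg _).trans hX
  induction d with
  | zero => simp
  | succ d ih =>
    have e : Y ^ (d + 1 + 1) - X ^ (d + 1 + 1) = Y * (Y ^ (d + 1) - X ^ (d + 1))
      + (Y - X) * X ^ (d + 1) := by ring
    rw [e]
    calc _ ≤ ‖Y * (Y ^ (d + 1) - X ^ (d + 1))‖ + ‖(Y - X) * X ^ (d + 1)‖ := norm_add_le _ _
      _ = ‖Y‖ * ‖Y ^ (d + 1) - X ^ (d + 1)‖ + ‖Y - X‖ * ‖X‖ ^ (d + 1) := by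
        rw [norm_mul, norm_mul, norm_pow]
      _ ≤ M * ((d + 1) * M ^ d * ‖Y - X‖) + ‖Y - X‖ * M ^ (d + 1) := by gcongr
      _ = _ := by push_cast; ring

theorem aux_close (d : ℕ) (hd : 1 < d) (R : ℝ) (hR1 : 1 ≤ R) (hR : R ^ (d - 1) = 2)
    (lam : ℂ) (N : ℕ) (hF : ∀ j ≤ N, ‖(fc d lam)^[j + 1] 0‖ ≤ R) (r : ℝ) (hr : 0 ≤ r)
    (hb : (2 * d : ℝ) ^ N * (r ^ d / R) < 1) (y : ℂ) (hy : ‖y‖ ≤ r) (j : ℕ) (hj : j ≤ N) :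
    ‖(fc d lam)^[j + 1] y - (fc d lam)^[j + 1] 0‖ ≤
      R * ((2 * d : ℝ) ^ j * (r ^ d / R)) / (1 - (2 * d : ℝ) ^ j * (r ^ d / R)) := by
  have hd1 : (1 : ℝ) < d := by exact_mod_cast hd
  have hbj : ∀ j ≤ N, (2 * d : ℝ) ^ j * (r ^ d / R) < 1 := by
    intro j hj
    refine lt_of_le_of_lt ?_ hb
    gcongr
    linarith
  induction j with
  | zero =>
    have h0 := hbj 0 hj
    simp only [pow_zero, one_mul] at h0 ⊢
    have hp : 0 ≤ r ^ d / R := by positivity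
    rw [le_div_iff₀ (by linarith)]
    have : (fc d lam)^[0 + 1] y - (fc d lam)^[0 + 1] 0 = y ^ d := by
      simp [fc, zero_pow (by omega : d ≠ 0)]
    rw [this, norm_pow, mul_div_cancel₀ _ (by positivity)]
    have h1 : ‖y‖ ^ d ≤ r ^ d := by gcongr
    have h2 : 0 ≤ ‖y‖ ^ d := by positivity
    nlinarith
  | succ j ih =>
    have ih := ih (by omega)
    have hX := hF j (by omega)
    have hb1 := hbj (j + 1) hj
    rw [Function.iterate_succ_apply' _ (j + 1), Function.iterate_succ_apply' _ (j + 1)]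
    set X := (fc d lam)^[j + 1] 0
    set Y := (fc d lam)^[j + 1] y
    set b := (2 * d : ℝ) ^ j * (r ^ d / R) with hbdef
    have hb0 : 0 ≤ b := by positivity
    have e1 : (2 * d : ℝ) ^ (j + 1) * (r ^ d / R) = 2 * d * b := by rw [hbdef]; ring
    rw [e1] at hb1 ⊢
    have hdb : 0 ≤ (d : ℝ) * b := by positivity
    have hb2 : b ≤ d * b := by nlinarith
    have hb3 : 0 < 1 - b := by nlinarith
    have hYX : Y = X + (Y - X) := by ring
    have hY : ‖Y‖ ≤ R / (1 - b) := by
      have : R / (1 - b) = R + R * b / (1 - b) := by field_simp; ring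
      rw [this, hYX]
      exact (norm_add_le _ _).trans (add_le_add hX ih)
    have hX2 : ‖X‖ ≤ R / (1 - b) := by
      refine hX.trans ?_
      rw [le_div_iff₀ hb3]; nlinarith
    obtain ⟨m, rfl⟩ : ∃ m, d = m + 1 := ⟨d - 1, by omega⟩
    have h3 := aux_pow_sub m X Y _ hX2 hY
    have e2 : fc (m + 1) lam Y - fc (m + 1) lam X = Y ^ (m + 1) - X ^ (m + 1) := by
      simp [fc]
    rw [e2]
    have hRm : R ^ m = 2 := by simpa using hR
    have bern : 1 + ((m + 1 : ℕ) : ℝ) * (-b) ≤ (1 + (-b)) ^ (m + 1) :=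
      one_add_mul_le_pow (by linarith) _
    have hRb : 0 ≤ R * b := by positivity
    calc _ ≤ _ := h3
      _ ≤ (m + 1) * (R / (1 - b)) ^ m * (R * b / (1 - b)) := by gcongr
      _ = R * (2 * ((m + 1 : ℕ) : ℝ) * b) / (1 - b) ^ (m + 1) := by
        rw [div_pow, hRm]; push_cast; field_simp; ring
      _ ≤ _ := by
        apply div_le_div_of_nonneg_left (by positivity) (by linarith)
        have : (1 + -b) = 1 - b := by ring
        rw [this] at bern
        linarith

theorem aux_lower_G (d : ℕ) (hd : 1 < d) (R : ℝ) (hR1 : 1 ≤ R) (hR : R ^ (d - 1) = 2)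
    (hl : Real.log R = Real.log 2 / ((d : ℝ) - 1)) (lam : ℂ) (g : ℝ)
    (hg : Filter.Tendsto
      (fun k : ℕ => (1 / 2) * Real.log (1 + ‖(fc d lam)^[k] 0‖ ^ 2) / (d : ℝ) ^ (k - 1))
      Filter.atTop (nhds g)) (n : ℕ) (hn : 1 ≤ n)
    (h1 : ‖lam‖ ≤ ‖(fc d lam)^[n] 0‖) (h2 : R ≤ ‖(fc d lam)^[n] 0‖) :
    Real.log ‖(fc d lam)^[n] 0‖ - Real.log R ≤ (d : ℝ) ^ (n - 1) * g := by
  have hs := aux_shift d hd (fun k => (1 / 2) * Real.log (1 + ‖(fc d lam)^[k] 0‖ ^ 2)) g n hn hg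
  refine ge_of_tendsto' hs (fun k => ?_)
  have hd0 : (0 : ℝ) < d := by positivity
  obtain ⟨a1, a2⟩ := aux_lower d hd R hR1 hR hl lam _ h1 h2 k
  rw [Function.iterate_add_apply, le_div_iff₀ (by positivity)]
  set w := (fc d lam)^[k] ((fc d lam)^[n] 0)
  have hw : 0 < ‖w‖ := by linarith
  have h3 : Real.log (‖w‖ ^ 2) ≤ Real.log (1 + ‖w‖ ^ 2) :=
    Real.log_le_log (by positivity) (by linarith)
  rw [Real.log_pow] at h3
  push_cast at h3
  have := Real.log_nonneg hR1
  linarith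

theorem aux_upper_G (d : ℕ) (hd : 1 < d) (R : ℝ) (hR1 : 1 ≤ R)
    (hl : Real.log R = Real.log 2 / ((d : ℝ) - 1)) (lam : ℂ) (g : ℝ)
    (hg : Filter.Tendsto
      (fun k : ℕ => (1 / 2) * Real.log (1 + ‖(fc d lam)^[k] 0‖ ^ 2) / (d : ℝ) ^ (k - 1))
      Filter.atTop (nhds g)) (n : ℕ) (hn : 1 ≤ n) (v : ℝ) (h0 : 1 ≤ v)
    (h1 : ‖lam‖ ≤ v) (h2 : ‖(fc d lam)^[n] 0‖ ≤ v) :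
    (d : ℝ) ^ (n - 1) * g ≤ Real.log v + Real.log R := by
  have hs := aux_shift d hd (fun k => (1 / 2) * Real.log (1 + ‖(fc d lam)^[k] 0‖ ^ 2)) g n hn hg
  have hd0 : (0 : ℝ) < d := by positivity
  have hd1 : (1 : ℝ) < d := by exact_mod_cast hd
  have ht : Filter.Tendsto (fun k : ℕ => (Real.log v + Real.log R) +
      Real.log 2 / 2 * ((d : ℝ) ^ k)⁻¹) Filter.atTop
      (nhds ((Real.log v + Real.log R) + Real.log 2 / 2 * 0)) := by
    refine Filter.Tendsto.const_add _ (Filter.Tendsto.const_mul _ ?_)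
    exact tendsto_inv_atTop_zero.comp (tendsto_pow_atTop_atTop_of_one_lt hd1)
  rw [mul_zero, add_zero] at ht
  refine le_of_tendsto_of_tendsto' hs ht (fun k => ?_)
  obtain ⟨V, a0, a1, a2, a3⟩ := aux_upper d hd R hl lam _ v h0 h1 h2 k
  rw [Function.iterate_add_apply, div_le_iff₀ (by positivity)]
  set w := (fc d lam)^[k] ((fc d lam)^[n] 0)
  have hw : ‖w‖ ^ 2 ≤ V ^ 2 := by gcongr
  have hV : 1 ≤ V ^ 2 := one_le_pow₀ a0
  have h3 : Real.log (1 + ‖w‖ ^ 2) ≤ Real.log (2 * V ^ 2) :=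
    Real.log_le_log (by positivity) (by linarith)
  rw [Real.log_mul (by norm_num) (by positivity), Real.log_pow] at h3
  push_cast at h3
  have := Real.log_nonneg hR1
  rw [add_mul, mul_assoc, inv_mul_cancel₀ (by positivity)]
  linarith

theorem aux_zero (d : ℕ) (hd : 1 < d) (lam : ℂ) (g : ℝ)
    (hg : Filter.Tendsto
      (fun k : ℕ => (1 / 2) * Real.log (1 + ‖(fc d lam)^[k] 0‖ ^ 2) / (d : ℝ) ^ (k - 1))
      Filter.atTop (nhds g)) (n : ℕ) (hn : 1 ≤ n) (C : ℝ)
    (hb : ∀ k, ‖(fc d lam)^[n * k] 0‖ ≤ C) : g = 0 := by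
  refine aux_bdd_zero d hd (fun k => (1 / 2) * Real.log (1 + ‖(fc d lam)^[k] 0‖ ^ 2)) g
    ((1 / 2) * Real.log (1 + C ^ 2)) n hn (fun k => ?_) hg
  have h := hb k
  have h0 : 0 ≤ Real.log (1 + ‖(fc d lam)^[n * k] 0‖ ^ 2) :=
    Real.log_nonneg (by nlinarith [sq_nonneg ‖(fc d lam)^[n * k] 0‖])
  rw [Real.norm_of_nonneg (by positivity)]
  gcongr

theorem aux_CB (d : ℕ) (hd : 1 < d) (CB : ℝ)
    (hCB : ∀ lam ∈ frontier (Mloc d), ∀ z : ℂ,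
      |Real.log (chordInf z ^ d / chordInf (fc d lam z))| ≤ CB)
    (gI : ℂ → ℝ)
    (hgI : ∀ lam : ℂ, Filter.Tendsto
      (fun k : ℕ => (1 / 2) * Real.log (1 + ‖(fc d lam)^[k] 0‖ ^ 2) / (d : ℝ) ^ (k - 1))
      Filter.atTop (nhds (gI lam))) : 0 ≤ CB := by
  obtain ⟨R, hR1, hR, hl⟩ := aux_R d hd
  have hR2 : R ≤ 2 := by rw [← hR]; exact le_self_pow₀ hR1 (by omega)
  have hne : (frontier (Mloc d)).Nonempty := by
    rw [Set.nonempty_iff_ne_empty]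
    intro he
    rw [← isClopen_iff_frontier_eq_empty, isClopen_iff] at he
    rcases he with he | he
    · have h0 : (0 : ℂ) ∈ Mloc d := by
        refine ⟨0, ?_⟩
        rintro _ ⟨k, rfl⟩
        have : (fc d 0)^[k] 0 = 0 := Function.iterate_fixed (by simp [fc]; omega) k
        simp [this]
      rw [he] at h0
      exact h0
    · have h3 : (3 : ℂ) ∈ Mloc d := by rw [he]; trivial
      obtain ⟨C, hC⟩ := h3
      have hz := aux_zero d hd 3 _ (hgI 3) 1 le_rfl C (fun k => hC ⟨1 * k, rfl⟩)
      have e : (fc d 3)^[1] 0 = 3 := by simp [fc]; omega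
      have n3 : ‖(3 : ℂ)‖ = 3 := by simp
      have := aux_lower_G d hd R hR1 hR hl 3 _ (hgI 3) 1 le_rfl (by rw [e])
        (by rw [e, n3]; linarith)
      rw [e, n3, hz, mul_zero] at this
      have h4 : Real.log R < Real.log 3 := Real.log_lt_log (by linarith) (by linarith)
      linarith
  obtain ⟨l, hl⟩ := hne
  exact (abs_nonneg _).trans (hCB l hl 0)

theorem aux_small (d : ℕ) (hd : 1 < d) (R : ℝ) (hR1 : 1 ≤ R) (hR : R ^ (d - 1) = 2)
    (lam : ℂ) (N : ℕ) (hF : ∀ j ≤ N, ‖(fc d lam)^[j + 1] 0‖ ≤ R) (r : ℝ) (hr : 0 ≤ r)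
    (hrc : r ≤ √2 - 1) (hk : (2 * d : ℝ) ^ N * r ^ (d - 1) ≤ √2 - 1)
    (hz : ‖(fc d lam)^[N + 1] 0‖ ≤ r / 2) (k : ℕ) :
    ‖(fc d lam)^[(N + 1) * k] 0‖ ≤ r := by
  have hs : √2 ^ 2 = 2 := Real.sq_sqrt (by norm_num)
  have hs1 : 1 ≤ √2 := Real.one_le_sqrt.2 (by norm_num)
  have e : r ^ d = r ^ (d - 1) * r := by
    rw [← pow_succ]; congr 1; omega
  have hK : (2 * d : ℝ) ^ N * r ^ d ≤ (√2 - 1) * r := by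
    rw [e, ← mul_assoc]; gcongr
  have hB : (2 * d : ℝ) ^ N * (r ^ d / R) ≤ (√2 - 1) ^ 2 := by
    calc (2 * d : ℝ) ^ N * (r ^ d / R) ≤ (2 * d : ℝ) ^ N * r ^ d := by
          gcongr; exact div_le_self (by positivity) hR1
      _ ≤ _ := hK
      _ ≤ _ := by nlinarith
  have hB1 : (2 * d : ℝ) ^ N * (r ^ d / R) < 1 := by nlinarith
  induction k with
  | zero => simpa using hr
  | succ k ih =>
    have h := aux_close d hd R hR1 hR lam N hF r hr hB1 _ ih N le_rfl
    rw [← Function.iterate_add_apply] at h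
    have e2 : (N + 1) * (k + 1) = N + 1 + (N + 1) * k := by ring
    rw [e2]
    set Y := (fc d lam)^[N + 1 + (N + 1) * k] 0
    set X := (fc d lam)^[N + 1] 0
    have h2 : R * ((2 * d : ℝ) ^ N * (r ^ d / R)) / (1 - (2 * d : ℝ) ^ N * (r ^ d / R)) ≤ r / 2 := by
      rw [div_le_iff₀ (by linarith)]
      have e3 : R * ((2 * d : ℝ) ^ N * (r ^ d / R)) = (2 * d : ℝ) ^ N * r ^ d := by field_simp
      rw [e3]
      refine hK.trans ?_
      have : r / 2 * (1 - (√2 - 1) ^ 2) ≤ r / 2 * (1 - (2 * d : ℝ) ^ N * (r ^ d / R)) := by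
        gcongr
      refine le_trans (le_of_eq ?_) this
      linear_combination (r / 2) * hs
    calc ‖Y‖ = ‖(Y - X) + X‖ := by ring_nf
      _ ≤ ‖Y - X‖ + ‖X‖ := norm_add_le _ _
      _ ≤ r := by linarith

theorem statement8 (d : ℕ) (hd : 1 < d) (CB : ℝ)
    (hCB : ∀ lam ∈ frontier (Mloc d), ∀ z : ℂ,
      |Real.log (chordInf z ^ d / chordInf (fc d lam z))| ≤ CB)
    (gI : ℂ → ℝ)
    (hgI : ∀ lam : ℂ, Filter.Tendsto
      (fun k : ℕ => (1 / 2) * Real.log (1 + ‖(fc d lam)^[k] 0‖ ^ 2) / (d : ℝ) ^ (k - 1))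
      Filter.atTop (nhds (gI lam)))
    (n : ℕ) (hn : 1 ≤ n) (lam : ℂ)
    (hFn : Real.exp (-(tconst d CB n)) ≤ ‖(fc d lam)^[n] 0‖) :
    |Real.log ‖(fc d lam)^[n] 0‖ - (d : ℝ) ^ (n - 1) * gI lam| ≤ tconst d CB n := by
  have hCB0 := aux_CB d hd CB hCB gI hgI
  obtain ⟨R, hR1, hR, hl⟩ := aux_R d hd
  have hg := hgI lam
  have hd1 : (1 : ℝ) < d := by exact_mod_cast hd
  have hD : (0 : ℝ) < (d : ℝ) - 1 := by linarith
  obtain ⟨N, rfl⟩ : ∃ N, n = N + 1 := ⟨n - 1, by omega⟩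
  have hs : √2 ^ 2 = 2 := Real.sq_sqrt (by norm_num)
  have hs1 : 1 < √2 := by rw [Real.lt_sqrt] <;> norm_num
  have hlogd : 0 ≤ Real.log d := Real.log_nonneg hd1.le
  have hlogR : 0 ≤ Real.log R := Real.log_nonneg hR1
  have hlog2 : 0 ≤ Real.log 2 := Real.log_nonneg one_le_two
  have hc : 0 ≤ Real.log (√2 + 1) := Real.log_nonneg (by linarith)
  set q : ℝ := 2 * N * Real.log d / ((d : ℝ) - 1) with hq
  have hq0 : 0 ≤ q := by positivity
  -- the value of the constant
  have ht : Real.log 2 + 2 * Real.log R + q + Real.log (√2 + 1) ≤ tconst d CB (N + 1) := by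
    have : tconst d CB (N + 1) = Real.log 2 + 2 * Real.log R + q + Real.log (√2 + 1)
        + 4 * CB / ((d : ℝ) - 1) ^ 2 := by
      rw [tconst, hl, hq]; push_cast; field_simp; ring
    rw [this]
    have : 0 ≤ 4 * CB / ((d : ℝ) - 1) ^ 2 := by positivity
    linarith
  set t := tconst d CB (N + 1)
  have hzpos : 0 < ‖(fc d lam)^[N + 1] 0‖ := (Real.exp_pos _).trans_le hFn
  have hL : -t ≤ Real.log ‖(fc d lam)^[N + 1] 0‖ := (Real.le_log_iff_exp_le hzpos).2 hFn
  have e1 : (fc d lam)^[1] 0 = lam := by simp [fc]; omega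
  have hbig : R ≤ ‖lam‖ → ‖lam‖ ≤ ‖(fc d lam)^[N + 1] 0‖ := by
    intro h
    have := (aux_lower d hd R hR1 hR hl lam lam le_rfl h N).1
    rwa [Function.iterate_add_apply, e1]
  have hG0 : 0 ≤ (d : ℝ) ^ (N + 1 - 1) * gI lam := by
    have : 0 ≤ gI lam := by
      refine ge_of_tendsto' hg (fun k => ?_)
      have : 0 ≤ Real.log (1 + ‖(fc d lam)^[k] 0‖ ^ 2) :=
        Real.log_nonneg (by nlinarith [sq_nonneg ‖(fc d lam)^[k] 0‖])
      positivity
    positivity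
  by_cases hzR : R ≤ ‖(fc d lam)^[N + 1] 0‖
  · have hlz : ‖lam‖ ≤ ‖(fc d lam)^[N + 1] 0‖ := by
      rcases le_total R ‖lam‖ with h | h
      · exact hbig h
      · exact h.trans hzR
    have h1 := aux_lower_G d hd R hR1 hR hl lam _ hg (N + 1) hn hlz hzR
    have h2 := aux_upper_G d hd R hR1 hl lam _ hg (N + 1) hn _ (hR1.trans hzR) hlz le_rfl
    rw [abs_le]
    constructor <;> linarith
  push Not at hzR
  have hlam : ‖lam‖ ≤ R := by
    by_contra h
    push Not at h
    linarith [hbig h.le]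
  have hLR : Real.log ‖(fc d lam)^[N + 1] 0‖ ≤ Real.log R := Real.log_le_log hzpos hzR.le
  have hup := aux_upper_G d hd R hR1 hl lam _ hg (N + 1) hn R hR1 hlam hzR.le
  rw [abs_le]
  refine ⟨?_, by linarith⟩
  set r : ℝ := (√2 - 1) * Real.exp (-q) with hrdef
  have hr : 0 < r := mul_pos (by linarith) (Real.exp_pos _)
  have hinv : √2 - 1 = (√2 + 1)⁻¹ := by
    refine eq_inv_of_mul_eq_one_left ?_; linear_combination hs
  have hlogr : Real.log (r / 2) = - Real.log (√2 + 1) - q - Real.log 2 := by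
    rw [Real.log_div hr.ne' (by norm_num), hrdef, Real.log_mul (by linarith)
      (Real.exp_pos _).ne', Real.log_exp, hinv, Real.log_inv]
    ring
  rcases le_or_gt ‖(fc d lam)^[N + 1] 0‖ (r / 2) with hsm | hla
  · have hF : ∀ j ≤ N, ‖(fc d lam)^[j + 1] 0‖ ≤ R := by
      intro j hj
      by_contra h
      push Not at h
      have := (aux_lower d hd R hR1 hR hl lam _ (hlam.trans h.le) h.le (N - j)).1
      rw [← Function.iterate_add_apply] at this
      have e : N - j + (j + 1) = N + 1 := by omega
      rw [e] at this
      linarith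
    have hrc : r ≤ √2 - 1 := by
      refine mul_le_of_le_one_right (by linarith) ?_
      rw [Real.exp_le_one_iff]; linarith
    have hk : (2 * d : ℝ) ^ N * r ^ (d - 1) ≤ √2 - 1 := by
      have hE : Real.exp (-q) ^ (d - 1) = (((d : ℝ) ^ 2) ^ N)⁻¹ := by
        rw [← Real.exp_nat_mul, Nat.cast_sub hd.le, Nat.cast_one]
        have : ((d : ℝ) - 1) * -q = - Real.log (((d : ℝ) ^ 2) ^ N) := by
          rw [Real.log_pow, Real.log_pow, hq]; push_cast; field_simp
        rw [this, Real.exp_neg, Real.exp_log (by positivity)]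
      rw [hrdef, mul_pow (√2 - 1), hE]
      have h1 : (√2 - 1) ^ (d - 1) ≤ √2 - 1 :=
        pow_le_of_le_one (by linarith) (by nlinarith) (by omega)
      have hd2 : (2 : ℝ) ≤ d := by exact_mod_cast hd
      have h2 : (2 * d : ℝ) ^ N ≤ ((d : ℝ) ^ 2) ^ N := by
        gcongr; nlinarith
      have h3 : 0 ≤ √2 - 1 := by linarith
      calc _ ≤ ((d : ℝ) ^ 2) ^ N * ((√2 - 1) * (((d : ℝ) ^ 2) ^ N)⁻¹) := by gcongr
        _ = _ := by field_simp
    have hz := aux_zero d hd lam _ hg (N + 1) hn r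
      (aux_small d hd R hR1 hR lam N hF r hr.le hrc hk hsm)
    rw [hz, mul_zero]
    linarith
  · have := Real.log_le_log (by positivity) hla.le
    rw [hlogr] at this
    linarith
end

section
/- There exists a constant C₀ > 0, independent of n, such that for every integer n ≥ 1, ∫_{E_n} |log|F_n(λ)| − d^{n−1}·g_I(λ)| dω(λ) ≤ ω(E_n)·t_n + C₀, where E_n := {λ ∈ ℂ : |F_n(λ)| < e^{−t_n}}. -/
open MeasureTheory Real

namespace Stm9
open MeasureTheory Real Set Metric Filter Topology
open scoped ENNReal NNReal

lemma det_mul (a : ℂ) :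
    |((ContinuousLinearMap.toSpanSingleton ℂ a).restrictScalars ℝ).det| = ‖a‖ ^ 2 := by
  simp [ContinuousLinearMap.det, LinearMap.det_restrictScalars, Algebra.norm_complex_eq, Complex.normSq_eq_norm_sq]

lemma lintegral_image_hol {φ φ' : ℂ → ℂ} {S : Set ℂ} (hS : MeasurableSet S)
    (hφ : ∀ x ∈ S, HasDerivAt φ (φ' x) x) (hinj : InjOn φ S) (g : ℂ → ℝ≥0∞) :
    ∫⁻ x in φ '' S, g x = ∫⁻ x in S, ENNReal.ofReal (‖φ' x‖ ^ 2) * g (φ x) := by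
  have := lintegral_image_eq_lintegral_abs_det_fderiv_mul (volume : Measure ℂ) hS
    (f := φ) (f' := fun x => (ContinuousLinearMap.toSpanSingleton ℂ (φ' x)).restrictScalars ℝ)
    (fun x hx => ((hφ x hx).hasFDerivAt.restrictScalars ℝ).hasFDerivWithinAt) hinj g
  simpa [det_mul] using this

lemma polar_eq (h : ℂ → ℝ≥0∞) (hh : Measurable h) :
    ∫⁻ z, h z = ∫⁻ t in Ioi (0:ℝ), ENNReal.ofReal t *
      ∫⁻ θ in Ioo (-π) π, h (circleMap 0 t θ) := by
  rw [← Complex.lintegral_comp_polarCoord_symm, polarCoord_target, Measure.volume_eq_prod,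
    ← Measure.prod_restrict, lintegral_prod]
  · refine setLIntegral_congr_fun measurableSet_Ioi fun t ht => ?_
    rw [← lintegral_const_mul]
    · simp [circleMap, Complex.polarCoord_symm_apply, Complex.exp_mul_I]
    · fun_prop
  · apply Measurable.aemeasurable
    have : Measurable (fun p : ℝ × ℝ => (Complex.polarCoord.symm p)) := by
      simp only [Complex.polarCoord_symm_apply]; fun_prop
    fun_prop

lemma polar_lower (h : ℂ → ℝ≥0∞) (hh : Measurable h) (Good : Set ℝ) (hG : MeasurableSet Good)
    (hG0 : Good ⊆ Ioi 0) (κ : ℝ≥0∞)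
    (hk : ∀ t ∈ Good, κ ≤ ENNReal.ofReal t * ∫⁻ θ in Ioo (-π) π, h (circleMap 0 t θ)) :
    κ * volume Good ≤ ∫⁻ z, h z := by
  rw [polar_eq h hh, ← setLIntegral_const]
  refine le_trans (setLIntegral_mono' hG hk) (lintegral_mono_set hG0)

lemma circle_le (g : ℂ → ℂ) (t : ℝ) (ht : 0 < t) :
    ‖∮ z in C(0, t), g z‖ₑ ≤ ENNReal.ofReal t * ∫⁻ θ in Ioo (-π) π, ‖g (circleMap 0 t θ)‖ₑ := by
  have hper : Function.Periodic (fun θ : ℝ => deriv (circleMap 0 t) θ • g (circleMap 0 t θ)) (2 * π) := by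
    intro θ
    simp only [deriv_circleMap, periodic_circleMap 0 t θ]
  have h1 : (∮ z in C(0, t), g z) =
      ∫ θ in Ioc (-π) π, deriv (circleMap 0 t) θ • g (circleMap 0 t θ) := by
    rw [circleIntegral]
    have := hper.intervalIntegral_add_eq 0 (-π)
    rw [zero_add, show -π + 2 * π = π by ring] at this
    rw [this, intervalIntegral.integral_of_le (by linarith [pi_pos])]
  rw [h1, integral_Ioc_eq_integral_Ioo]
  refine (enorm_integral_le_lintegral_enorm _).trans ?_
  rw [← lintegral_const_mul' _ _ ENNReal.ofReal_ne_top]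
  refine lintegral_mono fun θ => ?_
  simp only [deriv_circleMap, smul_eq_mul, enorm_mul]
  gcongr
  rw [← ofReal_norm, ← ofReal_norm, ← ENNReal.ofReal_mul (norm_nonneg _)]
  simp [abs_of_pos ht]

lemma radial1 (K : ℝ) (hK : 0 ≤ K) :
    ∫⁻ w in ball (0:ℂ) K, ENNReal.ofReal (1 / ‖w‖) ≤ ENNReal.ofReal (2 * π * K) := by
  rw [← lintegral_indicator measurableSet_ball, polar_eq]
  · calc _ ≤ ∫⁻ t in Ioi (0:ℝ), (Ioo 0 K).indicator (fun _ => ENNReal.ofReal (2 * π)) t := by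
          refine setLIntegral_mono' measurableSet_Ioi fun t ht => ?_
          have ht' : (0:ℝ) < t := ht
          by_cases htK : t < K
          · have : ∀ θ, (ball (0:ℂ) K).indicator (fun w => ENNReal.ofReal (1 / ‖w‖)) (circleMap 0 t θ) = ENNReal.ofReal (1 / t) := by
              intro θ
              rw [indicator_of_mem] <;> simp [abs_of_pos ht', htK]
            simp only [this, setLIntegral_const]
            rw [indicator_of_mem (show t ∈ Ioo 0 K from ⟨ht', htK⟩), ← mul_assoc, ← ENNReal.ofReal_mul ht'.le,
              mul_one_div_cancel ht'.ne', Real.volume_Ioo]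
            rw [ENNReal.ofReal_one, one_mul]; apply le_of_eq; congr 1; ring
          · have : ∀ θ, (ball (0:ℂ) K).indicator (fun w => ENNReal.ofReal (1 / ‖w‖)) (circleMap 0 t θ) = 0 := by
              intro θ
              rw [indicator_of_notMem]; simp [abs_of_pos ht']; linarith
            simp only [this, lintegral_zero, mul_zero, zero_le]
      _ ≤ _ := by
          refine (setLIntegral_le_lintegral _ _).trans ?_
          rw [lintegral_indicator measurableSet_Ioo, setLIntegral_const, Real.volume_Ioo,
            ← ENNReal.ofReal_mul (by positivity)]
          simp
  · exact Measurable.indicator (by fun_prop) measurableSet_ball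

lemma radial2 (δ K : ℝ) (hδ : 0 < δ) (hK : δ ≤ K) :
    ∫⁻ w in ball (0:ℂ) K \ ball 0 δ, ENNReal.ofReal (1 / ‖w‖ ^ 2) ≤ ENNReal.ofReal (2 * π * Real.log (K / δ)) := by
  rw [← lintegral_indicator (measurableSet_ball.diff measurableSet_ball), polar_eq]
  · calc _ ≤ ∫⁻ t in Ioi (0:ℝ), (Ioc δ K).indicator (fun t => ENNReal.ofReal (2 * π * t⁻¹)) t +
              ({δ} : Set ℝ).indicator (fun t => ⊤) t := by
          refine setLIntegral_mono' measurableSet_Ioi fun t ht => ?_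
          have ht' : (0:ℝ) < t := ht
          by_cases htK : δ < t ∧ t < K
          · have : ∀ θ, (ball (0:ℂ) K \ ball 0 δ).indicator (fun w => ENNReal.ofReal (1 / ‖w‖^2)) (circleMap 0 t θ) = ENNReal.ofReal (1 / t^2) := by
              intro θ
              rw [indicator_of_mem] <;> simp [abs_of_pos ht', htK, htK.1.le]
            simp only [this, setLIntegral_const]
            rw [indicator_of_mem (show t ∈ Ioc δ K from ⟨htK.1, htK.2.le⟩), ← mul_assoc, ← ENNReal.ofReal_mul ht'.le,
              Real.volume_Ioo, ← ENNReal.ofReal_mul (by positivity)]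
            refine le_trans (le_of_eq ?_) le_self_add
            congr 1; field_simp; ring
          · by_cases hd : t = δ
            · subst hd
              simp
            have : ∀ θ, (ball (0:ℂ) K \ ball 0 δ).indicator (fun w => ENNReal.ofReal (1 / ‖w‖^2)) (circleMap 0 t θ) = 0 := by
              intro θ
              rw [indicator_of_notMem]; simp [abs_of_pos ht']
              intro h
              by_contra hh
              exact htK ⟨lt_of_le_of_ne (not_lt.1 hh) (Ne.symm hd), h⟩
            simp only [this, lintegral_zero, mul_zero, zero_le]
      _ ≤ _ := by
          refine (setLIntegral_le_lintegral _ _).trans ?_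
          rw [lintegral_add_left (Measurable.indicator (by fun_prop) measurableSet_Ioc),
            lintegral_indicator measurableSet_Ioc, lintegral_indicator (measurableSet_singleton _)]
          simp only [setLIntegral_const, Real.volume_singleton, mul_zero, add_zero]
          rw [← ofReal_integral_eq_lintegral_ofReal]
          · rw [← intervalIntegral.integral_of_le hK, intervalIntegral.integral_const_mul,
              integral_inv_of_pos hδ (hδ.trans_le hK)]
          · rw [← IntegrableOn, ← intervalIntegrable_iff_integrableOn_Ioc_of_le hK]
            refine IntervalIntegrable.const_mul (intervalIntegral.intervalIntegrable_inv ?_ ?_) _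
            · intro x hx
              rw [uIcc_of_le hK] at hx
              exact (hδ.trans_le hx.1).ne'
            · exact continuousOn_id
          · refine (ae_restrict_iff' measurableSet_Ioc).2 (Eventually.of_forall fun x hx => ?_)
            have : 0 < x := hδ.trans hx.1
            simp only [Pi.zero_apply]; positivity
  · exact Measurable.indicator (by fun_prop) (measurableSet_ball.diff measurableSet_ball)

end Stm9

namespace Stm9
open MeasureTheory Real Set Metric Filter Topology
open scoped ENNReal NNReal

lemma S0_meas (d : ℕ) : MeasurableSet {z : ℂ | (z ^ d) ^ ((d : ℂ)⁻¹) = z ∧ z ≠ 0} := by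
  apply MeasurableSet.inter
  · exact measurableSet_eq_fun (by fun_prop) measurable_id
  · exact (measurableSet_singleton (0:ℂ)).compl

/-- push-forward inequality -/
lemma push_le (d : ℕ) (hd : 1 < d) (lam : ℂ) (q Q : ℂ → ℂ) (hq : Measurable q)
    (ζ : ℂ) (hζ : IsPrimitiveRoot ζ d) (V : Set ℂ) (hV : MeasurableSet V)
    (hQ : ∀ z, z ≠ 0 → fc d lam z ∈ V →
      Q (fc d lam z) * (d * z ^ (d - 1)) ^ 2 = ∑ j ∈ Finset.range d, (ζ ^ j) ^ 2 * q (ζ ^ j * z)) :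
    ∫⁻ w in V, ‖Q w‖ₑ ≤ ∫⁻ z in (fc d lam) ⁻¹' V, ‖q z‖ₑ := by
  have hd0 : d ≠ 0 := by omega
  set S0 : Set ℂ := {z : ℂ | (z ^ d) ^ ((d : ℂ)⁻¹) = z ∧ z ≠ 0} with hS0
  have hfm : Measurable (fc d lam) := by unfold fc; fun_prop
  have hW : MeasurableSet (fc d lam ⁻¹' V) := hfm hV
  set S := S0 ∩ fc d lam ⁻¹' V with hS
  have hSm : MeasurableSet S := (S0_meas d).inter hW
  have hinj : InjOn (fc d lam) S := by
    intro x hx y hy hxy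
    have : x ^ d = y ^ d := by simpa [fc] using hxy
    rw [← hx.1.1, ← hy.1.1, this]
  have himg : V \ {lam} ⊆ fc d lam '' S := by
    intro w hw
    have hne : w - lam ≠ 0 := sub_ne_zero.2 hw.2
    have h1 : ((w - lam) ^ ((d : ℂ)⁻¹)) ^ d = w - lam := Complex.cpow_nat_inv_pow _ hd0
    have h2 : fc d lam ((w - lam) ^ ((d : ℂ)⁻¹)) = w := by simp [fc, h1]
    refine ⟨(w - lam) ^ ((d : ℂ)⁻¹), ⟨⟨by rw [h1], ?_⟩, ?_⟩, h2⟩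
    · intro h0
      rw [h0, zero_pow hd0] at h1
      exact hne h1.symm
    · simp only [mem_preimage, h2]; exact hw.1
  have hζn : ∀ j : ℕ, ‖ζ ^ j‖ = 1 := by
    intro j
    rw [norm_pow, hζ.norm'_eq_one hd0, one_pow]
  have hζ0 : ∀ j : ℕ, ζ ^ j ≠ 0 := by
    intro j h; have := hζn j; rw [h] at this; simp at this
  have hrot : ∀ (j : ℕ) z, fc d lam (ζ ^ j * z) = fc d lam z := by
    intro j z
    simp only [fc, mul_pow]
    rw [← pow_mul, mul_comm j d, pow_mul, hζ.pow_eq_one, one_pow, one_mul]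
  have hcv : ∀ j : ℕ, ∫⁻ z in (fun z => ζ ^ j * z) '' S, ‖q z‖ₑ = ∫⁻ z in S, ‖q (ζ ^ j * z)‖ₑ := by
    intro j
    rw [lintegral_image_hol (φ' := fun _ => ζ ^ j) hSm]
    · simp only [hζn]; simp
    · intro x _
      simpa using (hasDerivAt_id x).const_mul (ζ ^ j)
    · intro x _ y _ h
      exact mul_left_cancel₀ (hζ0 j) h
  calc ∫⁻ w in V, ‖Q w‖ₑ = ∫⁻ w in V \ {lam}, ‖Q w‖ₑ := by
        apply setLIntegral_congr
        exact (sdiff_null_ae_eq_self (by simp)).symm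
    _ ≤ ∫⁻ w in fc d lam '' S, ‖Q w‖ₑ := lintegral_mono_set himg
    _ = ∫⁻ z in S, ENNReal.ofReal (‖(d * z ^ (d - 1) : ℂ)‖ ^ 2) * ‖Q (fc d lam z)‖ₑ := by
        rw [lintegral_image_hol hSm _ hinj]
        intro x _
        exact (hasDerivAt_pow d x).add_const lam
    _ ≤ ∫⁻ z in S, ∑ j ∈ Finset.range d, ‖q (ζ ^ j * z)‖ₑ := by
        refine setLIntegral_mono' hSm fun z hz => ?_
        have h1 := hQ z hz.1.2 hz.2
        have h2 : ENNReal.ofReal (‖(d * z ^ (d - 1) : ℂ)‖ ^ 2) * ‖Q (fc d lam z)‖ₑ =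
            ‖Q (fc d lam z) * (d * z ^ (d - 1)) ^ 2‖ₑ := by
          rw [enorm_mul, mul_comm, ← norm_pow, ofReal_norm]
        rw [h2, h1]
        refine (enorm_sum_le _ _).trans (Finset.sum_le_sum fun j _ => ?_)
        rw [enorm_mul, ← ofReal_norm, norm_pow, hζn]
        simp
    _ ≤ ∑ j ∈ Finset.range d, ∫⁻ z in (fun z => ζ ^ j * z) '' S, ‖q z‖ₑ := by
        simp only [hcv]
        rw [lintegral_finsetSum]
        intro j _
        fun_prop
    _ = ∫⁻ z in ⋃ j ∈ Finset.range d, (fun z => ζ ^ j * z) '' S, ‖q z‖ₑ := by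
        rw [lintegral_biUnion_finset]
        · intro i hi j hj hij
          refine Set.disjoint_left.2 ?_
          rintro _ ⟨x, hx, rfl⟩ ⟨y, hy, hxy⟩
          simp only at hxy
          have h1 : fc d lam y = fc d lam x := by
            rw [← hrot j y, hxy, hrot]
          have h2 := hinj hy hx h1
          rw [h2] at hxy
          have h3 := mul_right_cancel₀ hx.1.2 hxy
          exact hij (hζ.pow_inj (by simpa using hi) (by simpa using hj) h3.symm)
        · intro j _
          exact hSm.image_of_continuousOn_injOn (by fun_prop)
            (fun x _ y _ h => mul_left_cancel₀ (hζ0 j) h)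
    _ ≤ _ := by
        apply lintegral_mono_set
        intro z hz
        simp only [mem_iUnion] at hz
        obtain ⟨j, _, x, hx, rfl⟩ := hz
        simp only [mem_preimage, hrot]
        exact hx.2

end Stm9

namespace Stm9
open MeasureTheory Real Set Metric Filter Topology
open scoped ENNReal NNReal

noncomputable def cc (d : ℕ) (lam : ℂ) (k : ℕ) : ℂ := (fc d lam)^[k] 0
noncomputable def bb (d : ℕ) (lam : ℂ) (n k : ℕ) : ℂ :=
  ∏ i ∈ Finset.Ico k n, ((d : ℂ) * cc d lam i ^ (d - 1))
noncomputable def qq (d : ℕ) (lam : ℂ) (n : ℕ) (z : ℂ) : ℂ :=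
  ∑ k ∈ Finset.Icc 1 n, bb d lam n k / (z - cc d lam k)
noncomputable def QQ (d : ℕ) (lam : ℂ) (n : ℕ) (w : ℂ) : ℂ :=
  ∑ k ∈ Finset.Icc 1 n, bb d lam n k * cc d lam k /
    (d * (w - cc d lam 1) * (w - cc d lam (k + 1)))

lemma cc_zero (d : ℕ) (lam : ℂ) : cc d lam 0 = 0 := rfl
lemma cc_succ (d : ℕ) (lam : ℂ) (k : ℕ) : cc d lam (k + 1) = cc d lam k ^ d + lam := by
  simp only [cc, Function.iterate_succ_apply']; rfl
lemma cc_one (d : ℕ) (hd : d ≠ 0) (lam : ℂ) : cc d lam 1 = lam := by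
  rw [cc_succ, cc_zero, zero_pow hd, zero_add]

lemma root_sum (d : ℕ) (hd : 1 < d) (ζ : ℂ) (hζ : IsPrimitiveRoot ζ d) (z a : ℂ)
    (h : z ^ d ≠ a ^ d) :
    ∑ j ∈ Finset.range d, (ζ ^ j) ^ 2 * (1 / (ζ ^ j * z - a)) =
      d * a * z ^ (d - 2) / (z ^ d - a ^ d) := by
  have hne : z ^ d - a ^ d ≠ 0 := sub_ne_zero.2 h
  have h1 : ∀ j, 1 / (ζ ^ j * z - a) =
      (∑ i ∈ Finset.range d, (ζ ^ j * z) ^ i * a ^ (d - 1 - i)) / (z ^ d - a ^ d) := by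
    intro j
    have h2 := (Commute.all (ζ ^ j * z) a).geom_sum₂_mul d
    have h3 : (ζ ^ j * z) ^ d = z ^ d := by
      rw [mul_pow, ← pow_mul, mul_comm j d, pow_mul, hζ.pow_eq_one, one_pow, one_mul]
    rw [h3] at h2
    have h4 : ζ ^ j * z - a ≠ 0 := by
      intro h0; rw [h0, mul_zero] at h2; exact hne h2.symm
    rw [div_eq_div_iff h4 hne, one_mul, h2]
  have h5 : ∀ i ∈ Finset.range d, ∑ j ∈ Finset.range d, (ζ ^ j) ^ 2 * (ζ ^ j) ^ i =
      if i = d - 2 then (d : ℂ) else 0 := by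
    intro i hi
    have hi' : i < d := by simpa using hi
    have e : ∀ j, (ζ ^ j) ^ 2 * (ζ ^ j) ^ i = (ζ ^ (i + 2)) ^ j := by
      intro j; rw [← pow_add, ← pow_mul, ← pow_mul]; ring_nf
    simp only [e]
    split_ifs with hid
    · have : i + 2 = d := by omega
      simp [this, hζ.pow_eq_one]
    · have hx : ζ ^ (i + 2) ≠ 1 := by
        intro hx
        have hdvd := (hζ.pow_eq_one_iff_dvd _).1 hx
        obtain ⟨m, hm⟩ := hdvd
        rcases m with _ | _ | m
        · omega
        · omega
        · have : d * (m + 1 + 1) = d * m + d + d := by ring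
          have : 0 ≤ d * m := Nat.zero_le _
          omega
      have h6 := geom_sum_mul (ζ ^ (i + 2)) d
      rw [← pow_mul, mul_comm (i+2) d, pow_mul, hζ.pow_eq_one, one_pow, sub_self] at h6
      exact (mul_eq_zero.1 h6).resolve_right (sub_ne_zero.2 hx)
  have : ∑ j ∈ Finset.range d, (ζ ^ j) ^ 2 * ∑ i ∈ Finset.range d, (ζ ^ j * z) ^ i * a ^ (d - 1 - i)
      = d * a * z ^ (d - 2) := by
    simp only [Finset.mul_sum, mul_pow]
    rw [Finset.sum_comm]
    have e : ∀ i ∈ Finset.range d, ∑ j ∈ Finset.range d, (ζ ^ j) ^ 2 * ((ζ ^ j) ^ i * z ^ i * a ^ (d - 1 - i)) =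
        (if i = d - 2 then (d : ℂ) else 0) * (z ^ i * a ^ (d - 1 - i)) := by
      intro i hi
      rw [← h5 i hi, Finset.sum_mul]
      refine Finset.sum_congr rfl fun j _ => by ring
    rw [Finset.sum_congr rfl e]
    simp only [ite_mul, zero_mul, Finset.sum_ite_eq', Finset.mem_range]
    rw [if_pos (by omega), show d - 1 - (d - 2) = 1 by omega]
    ring
  simp only [h1, mul_div_assoc']
  rw [← Finset.sum_div, this]

lemma bb_self (d : ℕ) (lam : ℂ) (n : ℕ) : bb d lam n n = 1 := by simp [bb]
lemma bb_step (d : ℕ) (lam : ℂ) (n k : ℕ) (hk : k < n) :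
    bb d lam n k = d * cc d lam k ^ (d - 1) * bb d lam n (k + 1) := by
  rw [bb, Finset.prod_eq_prod_Ico_succ_bot hk]; rfl

lemma cc_deriv (d : ℕ) (n : ℕ) (lam : ℂ) :
    HasDerivAt (fun l => cc d l n) (∑ k ∈ Finset.Icc 1 n, bb d lam n k) lam := by
  induction n with
  | zero => simpa [cc_zero] using hasDerivAt_const lam (0:ℂ)
  | succ n ih =>
    simp only [cc_succ]
    have h := (ih.pow d).add (hasDerivAt_id lam)
    refine h.congr_deriv ?_
    rw [Finset.sum_Icc_succ_top (by omega), bb_self, Finset.mul_sum]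
    congr 1
    refine Finset.sum_congr rfl fun k hk => ?_
    have hk' : k ≤ n := (Finset.mem_Icc.1 hk).2
    simp only [bb]
    rw [Finset.prod_Ico_succ_top hk']; ring

lemma QQ_push (d : ℕ) (hd : 1 < d) (lam : ℂ) (n : ℕ) (ζ : ℂ) (hζ : IsPrimitiveRoot ζ d) (z : ℂ) (hz : z ≠ 0)
    (h : ∀ k ∈ Finset.Icc 1 n, fc d lam z ≠ cc d lam (k + 1)) :
    QQ d lam n (fc d lam z) * (d * z ^ (d - 1)) ^ 2 =
      ∑ j ∈ Finset.range d, (ζ ^ j) ^ 2 * qq d lam n (ζ ^ j * z) := by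
  simp only [QQ, qq, Finset.mul_sum, Finset.sum_mul]
  rw [Finset.sum_comm]
  refine Finset.sum_congr rfl fun k hk => ?_
  have hne : z ^ d ≠ cc d lam k ^ d := by
    intro h0; apply h k hk; rw [cc_succ, fc, h0]
  have hne' := sub_ne_zero.2 hne
  have := root_sum d hd ζ hζ z (cc d lam k) hne
  have e0 : ∀ j, (ζ ^ j) ^ 2 * (bb d lam n k / (ζ ^ j * z - cc d lam k)) =
      bb d lam n k * ((ζ ^ j) ^ 2 * (1 / (ζ ^ j * z - cc d lam k))) := by intro j; ring
  simp only [e0]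
  rw [← Finset.mul_sum, this, cc_one d (by omega), cc_succ, fc]
  have hd0 : (d : ℂ) ≠ 0 := by exact_mod_cast (by omega : d ≠ 0)
  obtain ⟨e, rfl⟩ : ∃ e, d = e + 2 := ⟨d - 2, by omega⟩
  rw [show e + 2 - 1 = e + 1 by omega, show e + 2 - 2 = e by omega,
    show z ^ (e+2) + lam - lam = z ^ (e+2) by ring,
    show z ^ (e+2) + lam - (cc (e+2) lam k ^ (e+2) + lam) = z ^ (e+2) - cc (e+2) lam k ^ (e+2) by ring]
  rw [div_mul_eq_mul_div, mul_div_assoc', div_eq_div_iff (mul_ne_zero (mul_ne_zero hd0 (pow_ne_zero _ hz)) hne') hne']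
  ring

lemma QQ_eq (d : ℕ) (hd : 1 < d) (lam : ℂ) (n : ℕ) (hn : 1 ≤ n) (w : ℂ) (h1 : w ≠ lam)
    (h : ∀ k ∈ Finset.Icc 1 n, w ≠ cc d lam (k + 1)) :
    QQ d lam n w = qq d lam n w - (∑ k ∈ Finset.Icc 1 n, bb d lam n k) / (w - lam)
      + (cc d lam n / d) / ((w - lam) * (w - cc d lam (n + 1))) := by
  have hd0 : (d : ℂ) ≠ 0 := by exact_mod_cast (by omega : d ≠ 0)
  have hw1 : w - lam ≠ 0 := sub_ne_zero.2 h1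
  obtain ⟨m, rfl⟩ : ∃ m, n = m + 1 := ⟨n - 1, by omega⟩
  set b := bb d lam (m+1) with hb
  have key : ∀ k ∈ Finset.range m, b (k+1) * cc d lam (k+1) /
      (d * (w - cc d lam 1) * (w - cc d lam (k + 1 + 1))) =
      b (k+2) / (w - cc d lam (k+2)) - b (k+2) / (w - lam) := by
    intro k hk
    have hk' : k < m := by simpa using hk
    have hw2 : w - cc d lam (k+1+1) ≠ 0 := sub_ne_zero.2 (h (k+1) (by simp; omega))
    rw [hb, bb_step d lam (m+1) (k+1) (by omega), cc_one d (by omega)]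
    have e : w - cc d lam (k+1+1) = w - lam - cc d lam (k+1) ^ d := by rw [cc_succ]; ring
    have e2 : cc d lam (k+1) ^ (d-1) * cc d lam (k+1) = cc d lam (k+1) ^ d := by
      rw [← pow_succ]; congr 1; omega
    rw [show k + 2 = k + 1 + 1 from rfl]
    rw [div_sub_div _ _ hw2 hw1, div_eq_div_iff (mul_ne_zero (mul_ne_zero hd0 hw1) hw2) (mul_ne_zero hw2 hw1)]
    have e3 : w - lam - (w - cc d lam (k+1+1)) = cc d lam (k+1) ^ d := by rw [e]; ring
    linear_combination (d * bb d lam (m + 1) (k + 1 + 1) * (w - cc d lam (k+1+1)) * (w - lam)) * e2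
      - (d * bb d lam (m + 1) (k + 1 + 1) * (w - cc d lam (k+1+1)) * (w - lam)) * e3
  have sumform : ∀ g : ℕ → ℂ, ∑ k ∈ Finset.Icc 1 (m+1), g k = ∑ k ∈ Finset.range (m+1), g (k+1) := by
    intro g
    rw [Finset.range_eq_Ico, Finset.sum_Ico_add']; rfl
  rw [QQ, qq]
  rw [sumform, sumform, sumform]
  simp only [← hb]
  rw [Finset.sum_range_succ, Finset.sum_congr rfl key,
    Finset.sum_range_succ', Finset.sum_range_succ' (fun k => b (k+1)), Finset.sum_sub_distrib,
    ← Finset.sum_div (f := fun k => b (k+2))]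
  have hbn : b (m+1) = 1 := bb_self _ _ _
  rw [hbn, cc_one d (by omega)]
  have hw3 : w - cc d lam (m+1+1) ≠ 0 := sub_ne_zero.2 (h (m+1) (by simp))
  simp only [zero_add, cc_one d (by omega : d ≠ 0), add_assoc, one_add_one_eq_two]
  field_simp
  ring

end Stm9

namespace Stm9
open MeasureTheory Real Set Metric Filter Topology
open scoped ENNReal NNReal

lemma circ_one (a : ℂ) (t : ℝ) (ht : 0 < t) (h : ‖a‖ ≠ t) (b : ℂ) :
    (∮ z in C(0, t), b / (z - a)) = if ‖a‖ < t then 2 * π * Complex.I * b else 0 := by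
  simp only [div_eq_mul_inv]
  rw [circleIntegral.integral_const_mul]
  split_ifs with h1
  · rw [circleIntegral.integral_sub_inv_of_mem_ball (by simpa using h1)]; ring
  · have : (∮ z in C(0, t), (z - a)⁻¹) = 0 := by
      have hlt : t < ‖a‖ := lt_of_le_of_ne (not_lt.1 h1) (Ne.symm h)
      have hne : ∀ z ∈ closedBall (0:ℂ) t, z - a ≠ 0 := by
        intro z hz h0
        rw [sub_eq_zero.1 h0] at hz
        simp at hz; linarith
      apply Complex.circleIntegral_eq_zero_of_differentiable_on_off_countable ht.le countable_empty
      · exact ContinuousOn.inv₀ (by fun_prop) hne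
      · intro z hz
        exact DifferentiableAt.inv (by fun_prop) (hne z (ball_subset_closedBall hz.1))
    rw [this, mul_zero]

lemma circ_qq (d : ℕ) (lam : ℂ) (n : ℕ) (t : ℝ) (ht : 0 < t)
    (h : ∀ k ∈ Finset.Icc 1 n, ‖cc d lam k‖ ≠ t) :
    (∮ z in C(0, t), qq d lam n z) =
      2 * π * Complex.I * ∑ k ∈ Finset.Icc 1 n with ‖cc d lam k‖ < t, bb d lam n k := by
  simp only [qq]
  rw [circleIntegral.integral_fun_sum]
  · rw [Finset.mul_sum, Finset.sum_filter]
    exact Finset.sum_congr rfl fun k hk => circ_one _ t ht (h k hk) _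
  · intro k hk
    apply ContinuousOn.circleIntegrable ht.le
    apply ContinuousOn.div (by fun_prop) (by fun_prop)
    intro z hz h0
    rw [sub_eq_zero.1 h0] at hz
    exact h k hk (by simpa using hz)

lemma bb_norm_le (d : ℕ) (lam : ℂ) (n : ℕ) (b G : ℝ) (hb : ∀ k, 1 ≤ k → k < n → ‖cc d lam k‖ ≤ b)
    (hG : d * b ^ (d - 1) ≤ G) (k : ℕ) (hk : 1 ≤ k) (hkn : k ≤ n) :
    ‖bb d lam n k‖ ≤ G ^ (n - k) := by
  rw [bb, norm_prod]
  calc ∏ i ∈ Finset.Ico k n, ‖(d : ℂ) * cc d lam i ^ (d - 1)‖ ≤ ∏ i ∈ Finset.Ico k n, G := by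
        refine Finset.prod_le_prod (fun i _ => norm_nonneg _) fun i hi => ?_
        have hi' := Finset.mem_Ico.1 hi
        refine le_trans ?_ hG
        rw [norm_mul, norm_pow, Complex.norm_natCast]
        gcongr
        exact hb i (by omega) hi'.2
    _ = G ^ (n - k) := by simp

lemma geom3 (G : ℝ) (hG : 3 ≤ G) (m : ℕ) : ∑ i ∈ Finset.range (m+1), G ^ i ≤ 3 / 2 * G ^ m := by
  induction m with
  | zero => norm_num
  | succ m ih =>
    rw [Finset.sum_range_succ]
    have : (0:ℝ) < G ^ m := by positivity
    rw [pow_succ]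
    nlinarith

lemma sum_small (d : ℕ) (hd : 1 < d) (lam : ℂ) (n : ℕ) (hn : 1 ≤ n) (b ρ G : ℝ)
    (hb : ∀ k, 1 ≤ k → k < n → ‖cc d lam k‖ ≤ b) (hρ0 : 0 < ρ)
    (hG : d * b ^ (d - 1) ≤ G) (hG2 : 3 / 2 * d ≤ G)
    (hsm : 8 * ρ ^ (d - 1) * G ^ (n - 1) ≤ 1) (t : ℝ) (ht : t < ρ) (htn : ‖cc d lam n‖ < t) :
    7 / 8 ≤ ‖∑ k ∈ Finset.Icc 1 n with ‖cc d lam k‖ < t, bb d lam n k‖ := by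
  have hd2 : (2:ℝ) ≤ d := by exact_mod_cast hd
  have hG3 : 3 ≤ G := by linarith
  rw [Finset.sum_filter]
  obtain ⟨m, rfl⟩ : ∃ m, n = m + 1 := ⟨n - 1, by omega⟩
  rw [Finset.sum_Icc_succ_top (by omega), if_pos htn, bb_self]
  have key : ‖∑ k ∈ Finset.Icc 1 m, if ‖cc d lam k‖ < t then bb d lam (m+1) k else 0‖ ≤ 1 / 8 := by
    rcases Nat.eq_zero_or_pos m with rfl | hm
    · simp
    obtain ⟨p, rfl⟩ : ∃ p, m = p + 1 := ⟨m - 1, by omega⟩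
    have : ∀ k ∈ Finset.Icc 1 (p+1), ‖if ‖cc d lam k‖ < t then bb d lam (p+1+1) k else 0‖ ≤
        d * ρ ^ (d-1) * G ^ (p + 1 - k) := by
      intro k hk
      have hk' := Finset.mem_Icc.1 hk
      split_ifs with h
      · rw [bb_step d lam (p+1+1) k (by omega), norm_mul, norm_mul, norm_pow, Complex.norm_natCast]
        have h2 := bb_norm_le d lam (p+1+1) b G hb hG (k+1) (by omega) (by omega)
        rw [show p + 1 + 1 - (k+1) = p + 1 - k by omega] at h2
        gcongr
        linarith
      · rw [norm_zero]; positivity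
    calc _ ≤ ∑ k ∈ Finset.Icc 1 (p+1), d * ρ ^ (d-1) * G ^ (p + 1 - k) :=
          (norm_sum_le _ _).trans (Finset.sum_le_sum this)
      _ = d * ρ ^ (d-1) * ∑ i ∈ Finset.range (p+1), G ^ i := by
          rw [← Finset.mul_sum]
          congr 1
          rw [← Finset.sum_range_reflect]
          have := Finset.sum_Ico_add' (fun k => G ^ (p + 1 - k)) 0 (p+1) 1
          rw [← Finset.range_eq_Ico] at this
          rw [show Finset.Icc 1 (p+1) = Finset.Ico (0+1) (p+1+1) from rfl, ← this]
          refine Finset.sum_congr rfl fun x _ => ?_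
          congr 1; omega
      _ ≤ d * ρ ^ (d-1) * (3 / 2 * G ^ p) := by gcongr; exact geom3 G hG3 p
      _ = ρ ^ (d-1) * G ^ p * (3 / 2 * d) := by ring
      _ ≤ ρ ^ (d-1) * G ^ p * G := by gcongr
      _ ≤ 1 / 8 := by
          simp only [Nat.add_sub_cancel, pow_succ] at hsm
          linarith
  have := norm_sub_le (1 + ∑ k ∈ Finset.Icc 1 m, if ‖cc d lam k‖ < t then bb d lam (m+1) k else 0)
    (∑ k ∈ Finset.Icc 1 m, if ‖cc d lam k‖ < t then bb d lam (m+1) k else 0)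
  rw [add_sub_cancel_right, norm_one, add_comm (1:ℂ)] at this
  linarith

/-- the set of good radii -/
lemma good_meas (n : ℕ) (hn : 1 ≤ n) (a δ : ℕ → ℝ) (ρ G : ℝ) (hρ0 : 0 < ρ) (hG : 3 ≤ G)
    (p : ℝ) (hp : 0 < p) (hδ : ∀ k, δ k = p * G ^ (k - 1)) (hδn : δ n ≤ ρ / 8) :
    ENNReal.ofReal (ρ / 2) ≤
      volume (Ioo (ρ / 8) ρ \ ⋃ k ∈ Finset.Icc 1 n, Ioo (a k - δ k) (a k + δ k)) := by
  have hbad : volume (⋃ k ∈ Finset.Icc 1 n, Ioo (a k - δ k) (a k + δ k)) ≤ ENNReal.ofReal (3 * ρ / 8) := by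
    refine (measure_biUnion_finset_le _ _).trans ?_
    simp only [Real.volume_Ioo]
    rw [← ENNReal.ofReal_sum_of_nonneg]
    · apply ENNReal.ofReal_le_ofReal
      obtain ⟨m, rfl⟩ : ∃ m, n = m + 1 := ⟨n - 1, by omega⟩
      have : ∑ k ∈ Finset.Icc 1 (m+1), (a k + δ k - (a k - δ k)) = 2 * p * ∑ i ∈ Finset.range (m+1), G ^ i := by
        rw [Finset.mul_sum, show Finset.Icc 1 (m+1) = Finset.Ico (0+1) (m+1+1) from rfl,
          ← Finset.sum_Ico_add' (fun k => (a k + δ k - (a k - δ k))), ← Finset.range_eq_Ico]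
        refine Finset.sum_congr rfl fun x _ => ?_
        rw [hδ, Nat.add_sub_cancel]; ring
      rw [this]
      have h3 := geom3 G hG m
      rw [hδ, Nat.add_sub_cancel] at hδn
      nlinarith
    · intro k _
      rw [hδ]; ring_nf; positivity
  calc ENNReal.ofReal (ρ / 2) = ENNReal.ofReal (ρ - ρ / 8) - ENNReal.ofReal (3 * ρ / 8) := by
        rw [← ENNReal.ofReal_sub _ (by positivity)]; congr 1; ring
    _ ≤ volume (Ioo (ρ / 8) ρ) - volume (⋃ k ∈ Finset.Icc 1 n, Ioo (a k - δ k) (a k + δ k)) := by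
        rw [Real.volume_Ioo]; gcongr
    _ ≤ _ := le_measure_sdiff

lemma pow_sub_le (d : ℕ) (x y : ℂ) (R : ℝ) (hx : ‖x‖ ≤ R) (hy : ‖y‖ ≤ R) :
    ‖x ^ d - y ^ d‖ ≤ d * R ^ (d - 1) * ‖x - y‖ := by
  rw [← (Commute.all x y).geom_sum₂_mul d, norm_mul]
  gcongr
  refine (norm_sum_le _ _).trans ?_
  calc _ ≤ ∑ i ∈ Finset.range d, R ^ (d - 1) := by
        refine Finset.sum_le_sum fun i hi => ?_
        have hi' : i < d := by simpa using hi
        rw [norm_mul, norm_pow, norm_pow]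
        have hR : 0 ≤ R := (norm_nonneg _).trans hx
        calc ‖x‖ ^ i * ‖y‖ ^ (d - 1 - i) ≤ R ^ i * R ^ (d - 1 - i) := by gcongr
          _ = R ^ (d - 1) := by rw [← pow_add]; congr 1; omega
    _ = _ := by simp

end Stm9

namespace Stm9
open MeasureTheory Real Set Metric Filter Topology
open scoped ENNReal NNReal

lemma err_int (lam : ℂ) (V : Set ℂ) (hV : MeasurableSet V) (δ : ℝ) (hδ : 0 < δ) (hδ4 : δ ≤ 4)
    (hVs : ∀ w ∈ V, ‖w - lam‖ < 4 ∧ δ ≤ ‖w - lam‖) (err : ℂ → ℂ) (A B : ℝ) (hA : 0 ≤ A) (hB : 0 ≤ B)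
    (he : ∀ w ∈ V, ‖err w‖ ≤ A * (1 / ‖w - lam‖) + B * (1 / ‖w - lam‖ ^ 2)) :
    ∫⁻ w in V, ‖err w‖ₑ ≤ ENNReal.ofReal (8 * π * A + B * (2 * π * Real.log (4 / δ))) := by
  set g1 : ℂ → ℝ≥0∞ := (ball (0:ℂ) 4).indicator (fun w => ENNReal.ofReal (1 / ‖w‖)) with hg1
  set g2 : ℂ → ℝ≥0∞ := (ball (0:ℂ) 4 \ ball 0 δ).indicator (fun w => ENNReal.ofReal (1 / ‖w‖ ^ 2)) with hg2
  have hg1m : Measurable g1 := Measurable.indicator (by fun_prop) measurableSet_ball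
  have hg2m : Measurable g2 := Measurable.indicator (by fun_prop) (measurableSet_ball.diff measurableSet_ball)
  calc ∫⁻ w in V, ‖err w‖ₑ ≤ ∫⁻ w in V, (ENNReal.ofReal A * g1 (w - lam) + ENNReal.ofReal B * g2 (w - lam)) := by
        refine setLIntegral_mono' hV fun w hw => ?_
        obtain ⟨h1, h2⟩ := hVs w hw
        rw [hg1, hg2, indicator_of_mem (by simpa using h1), indicator_of_mem (by simpa using ⟨h1, h2⟩),
          ← ENNReal.ofReal_mul hA, ← ENNReal.ofReal_mul hB, ← ENNReal.ofReal_add (by positivity) (by positivity),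
          ← ofReal_norm]
        exact ENNReal.ofReal_le_ofReal (he w hw)
    _ ≤ ∫⁻ w, (ENNReal.ofReal A * g1 (w - lam) + ENNReal.ofReal B * g2 (w - lam)) :=
        setLIntegral_le_lintegral _ _
    _ = ∫⁻ w, (ENNReal.ofReal A * g1 w + ENNReal.ofReal B * g2 w) :=
        lintegral_sub_right_eq_self (fun w => ENNReal.ofReal A * g1 w + ENNReal.ofReal B * g2 w) lam
    _ = ENNReal.ofReal A * (∫⁻ w, g1 w) + ENNReal.ofReal B * ∫⁻ w, g2 w := by
        rw [lintegral_add_left (by fun_prop), lintegral_const_mul _ hg1m, lintegral_const_mul _ hg2m]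
    _ ≤ ENNReal.ofReal A * ENNReal.ofReal (2 * π * 4) + ENNReal.ofReal B * ENNReal.ofReal (2 * π * Real.log (4 / δ)) := by
        gcongr
        · rw [hg1, lintegral_indicator measurableSet_ball]; exact radial1 4 (by norm_num)
        · rw [hg2, lintegral_indicator (measurableSet_ball.diff measurableSet_ball)]; exact radial2 δ 4 hδ hδ4
    _ = _ := by
        have : 0 ≤ Real.log (4 / δ) := Real.log_nonneg (by rw [le_div_iff₀ hδ]; linarith)
        rw [← ENNReal.ofReal_mul hA, ← ENNReal.ofReal_mul hB, ← ENNReal.ofReal_add (by positivity) (by positivity)]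
        congr 1; ring

lemma trans_main (d : ℕ) (hd : 1 < d) (lam : ℂ) (hl : ‖lam‖ ≤ 2) (n : ℕ) (hn : 1 ≤ n) (b ρ G : ℝ)
    (hb0 : 0 ≤ b)
    (hb : ∀ k, 1 ≤ k → k < n → ‖cc d lam k‖ ≤ b) (hρ0 : 0 < ρ) (hρ1 : ρ ≤ 1)
    (hG : d * (b + ρ) ^ (d - 1) ≤ G) (hG2 : 3 / 2 * d ≤ G)
    (hsm : 8 * ρ ^ (d - 1) * G ^ (n - 1) ≤ 1) (hε : ‖cc d lam n‖ ≤ ρ / 8) :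
    2 * ρ ≤ 8 * π * ‖∑ k ∈ Finset.Icc 1 n, bb d lam n k‖ +
      (‖cc d lam n‖ / d * (8 / 7)) * (2 * π * Real.log (4 / ρ ^ d)) := by
  have hd2 : (2:ℝ) ≤ d := by exact_mod_cast hd
  have hd0 : d ≠ 0 := by omega
  have hG3 : 3 ≤ G := by linarith
  set δ : ℕ → ℝ := fun k => ρ ^ d * G ^ (k - 1) with hδ
  have hδpos : ∀ k, 0 < δ k := fun k => by positivity
  have hρd : ρ ^ d = ρ * ρ ^ (d - 1) := by rw [← pow_succ']; congr 1; omega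
  have hδn : δ n ≤ ρ / 8 := by
    simp only [hδ, hρd]; nlinarith
  have hδmono : ∀ k ≤ n, δ k ≤ δ n := by
    intro k hk
    simp only [hδ]
    gcongr
    · linarith
  have hδ1 : δ 1 = ρ ^ d := by simp [hδ]
  have hρd1 : ρ ^ d ≤ 1 := pow_le_one₀ hρ0.le hρ1
  set N : Set ℂ := ⋃ k ∈ Finset.Icc 1 n, ball (cc d lam k) (δ k) with hN
  have hNm : MeasurableSet N := Finset.measurableSet_biUnion _ fun k _ => measurableSet_ball
  have hc1 : cc d lam 1 = lam := cc_one d hd0 lam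
  have hN1 : ball lam (ρ ^ d) ⊆ N := by
    intro z hz
    refine mem_biUnion (show 1 ∈ Finset.Icc 1 n by simp [hn]) ?_
    rw [hc1, hδ1]; exact hz
  have hdisc : ∀ z, ‖z‖ < ρ → fc d lam z ∈ N := by
    intro z hz
    apply hN1
    simp only [fc, mem_ball, dist_eq_norm, add_sub_cancel_right, norm_pow]
    gcongr
  have hNinv : ∀ z ∈ N, fc d lam z ∈ N := by
    intro z hz
    simp only [hN, mem_iUnion] at hz
    obtain ⟨k, hk, hz⟩ := hz
    have hk' := Finset.mem_Icc.1 hk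
    rw [mem_ball, dist_eq_norm] at hz
    have htri : ‖z‖ ≤ ‖z - cc d lam k‖ + ‖cc d lam k‖ := by
      simpa using norm_add_le (z - cc d lam k) (cc d lam k)
    have := hδmono k hk'.2
    rcases lt_or_eq_of_le hk'.2 with hlt | heq
    · refine mem_biUnion (show k + 1 ∈ Finset.Icc 1 n by simp; omega) ?_
      have hbk := hb k hk'.1 hlt
      rw [mem_ball, dist_eq_norm, cc_succ, fc, add_sub_add_right_eq_sub]
      have h1 := pow_sub_le d z (cc d lam k) (b + ρ) (by linarith) (by linarith)
      have h2 : δ (k+1) = G * δ k := by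
        obtain ⟨m, rfl⟩ : ∃ m, k = m + 1 := ⟨k - 1, by omega⟩
        simp only [hδ, Nat.add_sub_cancel, pow_succ]; ring
      rw [h2]
      calc _ ≤ _ := h1
        _ ≤ G * ‖z - cc d lam k‖ := by gcongr
        _ < G * δ k := by gcongr
    · subst heq
      apply hdisc
      linarith
  set V : Set ℂ := ball 0 2 \ N with hV
  have hVm : MeasurableSet V := measurableSet_ball.diff hNm
  have hpre : fc d lam ⁻¹' V ⊆ V \ ball 0 ρ := by
    intro z hz
    have hz' : fc d lam z ∈ V := hz
    refine ⟨⟨?_, fun h => hz'.2 (hNinv z h)⟩, fun h => hz'.2 (hdisc z (by simpa using h))⟩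
    by_contra hcon
    have h2 : 2 ≤ ‖z‖ := by simpa using hcon
    have h3 : ‖fc d lam z‖ < 2 := by simpa using hz'.1
    have h4 : ‖z ^ d‖ ≤ ‖fc d lam z‖ + ‖lam‖ := by
      have := norm_sub_le (fc d lam z) lam
      simpa [fc] using this
    have h5 : (4:ℝ) ≤ ‖z ^ d‖ := by
      rw [norm_pow]
      calc (4:ℝ) = 2 ^ 2 := by norm_num
        _ ≤ 2 ^ d := pow_le_pow_right₀ (by norm_num) hd
        _ ≤ _ := by gcongr
    linarith
  -- points of V
  have hVc : ∀ w ∈ V, ∀ k ∈ Finset.Icc 1 n, δ k ≤ ‖w - cc d lam k‖ := by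
    intro w hw k hk
    by_contra hcon
    exact hw.2 (mem_biUnion hk (by simpa [dist_eq_norm] using hcon))
  have hVl : ∀ w ∈ V, ρ ^ d ≤ ‖w - lam‖ := by
    intro w hw
    have := hVc w hw 1 (by simp [hn])
    rwa [hc1, hδ1] at this
  have hcn1 : ‖cc d lam (n+1) - lam‖ ≤ ρ ^ d / 8 := by
    rw [cc_succ, add_sub_cancel_right, norm_pow]
    calc ‖cc d lam n‖ ^ d ≤ (ρ / 8) ^ d := by gcongr
      _ = ρ ^ d / 8 ^ d := by rw [div_pow]
      _ ≤ ρ ^ d / 8 := by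
        gcongr
        exact le_self_pow₀ (by norm_num) hd0
  have hVn1 : ∀ w ∈ V, 7 / 8 * ‖w - lam‖ ≤ ‖w - cc d lam (n+1)‖ := by
    intro w hw
    have h1 := hVl w hw
    have h2 : ‖w - lam‖ ≤ ‖w - cc d lam (n+1)‖ + ‖cc d lam (n+1) - lam‖ := by
      simpa using norm_add_le (w - cc d lam (n+1)) (cc d lam (n+1) - lam)
    linarith
  have hVne : ∀ w ∈ V, ∀ k ∈ Finset.Icc 1 n, w ≠ cc d lam (k+1) := by
    intro w hw k hk h0
    have hk' := Finset.mem_Icc.1 hk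
    rcases lt_or_eq_of_le hk'.2 with hlt | heq
    · have := hVc w hw (k+1) (by simp; omega)
      rw [h0, sub_self, norm_zero] at this
      linarith [hδpos (k+1)]
    · subst heq
      have h1 := hVn1 w hw
      rw [h0, sub_self, norm_zero] at h1
      have h2 := hVl w hw
      rw [h0] at h2
      have : 0 < ρ ^ d := by positivity
      linarith
  obtain ⟨ζ, hζ⟩ : ∃ ζ : ℂ, IsPrimitiveRoot ζ d := ⟨_, Complex.isPrimitiveRoot_exp d hd0⟩
  set q := qq d lam n with hq
  set Q := QQ d lam n with hQ
  have hqm : Measurable q := by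
    rw [hq]; unfold qq; fun_prop
  have hQm : Measurable Q := by
    rw [hQ]; unfold QQ; fun_prop
  have hpush : ∫⁻ w in V, ‖Q w‖ₑ ≤ ∫⁻ z in (fc d lam) ⁻¹' V, ‖q z‖ₑ := by
    apply push_le d hd lam q Q hqm ζ hζ V hVm
    intro z hz hzV
    exact QQ_push d hd lam n ζ hζ z hz (hVne _ hzV)
  -- finiteness
  have hfin : ∫⁻ w in V, ‖q w‖ₑ ≠ ⊤ := by
    have : ∀ w ∈ V, ‖q w‖ₑ ≤ ENNReal.ofReal (∑ k ∈ Finset.Icc 1 n, ‖bb d lam n k‖ / δ k) := by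
      intro w hw
      rw [← ofReal_norm]
      apply ENNReal.ofReal_le_ofReal
      refine (norm_sum_le _ _).trans (Finset.sum_le_sum fun k hk => ?_)
      rw [norm_div]
      have := hδpos k
      gcongr
      exact hVc w hw k hk
    refine ne_top_of_le_ne_top ?_ (setLIntegral_mono' hVm this)
    rw [setLIntegral_const]
    refine ENNReal.mul_ne_top ENNReal.ofReal_ne_top ?_
    exact ne_top_of_le_ne_top (measure_ball_lt_top (x := (0:ℂ)) (r := 2)).ne (measure_mono sdiff_subset)
  set F' := ∑ k ∈ Finset.Icc 1 n, bb d lam n k with hF'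
  have herr : ∫⁻ w in V, ‖q w - Q w‖ₑ ≤ ENNReal.ofReal (8 * π * ‖F'‖ +
      (‖cc d lam n‖ / d * (8 / 7)) * (2 * π * Real.log (4 / ρ ^ d))) := by
    apply err_int lam V hVm (ρ ^ d) (by positivity) (by linarith)
    · intro w hw
      refine ⟨?_, hVl w hw⟩
      have h2 : ‖w‖ < 2 := by simpa using hw.1
      linarith [norm_sub_le w lam]
    · positivity
    · positivity
    · intro w hw
      have hpos : 0 < ‖w - lam‖ := lt_of_lt_of_le (by positivity) (hVl w hw)
      have hne : w ≠ lam := by intro h; rw [h, sub_self, norm_zero] at hpos; exact lt_irrefl _ hpos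
      have e : q w - Q w = F' / (w - lam) - (cc d lam n / d) / ((w - lam) * (w - cc d lam (n + 1))) := by
        rw [hQ, QQ_eq d hd lam n hn w hne (hVne w hw)]; ring
      rw [e]
      refine (norm_sub_le _ _).trans ?_
      rw [norm_div, norm_div, norm_mul, norm_div, Complex.norm_natCast]
      apply add_le_add
      · rw [mul_one_div]
      · have h7 := hVn1 w hw
        rw [show ‖cc d lam n‖ / d * (8 / 7) * (1 / ‖w - lam‖ ^ 2) =
          ‖cc d lam n‖ / d / (‖w - lam‖ * (7 / 8 * ‖w - lam‖)) by field_simp]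
        gcongr
  have hmain : ∫⁻ w in V ∩ ball 0 ρ, ‖q w‖ₑ ≤ ∫⁻ w in V, ‖q w - Q w‖ₑ := by
    have h1 : ∫⁻ w in V, ‖q w‖ₑ ≤ (∫⁻ w in V, ‖q w - Q w‖ₑ) + ∫⁻ w in V \ ball 0 ρ, ‖q w‖ₑ := by
      calc ∫⁻ w in V, ‖q w‖ₑ ≤ ∫⁻ w in V, (‖q w - Q w‖ₑ + ‖Q w‖ₑ) := by
            refine lintegral_mono fun w => ?_
            simpa using enorm_add_le (q w - Q w) (Q w)
        _ = (∫⁻ w in V, ‖q w - Q w‖ₑ) + ∫⁻ w in V, ‖Q w‖ₑ := lintegral_add_left (by fun_prop) _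
        _ ≤ _ := add_le_add_right (hpush.trans (lintegral_mono_set hpre)) _
    rw [← lintegral_inter_add_sdiff _ V (measurableSet_ball (x := (0:ℂ)) (ε := ρ))] at h1
    refine (ENNReal.add_le_add_iff_right ?_).1 h1
    exact ne_top_of_le_ne_top hfin (lintegral_mono_set sdiff_subset)
  -- lower bound
  set Good : Set ℝ := Ioo (ρ / 8) ρ \ ⋃ k ∈ Finset.Icc 1 n, Ioo (‖cc d lam k‖ - δ k) (‖cc d lam k‖ + δ k) with hGood
  have hGm : MeasurableSet Good :=
    measurableSet_Ioo.diff (Finset.measurableSet_biUnion _ fun k _ => measurableSet_Ioo)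
  have hgv := good_meas n hn (fun k => ‖cc d lam k‖) δ ρ G hρ0 hG3 (ρ ^ d) (by positivity) (fun k => rfl) hδn
  have hgt : ∀ t ∈ Good, ∀ k ∈ Finset.Icc 1 n, δ k ≤ |t - ‖cc d lam k‖| := by
    intro t ht k hk
    by_contra hcon
    rw [not_le, abs_lt] at hcon
    exact ht.2 (mem_biUnion hk ⟨by linarith, by linarith⟩)
  have hlow : ENNReal.ofReal (2 * π * (7 / 8)) * volume Good ≤ ∫⁻ w in V ∩ ball 0 ρ, ‖q w‖ₑ := by
    rw [← lintegral_indicator (hVm.inter measurableSet_ball)]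
    apply polar_lower _ (Measurable.indicator (by fun_prop) (hVm.inter measurableSet_ball)) Good hGm
    · intro t ht; have := ht.1.1; simp only [mem_Ioi]; linarith
    · intro t ht
      have ht0 : 0 < t := by have := ht.1.1; linarith
      have hmem : ∀ θ, circleMap 0 t θ ∈ V ∩ ball 0 ρ := by
        intro θ
        have hnorm : ‖circleMap 0 t θ‖ = t := by simp [abs_of_pos ht0]
        refine ⟨⟨by simp only [mem_ball_zero_iff, hnorm]; linarith [ht.1.2], ?_⟩, by simp only [mem_ball_zero_iff, hnorm]; exact ht.1.2⟩
        intro hc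
        simp only [hN, mem_iUnion] at hc
        obtain ⟨k, hk, hc⟩ := hc
        rw [mem_ball, dist_eq_norm] at hc
        have h1 := hgt t ht k hk
        have h2 := abs_norm_sub_norm_le (circleMap 0 t θ) (cc d lam k)
        rw [hnorm] at h2
        linarith
      have hind : ∀ θ, (V ∩ ball 0 ρ).indicator (fun w => ‖q w‖ₑ) (circleMap 0 t θ) = ‖q (circleMap 0 t θ)‖ₑ :=
        fun θ => indicator_of_mem (hmem θ) _
      simp only [hind]
      refine le_trans ?_ (circle_le q t ht0)
      rw [hq, circ_qq d lam n t ht0]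
      · rw [← ofReal_norm]
        apply ENNReal.ofReal_le_ofReal
        have hs := sum_small d hd lam n hn b ρ G hb hρ0 ?_ hG2 hsm t ht.1.2 (by linarith [ht.1.1])
        · simp only [norm_mul, Complex.norm_I, Complex.norm_ofNat, Complex.norm_real, mul_one,
            Real.norm_eq_abs, abs_of_pos pi_pos]
          gcongr
        · refine le_trans ?_ hG
          gcongr
          linarith
      · intro k hk h0
        have := hgt t ht k hk
        rw [h0, sub_self, abs_zero] at this
        linarith [hδpos k]
  have hfinal : ENNReal.ofReal (2 * ρ) ≤ ENNReal.ofReal (8 * π * ‖F'‖ +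
      (‖cc d lam n‖ / d * (8 / 7)) * (2 * π * Real.log (4 / ρ ^ d))) := by
    calc ENNReal.ofReal (2 * ρ) ≤ ENNReal.ofReal (2 * π * (7 / 8)) * ENNReal.ofReal (ρ / 2) := by
          rw [← ENNReal.ofReal_mul (by positivity)]
          apply ENNReal.ofReal_le_ofReal
          nlinarith [pi_gt_three]
      _ ≤ _ := by gcongr
      _ ≤ _ := hlow
      _ ≤ _ := hmain
      _ ≤ _ := herr
  refine (ENNReal.ofReal_le_ofReal_iff ?_).1 hfinal
  have : 0 ≤ Real.log (4 / ρ ^ d) := Real.log_nonneg (by rw [le_div_iff₀ (by positivity)]; linarith)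
  positivity

end Stm9

namespace Stm9
open MeasureTheory Real Set Metric Filter Topology
open scoped ENNReal NNReal

noncomputable def Bd (d : ℕ) : ℝ := (2:ℝ) ^ ((d:ℝ) - 1)⁻¹
noncomputable def sg (d n : ℕ) : ℝ := Real.exp (-(2 * Real.log d / ((d:ℝ) - 1)) * ((n:ℝ) - 1))

lemma Bd_pow (d : ℕ) (hd : 1 < d) : Bd d ^ (d - 1) = 2 := by
  rw [Bd, ← Real.rpow_natCast, ← Real.rpow_mul (by norm_num), Nat.cast_sub hd.le, Nat.cast_one,
    inv_mul_cancel₀, Real.rpow_one]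
  have : (1:ℝ) < d := by exact_mod_cast hd
  linarith

lemma Bd_one (d : ℕ) (hd : 1 < d) : 1 < Bd d := by
  have : (1:ℝ) < d := by exact_mod_cast hd
  exact Real.one_lt_rpow (by norm_num) (inv_pos.2 (by linarith))

lemma Bd_two (d : ℕ) (hd : 1 < d) : Bd d ≤ 2 := by
  have h1 := Bd_pow d hd
  have h2 := Bd_one d hd
  calc Bd d ≤ Bd d ^ (d - 1) := le_self_pow₀ h2.le (by omega)
    _ = 2 := h1

lemma Bd_pow' (d : ℕ) (hd : 1 < d) : Bd d ^ d = 2 * Bd d := by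
  rw [← Bd_pow d hd, ← pow_succ]; congr 1; omega

lemma sg_pos (d n : ℕ) : 0 < sg d n := Real.exp_pos _

lemma sg_pow (d n : ℕ) (hd : 1 < d) (hn : 1 ≤ n) : sg d n ^ (d - 1) * ((d:ℝ) * d) ^ (n - 1) = 1 := by
  have hd1 : (1:ℝ) < d := by exact_mod_cast hd
  have hd0 : (0:ℝ) < d := by linarith
  have e : ((d:ℝ) * d) ^ (n - 1) = Real.exp (2 * Real.log d * ((n:ℝ) - 1)) := by
    rw [show 2 * Real.log d * ((n:ℝ) - 1) = ((n - 1 : ℕ) : ℝ) * (Real.log d + Real.log d) by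
      rw [Nat.cast_sub hn]; push_cast; ring]
    rw [Real.exp_nat_mul, Real.exp_add, Real.exp_log hd0]
  rw [e, sg, ← Real.exp_nat_mul, ← Real.exp_add, Nat.cast_sub hd.le, Nat.cast_one]
  rw [Real.exp_eq_one_iff]
  have : (d:ℝ) - 1 ≠ 0 := by linarith
  field_simp
  ring

lemma sg_le_one (d n : ℕ) (hd : 1 < d) (hn : 1 ≤ n) : sg d n ≤ 1 := by
  have hd1 : (1:ℝ) < d := by exact_mod_cast hd
  have hn1 : (1:ℝ) ≤ n := by exact_mod_cast hn
  rw [sg, Real.exp_le_one_iff]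
  have : 0 ≤ 2 * Real.log d / ((d:ℝ) - 1) :=
    div_nonneg (by have := Real.log_nonneg hd1.le; linarith) (by linarith)
  nlinarith

lemma orbit_escape (d : ℕ) (lam : ℂ) (b : ℝ) (hb : 0 ≤ b) (hl : ‖lam‖ ≤ b ^ d - b) (hd : d ≠ 0)
    (k : ℕ) (hk : b < ‖cc d lam k‖) (j : ℕ) : b < ‖cc d lam (k + j)‖ := by
  induction j with
  | zero => exact hk
  | succ j ih =>
    rw [← add_assoc, cc_succ]
    have h1 : ‖cc d lam (k+j) ^ d‖ ≤ ‖cc d lam (k+j) ^ d + lam‖ + ‖lam‖ := by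
      simpa using norm_sub_le (cc d lam (k+j) ^ d + lam) lam
    have h2 : b ^ d < ‖cc d lam (k+j) ^ d‖ := by rw [norm_pow]; gcongr
    linarith

lemma orbit_le (d : ℕ) (hd : d ≠ 0) (lam : ℂ) (b : ℝ) (hb : 0 ≤ b) (hl : ‖lam‖ ≤ b ^ d - b)
    (n : ℕ) (hn : ‖cc d lam n‖ ≤ b) (k : ℕ) (hk : k ≤ n) : ‖cc d lam k‖ ≤ b := by
  by_contra hcon
  have := orbit_escape d lam b hb hl hd k (not_le.1 hcon) (n - k)
  rw [Nat.add_sub_cancel' hk] at this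
  linarith

lemma lam_le (d : ℕ) (hd : 1 < d) (lam : ℂ) (n : ℕ) (hn : 1 ≤ n) (h : ‖cc d lam n‖ ≤ 1) : ‖lam‖ ≤ Bd d := by
  by_contra hcon
  rw [not_le] at hcon
  have h1 := Bd_one d hd
  have : ∀ k, ‖lam‖ ≤ ‖cc d lam (k+1)‖ := by
    intro k
    induction k with
    | zero => rw [zero_add, cc_one d (by omega)]
    | succ k ih =>
      rw [cc_succ]
      have h2 : ‖cc d lam (k+1) ^ d‖ ≤ ‖cc d lam (k+1) ^ d + lam‖ + ‖lam‖ := by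
        simpa using norm_sub_le (cc d lam (k+1) ^ d + lam) lam
      have h3 : ‖lam‖ ^ d ≤ ‖cc d lam (k+1) ^ d‖ := by rw [norm_pow]; gcongr
      have h4 : 2 * ‖lam‖ ≤ ‖lam‖ ^ d := by
        calc 2 * ‖lam‖ = Bd d ^ (d-1) * ‖lam‖ := by rw [Bd_pow d hd]
          _ ≤ ‖lam‖ ^ (d-1) * ‖lam‖ := by gcongr
          _ = ‖lam‖ ^ d := by rw [← pow_succ]; congr 1; omega
      linarith
  have := this (n-1)
  rw [Nat.sub_add_cancel hn] at this
  linarith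

lemma bern (d : ℕ) (hd : 1 < d) (δ : ℝ) (hδ : 0 ≤ δ) (hδ1 : δ / (2 * d) ≤ Bd d) :
    Bd d - δ ≤ (Bd d - δ / (2 * d)) ^ d - (Bd d - δ / (2 * d)) := by
  have hd1 : (1:ℝ) < d := by exact_mod_cast hd
  have h1 := Bd_one d hd
  set x := δ / (2 * d) with hx
  have hx0 : 0 ≤ x := by positivity
  have e : 2 * d * x = δ := by rw [hx]; field_simp
  have h := pow_sub_le d (Bd d : ℂ) ((Bd d - x : ℝ) : ℂ) (Bd d) (by simp [abs_of_pos (by linarith : 0 < Bd d)])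
    (by rw [Complex.norm_real, Real.norm_eq_abs, abs_of_nonneg (by linarith)]; linarith)
  rw [Bd_pow d hd] at h
  have e2 : ((Bd d : ℂ) ^ d - ((Bd d - x : ℝ) : ℂ) ^ d) = ((Bd d ^ d - (Bd d - x) ^ d : ℝ) : ℂ) := by push_cast; ring
  have e3 : ((Bd d : ℂ) - ((Bd d - x : ℝ) : ℂ)) = ((x : ℝ) : ℂ) := by push_cast; ring
  rw [e2, e3, Complex.norm_real, Complex.norm_real, Real.norm_eq_abs, Real.norm_eq_abs, abs_of_nonneg hx0] at h
  have h3 := (abs_le.1 h).2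
  rw [Bd_pow' d hd] at h3
  nlinarith

lemma cc_deriv' (d n : ℕ) (lam : ℂ) : deriv (fun l => cc d l n) lam = ∑ k ∈ Finset.Icc 1 n, bb d lam n k :=
  (cc_deriv d n lam).deriv

end Stm9

namespace Stm9
open MeasureTheory Real Set Metric Filter Topology
open scoped ENNReal NNReal

lemma log_sg (d n : ℕ) : Real.log (sg d n) = -(2 * Real.log d / ((d:ℝ) - 1)) * ((n:ℝ) - 1) := by
  rw [sg, Real.log_exp]

lemma log_sg_ge (d n : ℕ) (hd : 1 < d) (hn : 1 ≤ n) : - (2 * d * n : ℝ) ≤ Real.log (sg d n) := by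
  rw [log_sg]
  have hd2 : (2:ℝ) ≤ d := by exact_mod_cast hd
  have hn1 : (1:ℝ) ≤ n := by exact_mod_cast hn
  have h1 : Real.log d ≤ d - 1 := Real.log_le_sub_one_of_pos (by linarith)
  have h2 : 2 * Real.log d / ((d:ℝ) - 1) ≤ 2 := by
    rw [div_le_iff₀ (by linarith)]; linarith
  have h3 : 0 ≤ 2 * Real.log d / ((d:ℝ) - 1) :=
    div_nonneg (by have := Real.log_nonneg (by linarith : (1:ℝ) ≤ d); linarith) (by linarith)
  nlinarith

set_option maxHeartbeats 400000 in
lemma T1 (d : ℕ) (hd : 1 < d) : ∃ C : ℝ, 1 ≤ C ∧ ∀ n : ℕ, 1 ≤ n → ∀ lam : ℂ,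
    ‖cc d lam n‖ ≤ sg d n / (C * n ^ 2) → sg d n / (C * n) ≤ ‖deriv (fun l => cc d l n) lam‖ := by
  have hd2 : (2:ℝ) ≤ d := by exact_mod_cast hd
  set κ : ℝ := Real.exp (-((d:ℝ) - 1)) / 8 with hκ
  have hκ0 : 0 < κ := by positivity
  have hκ1 : κ ≤ 1 := by
    have : Real.exp (-((d:ℝ) - 1)) ≤ 1 := Real.exp_le_one_iff.2 (by linarith)
    rw [hκ]; linarith
  set L : ℝ := 2 + d * (-Real.log κ + 1 + 2 * d) with hL
  have hlogκ : Real.log κ ≤ 0 := Real.log_nonpos hκ0.le hκ1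
  have hL1 : 1 ≤ L := by
    have : 0 ≤ d * (-Real.log κ + 1 + 2 * d) := mul_nonneg (by linarith) (by linarith)
    rw [hL]; linarith
  have hpi := pi_gt_three
  clear_value L
  refine ⟨(8 * π + 16 * π * L) / κ, ?_, ?_⟩
  · rw [one_le_div hκ0]
    nlinarith [pi_gt_three]
  intro n hn lam h
  have hn1 : (1:ℝ) ≤ n := by exact_mod_cast hn
  have hn0 : (0:ℝ) < n := by linarith
  set σ := sg d n with hσ
  have hσ0 : 0 < σ := sg_pos d n
  have hσ1 : σ ≤ 1 := sg_le_one d n hd hn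
  have hσp : σ ^ (d - 1) * ((d:ℝ) * d) ^ (n - 1) = 1 := sg_pow d n hd hn
  have hσl : - (2 * d * n : ℝ) ≤ Real.log σ := log_sg_ge d n hd hn
  clear_value σ κ
  set C := (8 * π + 16 * π * L) / κ with hC
  have hCκ : C * κ = 8 * π + 16 * π * L := by rw [hC]; field_simp
  have hC0 : 0 < C := by rw [hC]; have := pi_pos; positivity
  clear_value C
  set ρ := κ * σ / n with hρ
  have hρ0 : 0 < ρ := by positivity
  clear_value ρ
  have hρn : ρ ≤ 1 / n := by
    rw [hρ]; gcongr; nlinarith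
  have hρ1 : ρ ≤ 1 := hρn.trans (by rw [div_le_one hn0]; exact hn1)
  have hB1 := Bd_one d hd
  have hB2 := Bd_two d hd
  have hερ : ‖cc d lam n‖ ≤ ρ / 8 := by
    refine h.trans ?_
    rw [hρ, div_le_iff₀ (by positivity)]
    have : κ * σ / n / 8 * (C * n ^ 2) = σ * ((C * κ) / 8 * n) := by field_simp
    rw [this, hCκ]
    have h8 : 1 ≤ (8 * π + 16 * π * L) / 8 := by nlinarith
    have : 1 ≤ (8 * π + 16 * π * L) / 8 * n := by nlinarith
    nlinarith
  have hc1 : ‖cc d lam n‖ ≤ 1 := by linarith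
  have hl := lam_le d hd lam n hn hc1
  have horb : ∀ k, 1 ≤ k → k < n → ‖cc d lam k‖ ≤ Bd d := by
    intro k _ hk
    refine orbit_le d (by omega) lam (Bd d) (by linarith) ?_ n (by linarith) k hk.le
    rw [Bd_pow' d hd]; linarith
  obtain ⟨G, hG⟩ : ∃ G : ℝ, G = 2 * d * (1 + 1 / n) ^ (d - 1) := ⟨_, rfl⟩
  have hone : 1 ≤ (1 + 1 / (n:ℝ)) ^ (d - 1) := one_le_pow₀ (by have : 0 < 1 / (n:ℝ) := by positivity
                                                               linarith)
  have hGa : d * (Bd d + ρ) ^ (d - 1) ≤ G := by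
    have h1 : Bd d + ρ ≤ Bd d * (1 + 1 / n) := by
      have : 1 / (n:ℝ) ≤ Bd d * (1 / n) := by
        have : 0 < 1 / (n:ℝ) := by positivity
        nlinarith
      linarith
    calc d * (Bd d + ρ) ^ (d - 1) ≤ d * (Bd d * (1 + 1 / n)) ^ (d - 1) := by gcongr
      _ = G := by rw [mul_pow, Bd_pow d hd, hG]; ring
  have hGb : 3 / 2 * d ≤ G := by rw [hG]; nlinarith
  have hG0 : 0 ≤ G := by linarith
  have hexp : ((1 + 1 / (n:ℝ)) ^ (d - 1)) ^ (n - 1) ≤ Real.exp ((d:ℝ) - 1) := by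
    rw [← pow_mul]
    calc (1 + 1 / (n:ℝ)) ^ ((d - 1) * (n - 1)) ≤ (Real.exp (1 / n)) ^ ((d - 1) * (n - 1)) := by
          gcongr
          linarith [Real.add_one_le_exp (1 / (n:ℝ))]
      _ = Real.exp (((d:ℝ) - 1) * (((n:ℝ) - 1) / n)) := by
          rw [← Real.exp_nat_mul, Nat.cast_mul, Nat.cast_sub hd.le, Nat.cast_sub hn]
          congr 1; push_cast; ring
      _ ≤ _ := by
          rw [Real.exp_le_exp]
          have : ((n:ℝ) - 1) / n ≤ 1 := by rw [div_le_one hn0]; linarith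
          nlinarith
  have hsm : 8 * ρ ^ (d - 1) * G ^ (n - 1) ≤ 1 := by
    have h1 : ρ ^ (d-1) ≤ κ * σ ^ (d-1) := by
      calc ρ ^ (d-1) ≤ (κ * σ) ^ (d-1) := by
            gcongr
            rw [hρ]; exact div_le_self (by positivity) hn1
        _ = κ ^ (d-1) * σ ^ (d-1) := mul_pow _ _ _
        _ ≤ κ * σ ^ (d-1) := by
            gcongr
            exact pow_le_of_le_one hκ0.le hκ1 (by omega)
    have h2 : G ^ (n-1) ≤ ((d:ℝ) * d) ^ (n-1) * Real.exp ((d:ℝ) - 1) := by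
      rw [hG, mul_pow]
      gcongr
    have h3 := hσp
    calc 8 * ρ ^ (d - 1) * G ^ (n - 1) ≤ 8 * (κ * σ ^ (d-1)) * (((d:ℝ) * d) ^ (n-1) * Real.exp ((d:ℝ) - 1)) := by gcongr
      _ = 8 * κ * Real.exp ((d:ℝ) - 1) * (σ ^ (d-1) * ((d:ℝ) * d) ^ (n-1)) := by ring
      _ = Real.exp (-((d:ℝ) - 1)) * Real.exp ((d:ℝ) - 1) := by rw [h3, hκ]; ring
      _ = 1 := by rw [← Real.exp_add]; simp
      _ ≤ 1 := le_rfl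
  have main := trans_main d hd lam (hl.trans hB2) n hn (Bd d) ρ G (by linarith) horb hρ0 hρ1 hGa hGb hsm hερ
  rw [← cc_deriv'] at main
  set F' := ‖deriv (fun l => cc d l n) lam‖ with hF'
  have hlog : Real.log (4 / ρ ^ d) ≤ L * n := by
    rw [Real.log_div (by norm_num) (by positivity), Real.log_pow, hρ,
      Real.log_div (by positivity) (by positivity), Real.log_mul (by positivity) (by positivity)]
    have h1 : Real.log 4 ≤ 2 := by
      rw [show (4:ℝ) = 2 ^ 2 by norm_num, Real.log_pow]; push_cast
      linarith [Real.log_two_lt_d9]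
    have h2 := hσl
    have h3 : Real.log n ≤ n := by linarith [Real.log_le_sub_one_of_pos hn0]
    have h4 : -Real.log κ ≤ -Real.log κ * n := by nlinarith
    calc Real.log 4 - d * (Real.log κ + Real.log σ - Real.log n)
        = Real.log 4 + d * (-Real.log κ - Real.log σ + Real.log n) := by ring
      _ ≤ 2 * n + d * (-Real.log κ * n + 2 * d * n + n) := by
          gcongr
          · linarith
          · linarith
      _ = L * n := by rw [hL]; ring
  have hsecond : (‖cc d lam n‖ / d * (8 / 7)) * (2 * π * Real.log (4 / ρ ^ d)) ≤ ρ := by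
    have h1 : ‖cc d lam n‖ / d * (8 / 7) ≤ σ / (C * n ^ 2) := by
      have : ‖cc d lam n‖ / d ≤ ‖cc d lam n‖ / 2 := by gcongr
      have h0 := norm_nonneg (cc d lam n)
      linarith
    calc _ ≤ σ / (C * n ^ 2) * (2 * π * (L * n)) := by
          have : 0 ≤ Real.log (4 / ρ ^ d) := Real.log_nonneg (by
            rw [le_div_iff₀ (by positivity)]
            have : ρ ^ d ≤ 1 := pow_le_one₀ hρ0.le hρ1
            linarith)
          have := pi_pos
          gcongr
      _ = σ / n * (2 * π * L / C) := by field_simp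
      _ ≤ σ / n * κ := by
          gcongr
          rw [div_le_iff₀ hC0, mul_comm κ C, hCκ]
          nlinarith [pi_pos]
      _ = ρ := by rw [hρ]; ring
  have hfin : ρ ≤ 8 * π * F' := by linarith
  rw [div_le_iff₀ (by positivity)]
  have h5 : κ * σ ≤ 8 * π * F' * n := by
    rw [hρ, div_le_iff₀ hn0] at hfin; exact hfin
  have h6 : κ * (F' * (C * n)) = (8 * π + 16 * π * L) * F' * n := by rw [← hCκ]; ring
  have h7 : κ * σ ≤ κ * (F' * (C * n)) := by
    rw [h6]
    refine h5.trans ?_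
    have : 0 ≤ 16 * π * L * (F' * n) := by have := pi_pos; positivity
    linarith
  exact le_of_mul_le_mul_left h7 hκ0

end Stm9

namespace Stm9
open MeasureTheory Real Set Metric Filter Topology
open scoped ENNReal NNReal

lemma ev1 (d : ℕ) (hd : 1 < d) :
    ∀ᶠ n : ℕ in atTop, 8 * (26 * (n:ℝ) ^ 3) ^ (d - 1) * Real.exp (-(1 / (16 * d)) * √n) ≤ 1 := by
  have hd0 : (0:ℝ) < d := by exact_mod_cast (by omega : 0 < d)
  have h1 := tendsto_rpow_mul_exp_neg_mul_atTop_nhds_zero ((6 * (d - 1) : ℕ) : ℝ) (1 / (16 * d)) (by positivity)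
  have h2 : Tendsto (fun n : ℕ => √(n:ℝ)) atTop atTop :=
    Real.tendsto_sqrt_atTop.comp tendsto_natCast_atTop_atTop
  have h3 := (h1.comp h2).const_mul (8 * (26:ℝ) ^ (d-1))
  rw [mul_zero] at h3
  have h4 := h3.eventually (ge_mem_nhds (show (0:ℝ) < 1 by norm_num))
  filter_upwards [h4] with n hn
  refine le_trans (le_of_eq ?_) hn
  simp only [Function.comp, Real.rpow_natCast]
  rw [mul_pow, show 6 * (d-1) = 2 * (3 * (d - 1)) by ring, pow_mul, Real.sq_sqrt (Nat.cast_nonneg n), pow_mul]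
  ring

lemma ev2 (d : ℕ) (hd : 1 < d) :
    ∀ᶠ n : ℕ in atTop, 26 * (n:ℝ) ^ 3 * sg d n * (4 * d * n) ≤ 1 := by
  have hd1 : (1:ℝ) < d := by exact_mod_cast hd
  set a := 2 * Real.log d / ((d:ℝ) - 1) with ha
  have ha0 : 0 < a := div_pos (by have := Real.log_pos hd1; linarith) (by linarith)
  have h1 := tendsto_rpow_mul_exp_neg_mul_atTop_nhds_zero ((4 : ℕ) : ℝ) a ha0
  have h3 := (h1.comp (tendsto_natCast_atTop_atTop (R := ℝ))).const_mul (104 * d * Real.exp a)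
  rw [mul_zero] at h3
  have h4 := h3.eventually (ge_mem_nhds (show (0:ℝ) < 1 by norm_num))
  filter_upwards [h4] with n hn
  refine le_trans (le_of_eq ?_) hn
  simp only [Function.comp, Real.rpow_natCast]
  rw [sg, ← ha, show -a * ((n:ℝ) - 1) = a + -a * n by ring, Real.exp_add]
  ring

lemma T2 (d : ℕ) (hd : 1 < d) : ∃ n0 : ℕ, 1 ≤ n0 ∧ ∀ n : ℕ, n0 ≤ n → ∀ lam : ℂ, ‖lam‖ ≤ Bd d - 1 / √n →
    ‖cc d lam n‖ ≤ n * sg d n → n ^ 3 * sg d n ≤ ‖deriv (fun l => cc d l n) lam‖ := by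
  have hd2 : (2:ℝ) ≤ d := by exact_mod_cast hd
  have hd0 : (0:ℝ) < d := by linarith
  obtain ⟨L, hL⟩ : ∃ L : ℝ, L = 2 + d * (2 * d) := ⟨_, rfl⟩
  have hL1 : 1 ≤ L := by have : 0 < d * (2 * (d:ℝ)) := by positivity
                         linarith
  obtain ⟨n1, hn1⟩ := exists_nat_ge (8 * L)
  obtain ⟨n0, hn0⟩ := eventually_atTop.1 ((ev1 d hd).and (ev2 d hd))
  refine ⟨max (max n0 n1) 4, by omega, ?_⟩
  intro n hn lam hl hc
  have hn4 : 4 ≤ n := by omega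
  obtain ⟨hE1, hE2⟩ := hn0 n (by omega)
  have hnL : 8 * L ≤ n := hn1.trans (by exact_mod_cast (by omega : n1 ≤ n))
  clear hn0 hn1 hn
  have hn1 : 1 ≤ n := by omega
  have hnr : (4:ℝ) ≤ n := by exact_mod_cast hn4
  have hnpos : (0:ℝ) < n := by linarith
  have hσ0 : 0 < sg d n := sg_pos d n
  have hσ1 : sg d n ≤ 1 := sg_le_one d n hd hn1
  have hσp := sg_pow d n hd hn1
  have hσl := log_sg_ge d n hd hn1
  generalize sg d n = σ at *
  have hs : √(n:ℝ) * √n = n := Real.mul_self_sqrt hnpos.le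
  have hs1 : 2 ≤ √(n:ℝ) := by
    rw [show (2:ℝ) = √4 by rw [show (4:ℝ) = 2^2 by norm_num, Real.sqrt_sq (by norm_num)]]
    exact Real.sqrt_le_sqrt hnr
  generalize √(n:ℝ) = s at *
  have hs0 : 0 < s := by linarith
  have hsn : s ≤ n := by rw [← hs]; exact le_mul_of_one_le_left hs0.le (by linarith)
  obtain ⟨ρ, hρ⟩ : ∃ ρ : ℝ, ρ = 26 * n ^ 3 * σ := ⟨_, rfl⟩
  rw [← hρ] at hE2
  have hρ0 : 0 < ρ := by rw [hρ]; positivity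
  have hn3 : (n:ℝ) ≤ n ^ 3 := le_self_pow₀ (by linarith) (by norm_num)
  have hρs : ρ ≤ 1 / (4 * d * s) := by
    rw [le_div_iff₀ (by positivity)]
    refine le_trans ?_ hE2
    gcongr
  have h4ds : 16 ≤ 4 * d * s := by
    calc (16:ℝ) = 4 * 2 * 2 := by norm_num
      _ ≤ 4 * d * s := by gcongr
  have hρ1 : ρ ≤ 1 := hρs.trans (by rw [div_le_one (by positivity)]; linarith)
  have hnσ : n * σ ≤ ρ / 8 := by
    rw [hρ]
    have : n * σ ≤ n ^ 3 * σ := by gcongr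
    have h0 : 0 ≤ n ^ 3 * σ := by positivity
    linarith
  have hσρ : σ ≤ ρ := by
    have : σ ≤ n * σ := le_mul_of_one_le_left hσ0.le (by linarith)
    linarith
  have hB1 := Bd_one d hd
  have hB2 := Bd_two d hd
  have hds : 1 / s / (2 * d) = 2 * (1 / (4 * d * s)) := by field_simp; norm_num
  have hds2 : 1 / (4 * d * s) ≤ 1 / 16 := by gcongr
  have hds0 : 0 < 1 / (4 * d * s) := by positivity
  have hbern := bern d hd (1 / s) (by positivity) (by rw [hds]; linarith)
  rw [hds] at hbern
  have hb0 : 0 ≤ Bd d - 2 * (1 / (4 * d * s)) := by linarith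
  have horb : ∀ k, 1 ≤ k → k < n → ‖cc d lam k‖ ≤ Bd d - 2 * (1 / (4 * d * s)) := by
    intro k _ hk
    exact orbit_le d (by omega) lam _ hb0 (by linarith) n (by linarith) k hk.le
  obtain ⟨G, hG⟩ : ∃ G : ℝ, G = 2 * d * Real.exp (-(1 / (8 * d * s))) := ⟨_, rfl⟩
  have h8 : 1 / (8 * d * s) = 1 / (4 * d * s) / 2 := by field_simp; norm_num
  have hexp := Real.add_one_le_exp (-(1 / (8 * d * s)))
  have hGa : d * (Bd d - 2 * (1 / (4 * d * s)) + ρ) ^ (d - 1) ≤ G := by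
    have h1 : Bd d - 2 * (1 / (4 * d * s)) + ρ ≤ Bd d * Real.exp (-(1 / (8 * d * s))) := by
      calc _ ≤ Bd d - 2 * (1 / (8 * d * s)) := by rw [h8]; linarith
        _ ≤ Bd d * (-(1 / (8 * d * s)) + 1) := by
            have : Bd d * (1 / (8 * d * s)) ≤ 2 * (1 / (8 * d * s)) := by gcongr
            linarith
        _ ≤ _ := by gcongr
    have h2 : (Bd d - 2 * (1 / (4 * d * s)) + ρ) ^ (d - 1) ≤ 2 * Real.exp (-(1 / (8 * d * s))) := by
      calc _ ≤ (Bd d * Real.exp (-(1 / (8 * d * s)))) ^ (d - 1) := by gcongr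
        _ = 2 * Real.exp (-(1 / (8 * d * s))) ^ (d - 1) := by rw [mul_pow, Bd_pow d hd]
        _ ≤ _ := by
            gcongr
            refine pow_le_of_le_one (Real.exp_pos _).le (Real.exp_le_one_iff.2 ?_) (by omega)
            rw [neg_nonpos]; positivity
    rw [hG]
    calc _ ≤ d * (2 * Real.exp (-(1 / (8 * d * s)))) := by gcongr
      _ = _ := by ring
  have hGb : 3 / 2 * d ≤ G := by
    rw [hG]
    have h1 : 3 / 4 ≤ Real.exp (-(1 / (8 * d * s))) := by linarith
    calc 3 / 2 * (d:ℝ) = 2 * d * (3 / 4) := by ring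
      _ ≤ _ := by gcongr
  have hG0 : 0 ≤ G := by rw [hG]; positivity
  have hsm : 8 * ρ ^ (d - 1) * G ^ (n - 1) ≤ 1 := by
    have hG2 : G ^ (n-1) ≤ ((d:ℝ) * d) ^ (n-1) * Real.exp (-(1 / (16 * d)) * s) := by
      rw [hG, mul_pow, ← Real.exp_nat_mul, Nat.cast_sub hn1, Nat.cast_one]
      refine mul_le_mul (by gcongr) (Real.exp_le_exp.2 ?_) (Real.exp_pos _).le (by positivity)
      have h1 : ((n:ℝ) - 1) * (1 / (8 * d * s)) = (1 / (16 * d)) * s + ((n:ℝ) - 2) / (16 * d * s) := by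
        rw [← hs]; field_simp; ring
      have h2 : 0 ≤ ((n:ℝ) - 2) / (16 * d * s) := div_nonneg (by linarith) (by positivity)
      linarith
    calc 8 * ρ ^ (d - 1) * G ^ (n - 1)
        ≤ 8 * ((26 * n ^ 3) ^ (d-1) * σ ^ (d-1)) * (((d:ℝ) * d) ^ (n-1) * Real.exp (-(1 / (16 * d)) * s)) := by
          rw [← mul_pow, ← hρ]; gcongr
      _ = (8 * (26 * n ^ 3) ^ (d-1) * Real.exp (-(1 / (16 * d)) * s)) * (σ ^ (d-1) * ((d:ℝ) * d) ^ (n-1)) := by ring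
      _ ≤ 1 := by rw [hσp, mul_one]; exact hE1
  have hl2 : ‖lam‖ ≤ 2 := by have : 0 < 1 / s := by positivity
                             linarith
  have main := trans_main d hd lam hl2 n hn1 _ ρ G hb0 horb hρ0 hρ1 hGa hGb hsm (by linarith)
  rw [← cc_deriv'] at main
  generalize ‖deriv (fun l => cc d l n) lam‖ = F' at *
  have hlog : Real.log (4 / ρ ^ d) ≤ L * n := by
    rw [Real.log_div (by norm_num) (by positivity), Real.log_pow]
    have h1 : Real.log 4 ≤ 2 := by
      rw [show (4:ℝ) = 2 ^ 2 by norm_num, Real.log_pow]; push_cast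
      linarith [Real.log_two_lt_d9]
    have h2 : Real.log σ ≤ Real.log ρ := Real.log_le_log hσ0 hσρ
    calc Real.log 4 - d * Real.log ρ = Real.log 4 + d * (- Real.log ρ) := by ring
      _ ≤ 2 * n + d * (2 * d * n) := by gcongr <;> linarith
      _ = L * n := by rw [hL]; ring
  have hlog0 : 0 ≤ Real.log (4 / ρ ^ d) := Real.log_nonneg (by
            rw [le_div_iff₀ (by positivity)]
            have : ρ ^ d ≤ 1 := pow_le_one₀ hρ0.le hρ1
            linarith)
  have hsecond : (‖cc d lam n‖ / d * (8 / 7)) * (2 * π * Real.log (4 / ρ ^ d)) ≤ ρ := by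
    have h1 : ‖cc d lam n‖ / d * (8 / 7) ≤ n * σ := by
      have : ‖cc d lam n‖ / d ≤ ‖cc d lam n‖ / 2 := by gcongr
      have h0 := norm_nonneg (cc d lam n)
      linarith
    calc _ ≤ n * σ * (2 * π * (L * n)) := by
          have := pi_pos
          gcongr
      _ ≤ n * σ * (2 * 4 * (L * n)) := by gcongr; exact pi_le_four
      _ = n ^ 2 * σ * (8 * L) := by ring
      _ ≤ n ^ 2 * σ * n := by gcongr
      _ = n ^ 3 * σ := by ring
      _ ≤ ρ := by
          rw [hρ]
          have : 0 ≤ n ^ 3 * σ := by positivity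
          linarith
  have hfin : ρ ≤ 8 * π * F' := by linarith
  have h25 : 26 * (n ^ 3 * σ) ≤ 26 * F' := by
    have hF0 : 0 < F' := by
      by_contra hcon
      have : 8 * π * F' ≤ 0 := mul_nonpos_of_nonneg_of_nonpos (by positivity) (not_lt.1 hcon)
      linarith
    calc 26 * (n ^ 3 * σ) = ρ := by rw [hρ]; ring
      _ ≤ 8 * π * F' := hfin
      _ ≤ 26 * F' := by gcongr; linarith [pi_lt_d2]
  linarith

end Stm9

namespace Stm9
open MeasureTheory Real Set Metric Filter Topology
open scoped ENNReal NNReal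

/-- truncated reciprocal -/
noncomputable def YY (M : ℝ) (u : ℂ) : ℂ := (starRingEnd ℂ) u / ((max ‖u‖ M : ℝ) : ℂ) ^ 2

lemma YY_norm (M : ℝ) (hM : 0 < M) (u : ℂ) : ‖YY M u‖ ≤ 1 / M := by
  have hp : 0 < max ‖u‖ M := lt_max_of_lt_right hM
  unfold YY
  rw [norm_div, norm_pow, Complex.norm_real, RCLike.norm_conj, Real.norm_of_nonneg hp.le,
    div_le_div_iff₀ (by positivity) hM]
  nlinarith [le_max_left ‖u‖ M, le_max_right ‖u‖ M, norm_nonneg u]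

lemma YY_mul (M : ℝ) (hM : 0 < M) (u : ℂ) : ‖u * YY M u‖ ≤ 1 := by
  have hp : 0 < max ‖u‖ M := lt_max_of_lt_right hM
  unfold YY
  rw [norm_mul, norm_div, norm_pow, Complex.norm_real, RCLike.norm_conj, Real.norm_of_nonneg hp.le,
    ← mul_div_assoc, div_le_one (by positivity)]
  nlinarith [le_max_left ‖u‖ M, norm_nonneg u]

lemma YY_mul_one (M : ℝ) (hM : 0 < M) (u : ℂ) (hu : M ≤ ‖u‖) : u * YY M u = 1 := by
  have h0 : (‖u‖ : ℂ) ≠ 0 := by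
    have : 0 < ‖u‖ := lt_of_lt_of_le hM hu
    exact_mod_cast this.ne'
  unfold YY
  rw [max_eq_left hu, ← mul_div_assoc, Complex.mul_conj, Complex.normSq_eq_norm_sq]
  push_cast
  field_simp

lemma YY_lip (M : ℝ) (hM : 0 < M) (u v : ℂ) : ‖YY M u - YY M v‖ ≤ 3 / M ^ 2 * ‖u - v‖ := by
  set p := max ‖u‖ M with hpd
  set r := max ‖v‖ M with hrd
  have hp : 0 < p := lt_max_of_lt_right hM
  have hr : 0 < r := lt_max_of_lt_right hM
  have hpM : M ≤ p := le_max_right _ _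
  have hrM : M ≤ r := le_max_right _ _
  have hvr : ‖v‖ ≤ r := le_max_left _ _
  have hpr : |r - p| ≤ ‖u - v‖ := by
    have h1 := abs_max_sub_max_le_abs ‖v‖ ‖u‖ M
    rw [← hpd, ← hrd] at h1
    have h2 := abs_norm_sub_norm_le v u
    rw [norm_sub_rev] at h2
    exact h1.trans h2
  have hpc : (p : ℂ) ≠ 0 := by exact_mod_cast hp.ne'
  have hrc : (r : ℂ) ≠ 0 := by exact_mod_cast hr.ne'
  have e : YY M u - YY M v = (starRingEnd ℂ) (u - v) / (p:ℂ) ^ 2 +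
      (starRingEnd ℂ) v * (((r - p) * (r + p) : ℝ) : ℂ) / ((p:ℂ) ^ 2 * (r:ℂ)^2) := by
    unfold YY
    rw [← hpd, ← hrd, map_sub]
    push_cast
    field_simp
    ring
  rw [e]
  refine (norm_add_le _ _).trans ?_
  rw [norm_div, norm_div, norm_mul, norm_mul, norm_pow, norm_pow, RCLike.norm_conj, RCLike.norm_conj,
    Complex.norm_real, Complex.norm_real, Complex.norm_real, Real.norm_eq_abs, Real.norm_eq_abs,
    Real.norm_eq_abs, abs_mul, abs_of_pos hp, abs_of_pos hr, abs_of_pos (add_pos hr hp)]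
  have n0 := norm_nonneg (u - v)
  have a1 : ‖u - v‖ / p ^ 2 ≤ ‖u - v‖ / M ^ 2 := by gcongr
  have a2 : ‖v‖ * (|r - p| * (r + p)) / (p ^ 2 * r ^ 2) ≤ r * (‖u - v‖ * (r + p)) / (p ^ 2 * r ^ 2) := by
    gcongr
  have a3 : r * (‖u - v‖ * (r + p)) / (p ^ 2 * r ^ 2) = ‖u - v‖ / (p * p) + ‖u - v‖ / (p * r) := by
    field_simp
  have a4 : ‖u - v‖ / (p * p) ≤ ‖u - v‖ / (M * M) := by gcongr
  have a5 : ‖u - v‖ / (p * r) ≤ ‖u - v‖ / (M * M) := by gcongr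
  have a6 : 3 / M ^ 2 * ‖u - v‖ = ‖u - v‖ / M ^ 2 + ‖u - v‖ / (M * M) + ‖u - v‖ / (M * M) := by
    field_simp; ring
  linarith

lemma field_lip (F : ℂ → ℂ) (hF : Differentiable ℂ F) (M : ℝ) (hM : 0 < M) (c0 : ℂ) (R : ℝ) :
    ∃ K : ℝ≥0, LipschitzOnWith K (fun c => YY M (deriv F c)) (closedBall c0 R) := by
  have hc : ContDiff ℂ 1 (deriv F) := by
    have h2 : Differentiable ℂ (deriv F) := fun z =>
      (hF.analyticAt z).deriv.differentiableAt
    exact h2.contDiff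
  have hl : LocallyLipschitz (deriv F) := hc.locallyLipschitz
  obtain ⟨K, hK⟩ := (hl.locallyLipschitzOn (s := closedBall c0 R)).exists_lipschitzOnWith_of_compact
    (isCompact_closedBall c0 R)
  refine ⟨⟨3 / M ^ 2, by positivity⟩ * K, ?_⟩
  have hY : LipschitzWith (⟨3 / M ^ 2, by positivity⟩ : ℝ≥0) (YY M) :=
    LipschitzWith.of_dist_le_mul (fun u v => by
      rw [dist_eq_norm, dist_eq_norm]; exact YY_lip M hM u v)
  exact hY.comp_lipschitzOnWith hK

/-- the flow -/
lemma flow_exists (F : ℂ → ℂ) (hF : Differentiable ℂ F) (M s : ℝ) (hM : 0 < M) (hs : 0 < s) (c0 : ℂ)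
    (H : ∀ c, ‖c - c0‖ < s / M → ‖F c - F c0‖ < s → M ≤ ‖deriv F c‖) (v : ℂ) (hv : ‖v‖ < s) :
    ∃ g : ℝ → ℂ, g 0 = c0 ∧
      (∀ t ∈ Icc (0:ℝ) 1, HasDerivWithinAt g (v * YY M (deriv F (g t))) (Icc 0 1) t) ∧
      (∀ t ∈ Icc (0:ℝ) 1, ‖g t - c0‖ ≤ ‖v‖ / M * t) ∧ F (g 1) = F c0 + v := by
  obtain ⟨K, hK⟩ := field_lip F hF M hM c0 (s / M)
  have hsM : 0 < s / M := div_pos hs hM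
  have hb : ∀ x, ‖v * YY M (deriv F x)‖ ≤ ‖v‖ / M := by
    intro x
    rw [norm_mul, div_eq_mul_one_div]
    exact mul_le_mul_of_nonneg_left (YY_norm M hM _) (norm_nonneg _)
  have hPL : IsPicardLindelof (fun _ c => v * YY M (deriv F c)) (tmin := 0) (tmax := 1)
      ⟨0, by simp⟩ c0 ⟨s / M, hsM.le⟩ 0 ⟨s / M, hsM.le⟩ (‖v‖₊ * K) := by
    apply IsPicardLindelof.of_time_independent
    · intro x _
      refine (hb x).trans ?_
      show ‖v‖ / M ≤ s / M
      gcongr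
    · intro x hx y hy
      have := hK hx hy
      simp only [edist_eq_enorm_sub] at this ⊢
      rw [← mul_sub, enorm_mul, ENNReal.coe_mul, mul_assoc]
      gcongr
      exact le_refl _
    · simp
  obtain ⟨g, hg0, hg⟩ := hPL.exists_eq_forall_mem_Icc_hasDerivWithinAt₀
  simp only at hg0
  have hgb : ∀ t ∈ Icc (0:ℝ) 1, ‖g t - c0‖ ≤ ‖v‖ / M * t := by
    intro t ht
    have := norm_image_sub_le_of_norm_deriv_le_segment' hg (fun x _ => hb (g x)) t ht
    simpa [hg0] using this
  refine ⟨g, hg0, hg, hgb, ?_⟩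
  have hFg : ∀ t ∈ Icc (0:ℝ) 1, HasDerivWithinAt (fun t => F (g t))
      (deriv F (g t) * (v * YY M (deriv F (g t)))) (Icc 0 1) t := by
    intro t ht
    exact (hF (g t)).hasDerivAt.comp_hasDerivWithinAt t (hg t ht)
  have hFb : ∀ t ∈ Icc (0:ℝ) 1, ‖F (g t) - F c0‖ ≤ ‖v‖ * t := by
    intro t ht
    have := norm_image_sub_le_of_norm_deriv_le_segment' hFg (C := ‖v‖) (fun x _ => by
      rw [mul_left_comm, norm_mul]
      exact mul_le_of_le_one_right (norm_nonneg _) (YY_mul M hM _)) t ht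
    simpa [hg0] using this
  have hD : ∀ t ∈ Icc (0:ℝ) 1, deriv F (g t) * (v * YY M (deriv F (g t))) = v := by
    intro t ht
    have h1 : ‖v‖ * t ≤ ‖v‖ := mul_le_of_le_one_right (norm_nonneg _) ht.2
    have hM2 : M ≤ ‖deriv F (g t)‖ := by
      apply H
      · refine (hgb t ht).trans_lt ?_
        rw [div_mul_eq_mul_div]
        gcongr
        linarith
      · linarith [hFb t ht]
    rw [mul_left_comm, YY_mul_one M hM _ hM2, mul_one]
  have hz : ∀ t ∈ Icc (0:ℝ) 1, HasDerivWithinAt (fun t : ℝ => F (g t) - (t:ℂ) * v) 0 (Icc 0 1) t := by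
    intro t ht
    have h1 := hFg t ht
    rw [hD t ht] at h1
    have h2 : HasDerivWithinAt (fun t : ℝ => (t:ℂ) * v) (1 * v) (Icc 0 1) t :=
      (Complex.ofRealCLM.hasDerivAt.mul_const v).hasDerivWithinAt
    have h3 := h1.sub h2
    rw [one_mul, sub_self] at h3
    exact h3
  have := norm_image_sub_le_of_norm_deriv_le_segment' hz (C := 0) (fun x _ => by simp) 1 (by simp)
  simp [hg0] at this
  have h3 : F (g 1) - v - F c0 = 0 := this
  linear_combination h3

lemma section_exists (F : ℂ → ℂ) (hF : Differentiable ℂ F) (M s : ℝ) (hM : 0 < M) (hs : 0 < s) (c0 : ℂ)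
    (H : ∀ c, ‖c - c0‖ < s / M → ‖F c - F c0‖ < s → M ≤ ‖deriv F c‖) :
    ∃ φ : ℂ → ℂ, φ (F c0) = c0 ∧ ∀ w ∈ ball (F c0) s, F (φ w) = w ∧ ‖φ w - c0‖ ≤ ‖w - F c0‖ / M ∧
      HasDerivAt φ (deriv F (φ w))⁻¹ w ∧ deriv F (φ w) ≠ 0 := by
  have hsM : 0 < s / M := div_pos hs hM
  choose! G hG0 hGd hGb hGF using flow_exists F hF M s hM hs c0 H
  obtain ⟨K, hK⟩ := field_lip F hF M hM c0 (s / M)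
  have e1 : ∀ w ∈ ball (F c0) s, ‖w - F c0‖ < s := fun w hw => mem_ball_iff_norm.1 hw
  have hmem : ∀ v, ‖v‖ < s → ∀ t ∈ Icc (0:ℝ) 1, G v t ∈ closedBall c0 (s / M) := by
    intro v hv t ht
    rw [mem_closedBall_iff_norm]
    refine (hGb v hv t ht).trans ?_
    have h1 : ‖v‖ * t ≤ ‖v‖ := mul_le_of_le_one_right (norm_nonneg _) ht.2
    rw [div_mul_eq_mul_div]
    gcongr
    linarith
  have hright : ∀ v, ‖v‖ < s → ∀ t ∈ Ico (0:ℝ) 1,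
      HasDerivWithinAt (G v) (v * YY M (deriv F (G v t))) (Ici t) t := by
    intro v hv t ht
    exact (hGd v hv t ⟨ht.1, ht.2.le⟩).mono_of_mem_nhdsWithin (Icc_mem_nhdsGE_of_mem ht)
  have hcont : ∀ u, ‖u‖ < s → ∀ v, ‖v‖ < s →
      dist (G v 1) (G u 1) ≤ gronwallBound 0 (‖u‖₊ * K : ℝ≥0) (‖v - u‖ / M + 0) (1 - 0) := by
    intro u hu v hv
    refine dist_le_of_approx_trajectories_ODE_of_mem (v := fun _ c => u * YY M (deriv F c))
      (s := fun _ => closedBall c0 (s / M)) (K := ‖u‖₊ * K) (a := 0) (b := 1) ?_ ?_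
      (hright v hv) ?_ (fun t ht => hmem v hv t ⟨ht.1, ht.2.le⟩) ?_ (hright u hu) ?_
      (fun t ht => hmem u hu t ⟨ht.1, ht.2.le⟩) ?_ 1 (by simp)
    · intro t _ x hx y hy
      have := hK hx hy
      simp only [edist_eq_enorm_sub] at this ⊢
      rw [← mul_sub, enorm_mul, ENNReal.coe_mul, mul_assoc]
      gcongr
      exact le_refl _
    · exact fun t ht => (hGd v hv t ht).continuousWithinAt
    · intro t ht
      rw [dist_eq_norm, ← sub_mul, norm_mul, div_eq_mul_one_div]
      exact mul_le_mul_of_nonneg_left (YY_norm M hM _) (norm_nonneg _)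
    · exact fun t ht => (hGd u hu t ht).continuousWithinAt
    · intro t ht
      simp
    · rw [hG0 v hv, hG0 u hu, dist_self]
  refine ⟨fun w => G (w - F c0) 1, ?_, ?_⟩
  · have h0 := hGb 0 (by simpa using hs) 1 (by simp)
    simp only [norm_zero, zero_div, zero_mul] at h0
    have := norm_le_zero_iff.1 h0
    simp only [sub_self]
    exact sub_eq_zero.1 this
  · have key : ∀ w ∈ ball (F c0) s, F (G (w - F c0) 1) = w := by
      intro w hw
      rw [hGF _ (e1 w hw)]; ring
    intro w hw
    have hnear : ∀ᶠ y in 𝓝 w, y ∈ ball (F c0) s := isOpen_ball.mem_nhds hw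
    have hb1 : ‖G (w - F c0) 1 - c0‖ ≤ ‖w - F c0‖ / M := by
      simpa using hGb _ (e1 w hw) 1 (by simp)
    refine ⟨key w hw, hb1, ?_⟩
    have hct : ContinuousAt (fun w => G (w - F c0) 1) w := by
      rw [ContinuousAt, tendsto_iff_dist_tendsto_zero]
      have h1 : Tendsto (fun y : ℂ => gronwallBound 0 (‖w - F c0‖₊ * K : ℝ≥0)
          (‖(y - F c0) - (w - F c0)‖ / M + 0) (1 - 0)) (𝓝 w) (𝓝 0) := by
        have h2 : Tendsto (fun y : ℂ => ‖(y - F c0) - (w - F c0)‖ / M + 0) (𝓝 w) (𝓝 0) := by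
          have : Continuous (fun y : ℂ => ‖(y - F c0) - (w - F c0)‖ / M + 0) := by fun_prop
          simpa using this.tendsto w
        have h3 := (gronwallBound_continuous_ε 0 ((‖w - F c0‖₊ * K : ℝ≥0):ℝ) (1 - 0)).tendsto 0
        rw [gronwallBound_ε0_δ0] at h3
        exact h3.comp h2
      refine squeeze_zero' (Eventually.of_forall fun _ => dist_nonneg) ?_ h1
      filter_upwards [hnear] with y hy
      exact hcont _ (e1 w hw) _ (e1 y hy)
    have hne : deriv F (G (w - F c0) 1) ≠ 0 := by
      have : M ≤ ‖deriv F (G (w - F c0) 1)‖ := by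
        apply H
        · refine hb1.trans_lt ?_
          gcongr
          exact e1 w hw
        · rw [key w hw]; exact e1 w hw
      intro h
      rw [h, norm_zero] at this
      linarith
    exact ⟨HasDerivAt.of_local_left_inverse hct (hF _).hasDerivAt hne
      (by filter_upwards [hnear] with y hy using key y hy), hne⟩
end Stm9

namespace Stm9
open MeasureTheory Real Set Metric Filter Topology
open scoped ENNReal NNReal

lemma mv0 (q : ℂ → ℂ) (s : ℝ) (hs : 0 < s) (hq : DifferentiableOn ℂ q (ball 0 s)) (hm : Measurable q) :
    ‖q 0‖ₑ * ENNReal.ofReal (π * s ^ 2 / 2) ≤ ∫⁻ z in ball 0 s, ‖q z‖ₑ := by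
  rw [← lintegral_indicator measurableSet_ball]
  have h := polar_lower ((ball (0:ℂ) s).indicator fun z => ‖q z‖ₑ)
    (hm.enorm.indicator measurableSet_ball) (Ioo (s/2) s) measurableSet_Ioo
    (fun t ht => lt_trans (half_pos hs) ht.1) (‖q 0‖ₑ * ENNReal.ofReal (π * s)) ?_
  · refine le_trans (le_of_eq ?_) h
    rw [Real.volume_Ioo, mul_assoc, ← ENNReal.ofReal_mul (by positivity)]
    congr 2
    ring
  · intro t ht
    have ht0 : 0 < t := lt_trans (half_pos hs) ht.1
    have hsub : closedBall (0:ℂ) t ⊆ ball 0 s := closedBall_subset_ball ht.2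
    have hC := Complex.circleIntegral_sub_inv_smul_of_differentiable_on_off_countable
      (s := ∅) (f := q) (c := 0) (w := 0) (R := t) countable_empty (mem_ball_self ht0)
      (hq.continuousOn.mono hsub) (fun x hx => (hq x (hsub (ball_subset_closedBall hx.1))).differentiableAt
        (isOpen_ball.mem_nhds (hsub (ball_subset_closedBall hx.1))))
    have h1 := circle_le (fun z => (z - 0)⁻¹ • q z) t ht0
    rw [hC] at h1
    have h2 : ∀ θ : ℝ, ‖(circleMap 0 t θ - 0)⁻¹ • q (circleMap 0 t θ)‖ₑ =
        ENNReal.ofReal t⁻¹ * (ball (0:ℂ) s).indicator (fun z => ‖q z‖ₑ) (circleMap 0 t θ) := by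
      intro θ
      have hmem : circleMap 0 t θ ∈ ball (0:ℂ) s := by
        simp [abs_of_pos ht0, ht.2]
      rw [indicator_of_mem hmem, enorm_smul, sub_zero]
      congr 1
      rw [← ofReal_norm, norm_inv, norm_circleMap_zero, abs_of_pos ht0]
    simp only [h2] at h1
    have h3 : ∫⁻ θ in Ioo (-π) π, ENNReal.ofReal t⁻¹ *
        (ball (0:ℂ) s).indicator (fun z => ‖q z‖ₑ) (circleMap 0 t θ) =
        ENNReal.ofReal t⁻¹ * ∫⁻ θ in Ioo (-π) π,
        (ball (0:ℂ) s).indicator (fun z => ‖q z‖ₑ) (circleMap 0 t θ) :=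
      lintegral_const_mul' _ _ ENNReal.ofReal_ne_top
    rw [h3, ← mul_assoc, ← ENNReal.ofReal_mul ht0.le, mul_inv_cancel₀ ht0.ne', ENNReal.ofReal_one,
      one_mul, enorm_smul] at h1
    have h4 : ‖(2 * π * Complex.I : ℂ)‖ₑ = ENNReal.ofReal (2 * π) := by
      rw [← ofReal_norm]
      simp [abs_of_pos Real.pi_pos]
    rw [h4] at h1
    calc ‖q 0‖ₑ * ENNReal.ofReal (π * s) = ENNReal.ofReal (s / 2) * (ENNReal.ofReal (2 * π) * ‖q 0‖ₑ) := by
          rw [← mul_assoc, ← ENNReal.ofReal_mul (by positivity), mul_comm]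
          congr 2; ring
      _ ≤ _ := by
          gcongr
          exact ht.1.le

lemma mv (p : ℂ → ℂ) (w : ℂ) (s : ℝ) (hs : 0 < s) (hp : DifferentiableOn ℂ p (ball w s)) (hm : Measurable p) :
    ‖p w‖ₑ * ENNReal.ofReal (π * s ^ 2 / 2) ≤ ∫⁻ z in ball w s, ‖p z‖ₑ := by
  have h := mv0 (fun z => p (w + z)) s hs ?_ (hm.comp (measurable_const_add w))
  · simp only [add_zero] at h
    refine h.trans (le_of_eq ?_)
    rw [← lintegral_indicator measurableSet_ball, ← lintegral_indicator measurableSet_ball,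
      ← lintegral_add_left_eq_self ((ball w s).indicator _) w]
    congr 1
    ext z
    simp [indicator]
  · refine hp.comp (by fun_prop) ?_
    intro z hz
    simpa [mem_ball_iff_norm] using hz

/-- holomorphic section over a disc -/
def Sec (F : ℂ → ℂ) (R : ℝ) (φ : ℂ → ℂ) : Prop :=
  ∀ w ∈ ball (0:ℂ) R, F (φ w) = w ∧ HasDerivAt φ (deriv F (φ w))⁻¹ w ∧ deriv F (φ w) ≠ 0

lemma Sec.diff {F : ℂ → ℂ} {R : ℝ} {φ : ℂ → ℂ} (h : Sec F R φ) : DifferentiableOn ℂ φ (ball 0 R) :=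
  fun w hw => (h w hw).2.1.differentiableAt.differentiableWithinAt

lemma Sec.injOn {F : ℂ → ℂ} {R : ℝ} {φ : ℂ → ℂ} (h : Sec F R φ) : InjOn φ (ball 0 R) := by
  intro a ha b hb hab
  rw [← (h a ha).1, ← (h b hb).1, hab]

lemma Sec.uniq {F : ℂ → ℂ} (hF : Differentiable ℂ F) {R : ℝ} {φ ψ : ℂ → ℂ} (h1 : Sec F R φ) (h2 : Sec F R ψ)
    (w : ℂ) (hw : w ∈ ball 0 R) (he : φ w = ψ w) : EqOn φ ψ (ball 0 R) := by
  have hst : HasStrictDerivAt F (deriv F (φ w)) (φ w) := (hF.analyticAt (φ w)).hasStrictDerivAt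
  have hl := hst.eventually_left_inverse (h1 w hw).2.2
  have c1 : ContinuousAt φ w := (h1 w hw).2.1.continuousAt
  have c2 : ContinuousAt ψ w := (h2 w hw).2.1.continuousAt
  have l1 := c1.eventually hl
  have l2 : ∀ᶠ x in 𝓝 w, HasStrictDerivAt.localInverse F _ _ hst (h1 w hw).2.2 (F (ψ x)) = ψ x := by
    have c2' : Tendsto ψ (𝓝 w) (𝓝 (φ w)) := by rw [he]; exact c2
    exact c2'.eventually hl
  have hn : ∀ᶠ y in 𝓝 w, y ∈ ball (0:ℂ) R := isOpen_ball.mem_nhds hw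
  refine (h1.diff.analyticOnNhd isOpen_ball).eqOn_of_preconnected_of_eventuallyEq
    (h2.diff.analyticOnNhd isOpen_ball) (convex_ball 0 R).isPreconnected hw ?_
  filter_upwards [l1, l2, hn] with y y1 y2 y3
  rw [← y1, (h1 y y3).1]
  conv_rhs => rw [← y2, (h2 y y3).1]

lemma piece {F : ℂ → ℂ} {s : ℝ} (hs : 0 < s) {φ : ℂ → ℂ} (h : Sec F (2 * s) φ) :
    ∫⁻ c in φ '' (ball 0 s), ENNReal.ofReal (Real.log (s / ‖F c‖)) ≤ 4 * volume (φ '' (ball 0 (2 * s))) := by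
  have hsub : ball (0:ℂ) s ⊆ ball 0 (2 * s) := ball_subset_ball (by linarith)
  have hder : ∀ w ∈ ball (0:ℂ) (2 * s), HasDerivAt φ (deriv φ w) w := fun w hw =>
    (h w hw).2.1.differentiableAt.hasDerivAt
  set V := volume (φ '' (ball 0 (2 * s))) with hV
  have hVeq : V = ∫⁻ x in ball (0:ℂ) (2 * s), ENNReal.ofReal (‖deriv φ x‖ ^ 2) := by
    have := lintegral_image_hol measurableSet_ball hder h.injOn (fun _ => 1)
    simpa using this
  have hmv : ∀ w ∈ ball (0:ℂ) s, ENNReal.ofReal (‖deriv φ w‖ ^ 2) * ENNReal.ofReal (π * s ^ 2 / 2) ≤ V := by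
    intro w hw
    have hs2 : ball w s ⊆ ball 0 (2 * s) := by
      apply ball_subset_ball'
      have : dist w 0 < s := hw
      linarith
    have := mv (fun z => (deriv φ z) ^ 2) w s hs ?_ ((measurable_deriv φ).pow_const 2)
    · rw [hVeq]
      simp only [← ofReal_norm, norm_pow] at this
      exact this.trans (lintegral_mono_set hs2)
    · exact ((h.diff.deriv isOpen_ball).mono hs2).pow 2
  rw [lintegral_image_hol measurableSet_ball (fun w hw => hder w (hsub hw)) (h.injOn.mono hsub)]
  have hpos : 0 < π * s ^ 2 / 2 := by positivity
  have hq0 : ENNReal.ofReal (π * s ^ 2 / 2) ≠ 0 := by simpa using hpos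
  calc _ ≤ ∫⁻ w in ball (0:ℂ) s, (V / ENNReal.ofReal (π * s ^ 2 / 2) * ENNReal.ofReal s) * ENNReal.ofReal (1 / ‖w‖) := by
        refine setLIntegral_mono' measurableSet_ball fun w hw => ?_
        rw [(h w (hsub hw)).1, mul_assoc, ← ENNReal.ofReal_mul hs.le]
        have a1 : ENNReal.ofReal (‖deriv φ w‖ ^ 2) ≤ V / ENNReal.ofReal (π * s ^ 2 / 2) := by
          rw [ENNReal.le_div_iff_mul_le (Or.inl hq0) (Or.inl ENNReal.ofReal_ne_top)]
          exact hmv w hw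
        have a2 : Real.log (s / ‖w‖) ≤ s * (1 / ‖w‖) := by
          have := Real.log_le_self (x := s / ‖w‖) (by positivity)
          rw [mul_one_div]
          exact this
        gcongr
    _ = (V / ENNReal.ofReal (π * s ^ 2 / 2) * ENNReal.ofReal s) * ∫⁻ w in ball (0:ℂ) s, ENNReal.ofReal (1 / ‖w‖) := by
        rw [lintegral_const_mul]
        fun_prop
    _ ≤ (V / ENNReal.ofReal (π * s ^ 2 / 2) * ENNReal.ofReal s) * ENNReal.ofReal (2 * π * s) := by
        gcongr
        exact radial1 s hs.le
    _ = 4 * V := by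
        rw [mul_assoc, ← ENNReal.ofReal_mul hs.le, div_eq_mul_inv, ← ENNReal.ofReal_inv_of_pos hpos,
          mul_assoc, ← ENNReal.ofReal_mul (by positivity)]
        have : (π * s ^ 2 / 2)⁻¹ * (s * (2 * π * s)) = 4 := by
          field_simp
          norm_num
        rw [this, mul_comm]
        norm_num

lemma lemS {F : ℂ → ℂ} (hF : Differentiable ℂ F) (hcount : {z | F z = 0}.Countable) {s M : ℝ}
    (hs : 0 < s) (hM : 0 < M) (A : Set ℂ) (hA : ∀ c ∈ A, ‖F c‖ < s)
    (HA : ∀ c ∈ A, ∀ c', ‖c' - c‖ < 3 * s / M → ‖F c'‖ < 4 * s → M ≤ ‖deriv F c'‖)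
    (hB : ∀ c, ‖F c‖ < 4 * s → ‖c‖ < 3) :
    ∫⁻ c in A, ENNReal.ofReal (Real.log (s / ‖F c‖)) ≤ 4 * volume (ball (0:ℂ) 3) := by
  set Λ : Set ℂ := {l | ∃ φ, Sec F (2 * s) φ ∧ φ 0 = l} with hΛ
  have h0 : (0:ℂ) ∈ ball (0:ℂ) (2 * s) := mem_ball_self (by linarith)
  have hΛc : Λ.Countable := by
    refine hcount.mono ?_
    rintro l ⟨φ, hφ, rfl⟩
    exact (hφ 0 h0).1
  have hΛ' : ∀ l : Λ, ∃ φ, Sec F (2 * s) φ ∧ φ 0 = l := fun l => l.2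
  choose φ hφ hφ0 using hΛ'
  have : Countable Λ := hΛc.to_subtype
  have hcov : A ⊆ ⋃ l : Λ, φ l '' (ball 0 s) := by
    intro c hc
    obtain ⟨ψ, hψ0, hψ⟩ := section_exists F hF M (3 * s) hM (by linarith) c (fun c' h1 h2 => by
      refine HA c hc c' h1 ?_
      have := norm_le_norm_sub_add (F c') (F c)
      linarith [hA c hc])
    have hsec : Sec F (2 * s) ψ := by
      intro w hw
      have hw' : w ∈ ball (F c) (3 * s) := by
        rw [mem_ball_iff_norm]
        have h1 : ‖w‖ < 2 * s := by simpa using hw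
        linarith [norm_sub_le w (F c), hA c hc]
      exact ⟨(hψ w hw').1, (hψ w hw').2.2⟩
    have hl : ψ 0 ∈ Λ := ⟨ψ, hsec, rfl⟩
    have heq := Sec.uniq hF (hφ ⟨ψ 0, hl⟩) hsec 0 h0 (hφ0 ⟨ψ 0, hl⟩)
    have hFc : F c ∈ ball (0:ℂ) s := by simpa using hA c hc
    refine mem_iUnion.2 ⟨⟨ψ 0, hl⟩, F c, hFc, ?_⟩
    rw [heq (ball_subset_ball (by linarith) hFc), hψ0]
  have hdisj : Pairwise (Function.onFun Disjoint fun l : Λ => φ l '' (ball 0 (2 * s))) := by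
    intro l m hlm
    rw [Function.onFun, Set.disjoint_left]
    rintro _ ⟨w, hw, rfl⟩ ⟨w', hw', he⟩
    have e1 : w = w' := by rw [← (hφ l w hw).1, ← (hφ m w' hw').1, he]
    subst e1
    have := Sec.uniq hF (hφ m) (hφ l) w hw he h0
    rw [hφ0, hφ0] at this
    exact hlm (Subtype.ext this.symm)
  have hmeas : ∀ l : Λ, MeasurableSet (φ l '' (ball 0 (2 * s))) := fun l =>
    measurableSet_ball.image_of_continuousOn_injOn (hφ l).diff.continuousOn (hφ l).injOn
  calc _ ≤ ∫⁻ c in ⋃ l : Λ, φ l '' (ball 0 s), ENNReal.ofReal (Real.log (s / ‖F c‖)) :=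
        lintegral_mono_set hcov
    _ ≤ ∑' l : Λ, ∫⁻ c in φ l '' (ball 0 s), ENNReal.ofReal (Real.log (s / ‖F c‖)) :=
        lintegral_iUnion_le _ _
    _ ≤ ∑' l : Λ, 4 * volume (φ l '' (ball 0 (2 * s))) :=
        ENNReal.tsum_le_tsum fun l => piece hs (hφ l)
    _ = 4 * volume (⋃ l : Λ, φ l '' (ball 0 (2 * s))) := by
        rw [ENNReal.tsum_mul_left, measure_iUnion hdisj hmeas]
    _ ≤ _ := by
        gcongr
        refine iUnion_subset fun l => ?_
        rintro _ ⟨w, hw, rfl⟩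
        have h1 : ‖w‖ < 2 * s := by simpa using hw
        have := hB (φ l w) (by rw [(hφ l w hw).1]; linarith)
        simpa using this
end Stm9

namespace Stm9
open MeasureTheory Real Set Metric Filter Topology
open scoped ENNReal NNReal

lemma cc_diff (d n : ℕ) : Differentiable ℂ (fun l => cc d l n) :=
  fun l => (cc_deriv d n l).differentiableAt

lemma cc_poly (d n : ℕ) : ∃ P : Polynomial ℂ, ∀ l, P.eval l = cc d l n := by
  induction n with
  | zero => exact ⟨0, fun l => by simp [cc_zero]⟩
  | succ n ih =>
    obtain ⟨P, hP⟩ := ih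
    exact ⟨P ^ d + Polynomial.X, fun l => by simp [cc_succ, hP]⟩

lemma cc_count (d n : ℕ) (hd : 1 < d) (hn : 1 ≤ n) : {l | cc d l n = 0}.Countable := by
  obtain ⟨P, hP⟩ := cc_poly d n
  have hP0 : P ≠ 0 := by
    rintro rfl
    have h1 := hP 3
    rw [Polynomial.eval_zero] at h1
    have := lam_le d hd 3 n hn (by rw [← h1]; simp)
    have h2 := Bd_two d hd
    norm_num at this
    linarith
  have h := P.finite_setOfPred_isRoot hP0
  refine (h.subset ?_).countable
  intro l hl
  show P.eval l = 0
  rw [hP]; exact hl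

lemma ball3 (d n : ℕ) (hd : 1 < d) (hn : 1 ≤ n) (c : ℂ) (h : ‖cc d c n‖ ≤ 1) : ‖c‖ < 3 := by
  have := lam_le d hd c n hn h
  linarith [Bd_two d hd]

/-- small scale bound -/
lemma smallS (d : ℕ) (hd : 1 < d) (C1 : ℝ) (h0 : 0 < C1) (h1 : C1 ≤ 1 / 4) :
    ∃ C : ℝ, 1 ≤ C ∧ ∀ n : ℕ, 1 ≤ n →
      ∫⁻ c in {c | ‖cc d c n‖ < C1 * sg d n / (C * n ^ 2)},
        ENNReal.ofReal (Real.log (C1 * sg d n / (C * n ^ 2) / ‖cc d c n‖)) ≤ 4 * volume (ball (0:ℂ) 3) := by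
  obtain ⟨C, hC, hT⟩ := T1 d hd
  refine ⟨C, hC, fun n hn => ?_⟩
  have hn1 : (1:ℝ) ≤ n := by exact_mod_cast hn
  have hsg := sg_pos d n
  have hn2 : (1:ℝ) ≤ C * n ^ 2 := one_le_mul_of_one_le_of_one_le hC (one_le_pow₀ hn1)
  have h4 : 4 * (C1 * sg d n / (C * n ^ 2)) ≤ sg d n / (C * n ^ 2) := by
    rw [← mul_div_assoc]
    gcongr
    nlinarith
  have h5 : sg d n / (C * n ^ 2) ≤ 1 := by
    rw [div_le_one (by linarith)]
    exact (sg_le_one d n hd hn).trans hn2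
  refine lemS (F := fun c => cc d c n) (cc_diff d n) (cc_count d n hd hn) (M := sg d n / (C * n)) (by positivity)
    (by positivity) _ (fun c hc => hc) ?_ ?_
  · intro c _ c' _ h
    exact hT n hn c' (h.le.trans h4)
  · intro c hc
    exact ball3 d n hd hn c (hc.le.trans (h4.trans h5))

/-- region bound -/
lemma regS (d : ℕ) (C1 C V : ℝ) (h0 : 0 < C1) (hC : 1 ≤ C) (hV : 0 ≤ V) (n : ℕ) (hn : 1 ≤ n)
    (D : Set ℂ) (hD : volume D ≤ ENNReal.ofReal V)
    (hs : ∫⁻ c in {c | ‖cc d c n‖ < C1 * sg d n / (C * n ^ 2)},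
        ENNReal.ofReal (Real.log (C1 * sg d n / (C * n ^ 2) / ‖cc d c n‖)) ≤ 4 * volume (ball (0:ℂ) 3)) :
    ∫⁻ c in D, ENNReal.ofReal (Real.log (C1 * sg d n / ‖cc d c n‖)) ≤
      ENNReal.ofReal (Real.log (C * n ^ 2) * V) + 4 * volume (ball (0:ℂ) 3) := by
  have hn1 : (1:ℝ) ≤ n := by exact_mod_cast hn
  have hsg := sg_pos d n
  have hn2 : (1:ℝ) ≤ C * n ^ 2 := one_le_mul_of_one_le_of_one_le hC (one_le_pow₀ hn1)
  set S : Set ℂ := {c | ‖cc d c n‖ < C1 * sg d n / (C * n ^ 2)} with hSd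
  have hSm : MeasurableSet S := by
    apply IsOpen.measurableSet
    exact isOpen_lt (cc_diff d n).continuous.norm continuous_const
  have hpt : ∀ c, ENNReal.ofReal (Real.log (C1 * sg d n / ‖cc d c n‖)) ≤
      ENNReal.ofReal (Real.log (C * n ^ 2)) +
        S.indicator (fun c => ENNReal.ofReal (Real.log (C1 * sg d n / (C * n ^ 2) / ‖cc d c n‖))) c := by
    intro c
    by_cases hc0 : ‖cc d c n‖ = 0
    · simp [hc0]
    have hc1 : 0 < ‖cc d c n‖ := lt_of_le_of_ne (norm_nonneg _) (Ne.symm hc0)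
    by_cases hcS : c ∈ S
    · rw [indicator_of_mem hcS]
      refine le_trans (ENNReal.ofReal_le_ofReal (le_of_eq ?_)) ENNReal.ofReal_add_le
      rw [← Real.log_mul (by positivity) (by positivity)]
      congr 1
      field_simp
    · refine le_add_right (ENNReal.ofReal_le_ofReal (Real.log_le_log (by positivity) ?_))
      have hcS' : C1 * sg d n / (C * n ^ 2) ≤ ‖cc d c n‖ := not_lt.1 hcS
      rw [div_le_iff₀ (by linarith)] at hcS'
      rw [div_le_iff₀ hc1]
      linarith
  calc _ ≤ ∫⁻ c in D, (ENNReal.ofReal (Real.log (C * n ^ 2)) +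
        S.indicator (fun c => ENNReal.ofReal (Real.log (C1 * sg d n / (C * n ^ 2) / ‖cc d c n‖))) c) :=
        lintegral_mono hpt
    _ = ENNReal.ofReal (Real.log (C * n ^ 2)) * volume D + ∫⁻ c in D,
        S.indicator (fun c => ENNReal.ofReal (Real.log (C1 * sg d n / (C * n ^ 2) / ‖cc d c n‖))) c := by
        rw [lintegral_add_left measurable_const, setLIntegral_const]
    _ ≤ ENNReal.ofReal (Real.log (C * n ^ 2)) * ENNReal.ofReal V + ∫⁻ c,
        S.indicator (fun c => ENNReal.ofReal (Real.log (C1 * sg d n / (C * n ^ 2) / ‖cc d c n‖))) c :=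
        add_le_add (mul_le_mul_right hD _) (setLIntegral_le_lintegral _ _)
    _ ≤ _ := by
        rw [lintegral_indicator hSm, ← ENNReal.ofReal_mul (Real.log_nonneg hn2)]
        gcongr

lemma vol3 : volume (ball (0:ℂ) 3) = ENNReal.ofReal (9 * π) := by
  rw [Complex.volume_ball, ← ENNReal.ofReal_pow (by norm_num), mul_comm,
    ENNReal.ofReal_mul (by norm_num)]
  rw [mul_comm]
  congr 1
  · norm_num
  · rw [← ENNReal.ofReal_coe_nnreal]; rfl

lemma volring (B e : ℝ) (he : 0 ≤ e) (heB : e ≤ B) (hB : B ≤ 2) :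
    volume (closedBall (0:ℂ) B \ closedBall 0 (B - e)) ≤ ENNReal.ofReal (4 * π * e) := by
  rw [measure_sdiff (closedBall_subset_closedBall (by linarith)) measurableSet_closedBall.nullMeasurableSet
    measure_closedBall_lt_top.ne, Complex.volume_closedBall, Complex.volume_closedBall,
    ← ENNReal.ofReal_pow (by linarith), ← ENNReal.ofReal_pow (by linarith)]
  have hpi : (↑NNReal.pi : ℝ≥0∞) = ENNReal.ofReal π := by rw [← ENNReal.ofReal_coe_nnreal]; rfl
  rw [hpi, ← ENNReal.ofReal_mul (by positivity), ← ENNReal.ofReal_mul (by positivity),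
    ← ENNReal.ofReal_sub _ (by positivity)]
  apply ENNReal.ofReal_le_ofReal
  have : B ^ 2 * π - (B - e) ^ 2 * π = π * (e * (2 * B - e)) := by ring
  rw [this]
  have h2 : e * (2 * B - e) ≤ e * 4 := by gcongr; linarith
  nlinarith [Real.pi_pos]

lemma main_bound (d : ℕ) (hd : 1 < d) (C1 : ℝ) (h0 : 0 < C1) (h1 : C1 ≤ 1 / 4) :
    ∃ K : ℝ, 0 ≤ K ∧ ∀ n : ℕ, 1 ≤ n →
      ∫⁻ c in {c | ‖cc d c n‖ < C1 * sg d n},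
        ENNReal.ofReal (Real.log (C1 * sg d n / ‖cc d c n‖)) ≤ ENNReal.ofReal K := by
  obtain ⟨C, hC, hS⟩ := smallS d hd C1 h0 h1
  obtain ⟨n0, _, hT⟩ := T2 d hd
  have hpi := Real.pi_pos
  obtain ⟨N, hN⟩ : ∃ N, N = max n0 4 := ⟨_, rfl⟩
  have hNn : n0 ≤ N := hN ▸ le_max_left _ _
  have hN4 : 4 ≤ N := hN ▸ le_max_right _ _
  have hlogC : 0 ≤ Real.log C := Real.log_nonneg hC
  have hN1 : (1:ℝ) ≤ N := by exact_mod_cast (by omega : 1 ≤ N)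
  have hlogN : 0 ≤ Real.log (C * N ^ 2) :=
    Real.log_nonneg (one_le_mul_of_one_le_of_one_le hC (one_le_pow₀ hN1))
  have h36 : 4 * volume (ball (0:ℂ) 3) = ENNReal.ofReal (36 * π) := by
    rw [vol3, ← ENNReal.ofReal_ofNat, ← ENNReal.ofReal_mul (by norm_num)]
    congr 1; ring
  refine ⟨(Real.log (C * N ^ 2) * (9 * π) + 36 * π) + (36 * π + (8 * π * (Real.log C + 4) + 36 * π)),
    by positivity, fun n hn => ?_⟩
  have hn1 : (1:ℝ) ≤ n := by exact_mod_cast hn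
  have hsg := sg_pos d n
  have hsg1 := sg_le_one d n hd hn
  have hr1 : C1 * sg d n ≤ 1 / 4 := by nlinarith
  rcases lt_or_ge n N with hnN | hnN
  · have := regS d C1 C (9 * π) h0 hC (by positivity) n hn {c | ‖cc d c n‖ < C1 * sg d n} (by
      rw [← vol3]
      apply measure_mono
      intro c hc
      have hc' : ‖cc d c n‖ < C1 * sg d n := hc
      simpa using ball3 d n hd hn c (by linarith)) (hS n hn)
    refine this.trans ?_
    rw [h36, ← ENNReal.ofReal_add (by
      have : 0 ≤ Real.log (C * n ^ 2) := Real.log_nonneg (one_le_mul_of_one_le_of_one_le hC (one_le_pow₀ hn1))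
      positivity) (by positivity)]
    apply ENNReal.ofReal_le_ofReal
    have hle : Real.log (C * n ^ 2) ≤ Real.log (C * N ^ 2) := by
      apply Real.log_le_log (by positivity)
      have : (n:ℝ) ≤ N := by exact_mod_cast hnN.le
      gcongr
    have h7 : Real.log (C * n ^ 2) * (9 * π) ≤ Real.log (C * N ^ 2) * (9 * π) := by gcongr
    have h8 : 0 ≤ 8 * π * (Real.log C + 4) := by positivity
    linarith
  · have hn4 : (4:ℝ) ≤ n := by exact_mod_cast (by omega : 4 ≤ n)
    have hsq : 2 ≤ √(n:ℝ) := by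
      rw [show (2:ℝ) = √4 by rw [show (4:ℝ) = 2 ^ 2 by norm_num, Real.sqrt_sq (by norm_num)]]
      exact Real.sqrt_le_sqrt hn4
    have hsqn : √(n:ℝ) * √(n:ℝ) = n := Real.mul_self_sqrt (by linarith)
    have hB1 := Bd_one d hd
    have hB2 := Bd_two d hd
    set e : ℝ := 2 / √(n:ℝ) with he
    have he0 : 0 ≤ e := by positivity
    have he1 : e ≤ 1 := by rw [he, div_le_one (by linarith)]; exact hsq
    set D1 : Set ℂ := {c | ‖cc d c n‖ < C1 * sg d n ∧ ‖c‖ ≤ Bd d - e} with hD1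
    set D2 : Set ℂ := closedBall (0:ℂ) (Bd d) \ closedBall 0 (Bd d - e) with hD2
    have hcov : {c | ‖cc d c n‖ < C1 * sg d n} ⊆ D1 ∪ D2 := by
      intro c hc
      have hc' : ‖cc d c n‖ < C1 * sg d n := hc
      rcases le_or_gt ‖c‖ (Bd d - e) with h | h
      · exact Or.inl ⟨hc, h⟩
      · refine Or.inr ⟨?_, ?_⟩
        · simpa using lam_le d hd c n hn (by linarith)
        · simpa using h
    have b1 : ∫⁻ c in D1, ENNReal.ofReal (Real.log (C1 * sg d n / ‖cc d c n‖)) ≤ ENNReal.ofReal (36 * π) := by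
      rw [← h36]
      refine lemS (F := fun c => cc d c n) (cc_diff d n) (cc_count d n hd hn) (M := n ^ 3 * sg d n) (by positivity)
        (by positivity) D1 (fun c hc => hc.1) ?_ ?_
      · intro c hc c' hcc hF
        apply hT n (hNn.trans hnN)
        · have h3 : 3 * (C1 * sg d n) / (n ^ 3 * sg d n) ≤ 1 / √(n:ℝ) := by
            have : 3 * (C1 * sg d n) / (n ^ 3 * sg d n) = 3 * C1 / n ^ 3 := by field_simp
            rw [this, div_le_div_iff₀ (by positivity) (by linarith)]
            have h5 : √(n:ℝ) ≤ n := by nlinarith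
            have h6 : (n:ℝ) ≤ n ^ 3 := le_self_pow₀ hn1 (by norm_num)
            have h9 : 3 * C1 * √(n:ℝ) ≤ 1 * √(n:ℝ) := by gcongr; linarith
            linarith
          have h4 : ‖c'‖ ≤ ‖c' - c‖ + ‖c‖ := norm_le_norm_sub_add c' c
          have h5 : e = 1 / √(n:ℝ) + 1 / √(n:ℝ) := by rw [he]; ring
          linarith [hc.2]
        · refine hF.le.trans ?_
          rw [← mul_assoc]
          gcongr
          linarith
      · intro c hc
        exact ball3 d n hd hn c (by linarith)
    have b2 := regS d C1 C (4 * π * e) h0 hC (by positivity) n hn D2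
      (volring (Bd d) e he0 (by linarith) hB2) (hS n hn)
    have b3 : Real.log (C * n ^ 2) * (4 * π * e) ≤ 8 * π * (Real.log C + 4) := by
      have hl1 : Real.log (C * n ^ 2) = Real.log C + 4 * Real.log (√(n:ℝ)) := by
        rw [Real.log_mul (by positivity) (by positivity), Real.log_pow, Real.log_sqrt (by linarith)]
        push_cast; ring
      have hl2 : Real.log (√(n:ℝ)) ≤ √(n:ℝ) := Real.log_le_self (by positivity)
      have hl3 : Real.log C + 4 * Real.log (√(n:ℝ)) ≤ (Real.log C + 4) * √(n:ℝ) := by nlinarith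
      have : 4 * π * e = 8 * π / √(n:ℝ) := by rw [he]; ring
      rw [this, hl1, ← mul_div_assoc, div_le_iff₀ (by linarith)]
      calc _ ≤ ((Real.log C + 4) * √(n:ℝ)) * (8 * π) := by gcongr
        _ = _ := by ring
    calc _ ≤ ∫⁻ c in D1 ∪ D2, ENNReal.ofReal (Real.log (C1 * sg d n / ‖cc d c n‖)) := lintegral_mono_set hcov
      _ ≤ _ := lintegral_union_le _ _ _
      _ ≤ ENNReal.ofReal (36 * π) + (ENNReal.ofReal (8 * π * (Real.log C + 4)) + ENNReal.ofReal (36 * π)) := by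
        refine add_le_add b1 (b2.trans ?_)
        rw [h36]
        gcongr
      _ = ENNReal.ofReal (36 * π + (8 * π * (Real.log C + 4) + 36 * π)) := by
        rw [← ENNReal.ofReal_add (by positivity) (by positivity), ← ENNReal.ofReal_add (by positivity) (by positivity)]
      _ ≤ _ := by
        apply ENNReal.ofReal_le_ofReal
        have : 0 ≤ Real.log (C * N ^ 2) * (9 * π) + 36 * π := by positivity
        linarith
end Stm9

namespace Stm9
open MeasureTheory Real Set Metric Filter Topology
open scoped ENNReal NNReal

lemma frontier_ne (d : ℕ) (hd : 1 < d) : (frontier (Mloc d)).Nonempty := by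
  rw [nonempty_frontier_iff]
  constructor
  · refine ⟨0, ?_⟩
    refine ⟨0, ?_⟩
    rintro _ ⟨k, rfl⟩
    have : ∀ k, cc d 0 k = 0 := by
      intro k
      induction k with
      | zero => rfl
      | succ k ih => rw [cc_succ, ih, zero_pow (by omega), zero_add]
    show ‖cc d 0 k‖ ≤ 0
    rw [this, norm_zero]
  · intro h
    have h3 : (3:ℂ) ∈ Mloc d := by rw [h]; trivial
    obtain ⟨b, hb⟩ := h3
    have hg : ∀ k : ℕ, (3:ℝ) + k ≤ ‖cc d 3 (k + 1)‖ := by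
      intro k
      induction k with
      | zero => rw [zero_add, cc_one d (by omega)]; simp
      | succ k ih =>
        rw [cc_succ d 3 (k + 1)]
        have hk : (0:ℝ) ≤ k := by positivity
        have h1 : ‖cc d 3 (k+1)‖ ^ 2 ≤ ‖cc d 3 (k+1) ^ d‖ := by
          rw [norm_pow]
          exact pow_le_pow_right₀ (by linarith) (by omega)
        have h2 : ‖cc d 3 (k+1) ^ d‖ ≤ ‖cc d 3 (k+1) ^ d + 3‖ + ‖(3:ℂ)‖ := by
          have := norm_sub_le (cc d 3 (k+1) ^ d + 3) 3
          simpa using this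
        have h4 : ‖(3:ℂ)‖ = 3 := by simp
        push_cast
        nlinarith
    obtain ⟨k, hk⟩ := exists_nat_gt b
    have h1 := hg k
    have h2 : ‖cc d 3 (k+1)‖ ≤ b := hb ⟨k+1, rfl⟩
    linarith

lemma orbit_up (d : ℕ) (hd : 1 < d) (lam : ℂ) (hl : ‖lam‖ ≤ 2) (n : ℕ) (hn : ‖cc d lam n‖ ≤ 2) (j : ℕ) :
    2 * ‖cc d lam (n + j)‖ ≤ 4 ^ (d ^ j) := by
  induction j with
  | zero => simp; linarith
  | succ j ih =>
    rw [← add_assoc, cc_succ, pow_succ, pow_mul]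
    set Y : ℝ := 4 ^ (d ^ j) with hY
    have hY4 : 4 ≤ Y := by
      have : (4:ℝ) ^ 1 ≤ 4 ^ (d ^ j) := pow_le_pow_right₀ (by norm_num) (Nat.one_le_pow _ _ (by omega))
      simpa using this
    have h1 := norm_add_le (cc d lam (n+j) ^ d) lam
    rw [norm_pow] at h1
    have h2 : ‖cc d lam (n + j)‖ ^ d ≤ (Y / 2) ^ d := by
      gcongr
      linarith
    have h3 : (Y / 2) ^ d ≤ Y ^ d / 4 := by
      rw [div_pow]
      have : (2:ℝ) ^ 2 ≤ 2 ^ d := pow_le_pow_right₀ (by norm_num) (by omega)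
      have hYd : 0 < Y ^ d := by positivity
      apply div_le_div_of_nonneg_left hYd.le (by norm_num)
      linarith
    have h4 : Y ^ 2 ≤ Y ^ d := pow_le_pow_right₀ (by linarith) (by omega)
    nlinarith

lemma gI_bounds (d : ℕ) (hd : 1 < d) (lam : ℂ) (g : ℝ)
    (hg : Tendsto (fun k : ℕ => (1 / 2) * Real.log (1 + ‖cc d lam k‖ ^ 2) / (d : ℝ) ^ (k - 1)) atTop (𝓝 g))
    (n : ℕ) (hn : 1 ≤ n) (h : ‖cc d lam n‖ ≤ 1) :
    0 ≤ (d:ℝ) ^ (n - 1) * g ∧ (d:ℝ) ^ (n - 1) * g ≤ Real.log 4 := by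
  have hd0 : (0:ℝ) < d := by exact_mod_cast (by omega : 0 < d)
  constructor
  · refine mul_nonneg (by positivity) (ge_of_tendsto' hg fun k => ?_)
    have : 0 ≤ Real.log (1 + ‖cc d lam k‖ ^ 2) := Real.log_nonneg (by nlinarith [sq_nonneg ‖cc d lam k‖])
    positivity
  · have h1 : Tendsto (fun j : ℕ => (d:ℝ) ^ (n-1) * ((1 / 2) * Real.log (1 + ‖cc d lam (j + n)‖ ^ 2) / (d : ℝ) ^ (j + n - 1)))
        atTop (𝓝 ((d:ℝ) ^ (n-1) * g)) := ((tendsto_add_atTop_iff_nat n).2 hg).const_mul _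
    refine le_of_tendsto' h1 fun j => ?_
    have e1 : j + n - 1 = j + (n - 1) := by omega
    have e2 : (d:ℝ) ^ (n-1) * ((1 / 2) * Real.log (1 + ‖cc d lam (j + n)‖ ^ 2) / (d : ℝ) ^ (j + n - 1)) =
        (1 / 2) * Real.log (1 + ‖cc d lam (j + n)‖ ^ 2) / (d : ℝ) ^ j := by
      rw [e1, pow_add]
      field_simp
    rw [e2, div_le_iff₀ (by positivity)]
    have hl := lam_le d hd lam n hn h
    have hu := orbit_up d hd lam (hl.trans (Bd_two d hd)) n (by linarith) j
    rw [add_comm n j] at hu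
    set Y : ℝ := 4 ^ (d ^ j) with hY
    have hY4 : 4 ≤ Y := by
      have : (4:ℝ) ^ 1 ≤ 4 ^ (d ^ j) := pow_le_pow_right₀ (by norm_num) (Nat.one_le_pow _ _ (by omega))
      simpa using this
    have h3 : 1 + ‖cc d lam (j + n)‖ ^ 2 ≤ Y ^ 2 := by
      have := norm_nonneg (cc d lam (j + n))
      nlinarith
    have h5 := Real.log_le_log (by positivity) h3
    rw [Real.log_pow, hY, Real.log_pow] at h5
    push_cast at h5
    linarith

lemma core (d : ℕ) (hd : 1 < d) (CB : ℝ) (hCB0 : 0 ≤ CB) (gI : ℂ → ℝ)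
    (hgI : ∀ lam : ℂ, Tendsto
      (fun k : ℕ => (1 / 2) * Real.log (1 + ‖cc d lam k‖ ^ 2) / (d : ℝ) ^ (k - 1)) atTop (𝓝 (gI lam))) :
    ∃ C₀ : ℝ, 0 < C₀ ∧ ∀ n : ℕ, 1 ≤ n →
      π⁻¹ * (∫ lam in {l : ℂ | ‖cc d l n‖ < Real.exp (-(tconst d CB n))},
          |Real.log ‖cc d lam n‖ - (d : ℝ) ^ (n - 1) * gI lam| / (1 + ‖lam‖ ^ 2) ^ 2)
        ≤ (π⁻¹ * ∫ lam in {l : ℂ | ‖cc d l n‖ < Real.exp (-(tconst d CB n))},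
            1 / (1 + ‖lam‖ ^ 2) ^ 2) * tconst d CB n + C₀ := by
  have hd1 : (0:ℝ) < (d:ℝ) - 1 := by
    have : (1:ℝ) < d := by exact_mod_cast hd
    linarith
  have hlog2 : 0 < Real.log 2 := Real.log_pos (by norm_num)
  have hlogs : Real.log 2 ≤ Real.log (√2 + 1) := by
    apply Real.log_le_log (by norm_num)
    have : (1:ℝ) ≤ √2 := Real.one_le_sqrt.2 (by norm_num)
    linarith
  obtain ⟨a, ha⟩ : ∃ a : ℝ, a = (1 / ((d : ℝ) - 1)) * (((d : ℝ) + 1) * Real.log 2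
    + 4 * CB / ((d : ℝ) - 1) + ((d : ℝ) - 1) * Real.log (√2 + 1)) := ⟨_, rfl⟩
  have ha2 : 2 * Real.log 2 ≤ a := by
    rw [ha, div_mul_eq_mul_div, one_mul, le_div_iff₀ hd1]
    have h1 : 0 ≤ 4 * CB / ((d : ℝ) - 1) := by positivity
    have h2 : ((d : ℝ) - 1) * Real.log 2 ≤ ((d : ℝ) - 1) * Real.log (√2 + 1) := by gcongr
    linarith
  have htc : ∀ n, tconst d CB n = a + 2 * Real.log d / ((d:ℝ) - 1) * ((n:ℝ) - 1) := by
    intro n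
    rw [tconst, ha]
    ring
  have hC1 : Real.exp (-a) ≤ 1 / 4 := by
    have : Real.exp (-a) ≤ Real.exp (Real.log (1/4)) := by
      apply Real.exp_le_exp.2
      have h4 : Real.log (1/4) = -(2 * Real.log 2) := by
        rw [one_div, Real.log_inv, show (4:ℝ) = 2 ^ 2 by norm_num, Real.log_pow]; push_cast; ring
      rw [h4]; linarith
    rwa [Real.exp_log (by norm_num)] at this
  obtain ⟨K, hK0, hK⟩ := main_bound d hd (Real.exp (-a)) (Real.exp_pos _) hC1
  have hpi := Real.pi_pos
  have hlog4 : 0 < Real.log 4 := Real.log_pos (by norm_num)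
  refine ⟨π⁻¹ * (Real.log 4 * (9 * π) + K), by positivity, fun n hn => ?_⟩
  have hre : Real.exp (-(tconst d CB n)) = Real.exp (-a) * sg d n := by
    rw [htc, sg, ← Real.exp_add]; congr 1; ring
  have hT0 : 0 ≤ tconst d CB n := by
    rw [htc]
    have hn1 : (0:ℝ) ≤ (n:ℝ) - 1 := by
      have : (1:ℝ) ≤ n := by exact_mod_cast hn
      linarith
    have hld : 0 ≤ Real.log d := Real.log_nonneg (by linarith)
    have := mul_nonneg (div_nonneg (mul_nonneg zero_le_two hld) hd1.le) hn1
    linarith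
  have hKn := hK n hn
  rw [← hre] at hKn
  set T := tconst d CB n with hT
  set r := Real.exp (-T) with hr
  have hr0 : 0 < r := Real.exp_pos _
  have hr1 : r ≤ 1 := by rw [hr, Real.exp_le_one_iff]; linarith
  set E : Set ℂ := {l : ℂ | ‖cc d l n‖ < r} with hE
  have hEm : MeasurableSet E := (isOpen_lt (cc_diff d n).continuous.norm continuous_const).measurableSet
  have hE3 : E ⊆ ball 0 3 := by
    intro c hc
    have hc' : ‖cc d c n‖ < r := hc
    simpa using ball3 d n hd hn c (by linarith)
  have hvE : volume E ≤ ENNReal.ofReal (9 * π) := by rw [← vol3]; exact measure_mono hE3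
  have hEfin : volume E ≠ ⊤ := ne_top_of_le_ne_top ENNReal.ofReal_ne_top hvE
  have hvEr : volume.real E ≤ 9 * π := ENNReal.toReal_le_of_le_ofReal (by positivity) hvE
  set w : ℂ → ℝ := fun l => 1 / (1 + ‖l‖ ^ 2) ^ 2 with hw
  have hw0 : ∀ l, 0 ≤ w l := fun l => by positivity
  have hw1 : ∀ l, w l ≤ 1 := fun l => by
    rw [hw]
    simp only
    rw [div_le_one (by positivity)]
    exact one_le_pow₀ (by nlinarith [sq_nonneg ‖l‖])
  have hwc : Continuous w := by
    apply Continuous.div continuous_const (by fun_prop)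
    intro l; positivity
  set v : ℂ → ℝ := fun l => Real.log (r / ‖cc d l n‖) with hv
  have hvm : Measurable v :=
    Real.measurable_log.comp (measurable_const.div (cc_diff d n).continuous.norm.measurable)
  have hv0 : ∀ l ∈ E, 0 ≤ v l := by
    intro l hl
    rcases (norm_nonneg (cc d l n)).eq_or_lt with h | h
    · simp [hv, ← h]
    · apply Real.log_nonneg
      rw [le_div_iff₀ h, one_mul]
      exact le_of_lt hl
  have hv0' : 0 ≤ᵐ[volume.restrict E] v := (ae_restrict_mem hEm).mono hv0
  have hvi : IntegrableOn v E := by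
    refine ⟨hvm.aestronglyMeasurable, ?_⟩
    rw [hasFiniteIntegral_iff_ofReal hv0']
    exact hKn.trans_lt ENNReal.ofReal_lt_top
  have hvint : ∫ l in E, v l ≤ K := by
    rw [integral_eq_lintegral_of_nonneg_ae hv0' hvm.aestronglyMeasurable]
    exact ENNReal.toReal_le_of_le_ofReal hK0 hKn
  have hwi : IntegrableOn w E := by
    refine Measure.integrableOn_of_bounded (M := 1) hEfin hwc.aestronglyMeasurable ?_
    refine Eventually.of_forall fun l => ?_
    rw [Real.norm_of_nonneg (hw0 l)]
    exact hw1 l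
  have hci : IntegrableOn (fun _ : ℂ => Real.log 4) E := integrableOn_const hEfin
  have hpt : ∀ l ∈ E, |Real.log ‖cc d l n‖ - (d : ℝ) ^ (n - 1) * gI l| / (1 + ‖l‖ ^ 2) ^ 2 ≤
      w l * T + (Real.log 4 + v l) := by
    intro l hl
    have hl' : ‖cc d l n‖ < r := hl
    obtain ⟨g0, g1⟩ := gI_bounds d hd l (gI l) (hgI l) n hn (by linarith)
    have hvl := hv0 l hl
    have hb : |Real.log ‖cc d l n‖ - (d : ℝ) ^ (n - 1) * gI l| ≤ T + (Real.log 4 + v l) := by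
      rcases (norm_nonneg (cc d l n)).eq_or_lt with h | h
      · rw [← h, Real.log_zero, zero_sub, abs_neg, abs_of_nonneg g0]
        linarith
      · have : v l = -T - Real.log ‖cc d l n‖ := by
          rw [hv]
          simp only
          rw [Real.log_div hr0.ne' h.ne', hr, Real.log_exp]
        rw [abs_le]
        constructor <;> linarith
    calc _ = |Real.log ‖cc d l n‖ - (d : ℝ) ^ (n - 1) * gI l| * w l := by
          rw [hw]; simp only; rw [mul_one_div]
      _ ≤ (T + (Real.log 4 + v l)) * w l := by gcongr
      _ = w l * T + (Real.log 4 + v l) * w l := by ring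
      _ ≤ w l * T + (Real.log 4 + v l) := by
          have : (Real.log 4 + v l) * w l ≤ Real.log 4 + v l :=
            mul_le_of_le_one_right (by linarith) (hw1 l)
          linarith
  have hmain : ∫ l in E, |Real.log ‖cc d l n‖ - (d : ℝ) ^ (n - 1) * gI l| / (1 + ‖l‖ ^ 2) ^ 2 ≤
      ∫ l in E, (w l * T + (Real.log 4 + v l)) := by
    refine integral_mono_of_nonneg (Eventually.of_forall fun l => by positivity) ?_
      ((ae_restrict_mem hEm).mono hpt)
    exact (hwi.mul_const T).add (hci.add hvi)
  have hsplit : ∫ l in E, (w l * T + (Real.log 4 + v l)) =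
      (∫ l in E, w l) * T + (Real.log 4 * volume.real E + ∫ l in E, v l) := by
    have e1 : ∫ l in E, (w l * T + (Real.log 4 + v l)) =
      (∫ l in E, w l * T) + ∫ l in E, (Real.log 4 + v l) := integral_add (hwi.mul_const T) (hci.add hvi)
    have e2 : ∫ l in E, (Real.log 4 + v l) = (∫ l in E, Real.log 4) + ∫ l in E, v l := integral_add hci hvi
    rw [e1, e2, integral_mul_const, setIntegral_const, smul_eq_mul, mul_comm (volume.real E)]
  rw [hsplit] at hmain
  have hfin : Real.log 4 * volume.real E ≤ Real.log 4 * (9 * π) := by gcongr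
  calc _ ≤ π⁻¹ * ((∫ l in E, w l) * T + (Real.log 4 * (9 * π) + K)) := by
        gcongr
        linarith
    _ = _ := by ring
end Stm9

theorem statement9 (d : ℕ) (hd : 1 < d) (CB : ℝ)
    (hCB : ∀ lam ∈ frontier (Mloc d), ∀ z : ℂ,
      |Real.log (chordInf z ^ d / chordInf (fc d lam z))| ≤ CB)
    (gI : ℂ → ℝ)
    (hgI : ∀ lam : ℂ, Filter.Tendsto
      (fun k : ℕ => (1 / 2) * Real.log (1 + ‖(fc d lam)^[k] 0‖ ^ 2) / (d : ℝ) ^ (k - 1))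
      Filter.atTop (nhds (gI lam))) :
    ∃ C₀ : ℝ, 0 < C₀ ∧ ∀ n : ℕ, 1 ≤ n →
      π⁻¹ * (∫ lam in {l : ℂ | ‖(fc d l)^[n] 0‖ < Real.exp (-(tconst d CB n))},
          |Real.log ‖(fc d lam)^[n] 0‖ - (d : ℝ) ^ (n - 1) * gI lam| / (1 + ‖lam‖ ^ 2) ^ 2)
        ≤ (π⁻¹ * ∫ lam in {l : ℂ | ‖(fc d l)^[n] 0‖ < Real.exp (-(tconst d CB n))},
            1 / (1 + ‖lam‖ ^ 2) ^ 2) * tconst d CB n + C₀ := by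
  have hCB0 : 0 ≤ CB := by
    obtain ⟨lam, hl⟩ := Stm9.frontier_ne d hd
    exact (abs_nonneg _).trans (hCB lam hl 0)
  exact Stm9.core d hd CB hCB0 gI hgI
end
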